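/- Let n ≥ n₀ ∨ n₁. For any link function f in the Hölder ball F(β₀,M), any index θ* ∈ S¹, any r ≥ 1 and any t ∈ [−1/2,1/2]², the data-driven estimator F̂_{(θ̂,ĥ)} produced by the selection rule satisfies the local oracle inequality (E_F|F̂_{(θ̂,ĥ)}(t) − F(t)|^r)^{1/r} ≤ c₁·[ln(n)/(n·h*_{K,f}(tᵀθ*))]^{1/2} + c₂·n^{−1/2}, where c₁ and c₂ are constants independent of n and of F. -/

import Mathlib

open MeasureTheory Real

noncomputable section

namespace SingleIndex

/-- Inner product of two points of `ℝ²`. -/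
def dot2 (a b : Fin 2 → ℝ) : ℝ := a 0 * b 0 + a 1 * b 1

/-- The unit circle `S¹ ⊂ ℝ²`. -/
def S1 : Set (Fin 2 → ℝ) := {θ | θ 0 ^ 2 + θ 1 ^ 2 = 1}

/-- The Hölder ball `F(β₀, M)`: functions with `‖f‖_∞ + Hölder seminorm ≤ M`. -/
def HolderBall (β₀ M : ℝ) : Set (ℝ → ℝ) :=
  {f | ∃ A B : ℝ, A + B ≤ M ∧ (∀ y, |f y| ≤ A) ∧
    ∀ y₁ y₂ : ℝ, |f y₁ - f y₂| ≤ B * |y₁ - y₂| ^ β₀}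

/-- Assumption 4 on the kernel `K`. -/
structure KernelHyp (K : ℝ → ℝ) (Q : ℝ) : Prop where
  supp : ∀ u : ℝ, u ∉ Set.Icc (-(1/2) : ℝ) (1/2) → K u = 0
  norm_one : ∫ u : ℝ, K u = 1
  symm : ∀ u : ℝ, K (-u) = K u
  lip : ∀ u v : ℝ, |K u - K v| ≤ Q * |u - v|

/-- `‖K‖_∞`. -/
def Ksup (K : ℝ → ℝ) : ℝ := ⨆ u : ℝ, |K u|

/-- `‖K‖₁`. -/
def K1 (K : ℝ → ℝ) : ℝ := ∫ u : ℝ, |K u|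

/-- The monotone approximation error `Δ_{K,f}(h,z)`. -/
def Delta (K f : ℝ → ℝ) (h z : ℝ) : ℝ :=
  sSup {v | ∃ δ : ℝ, 0 < δ ∧ δ ≤ h ∧
    v = |δ⁻¹ * ∫ u : ℝ, K ((u - z) / δ) * (f u - f z)|}

/-- The Hardy–Littlewood maximal function `Δ*_{K,f}(h,y)` of `Δ_{K,f}(h,·)`. -/
def DeltaStar (K f : ℝ → ℝ) (h y : ℝ) : ℝ :=
  sSup {v | ∃ a : ℝ, 0 < a ∧
    v = (2 * a)⁻¹ * ∫ z in Set.Icc (y - a) (y + a), Delta K f h z}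

/-- `h_min = n⁻¹ ln^{1+2/ω}(n)`. -/
def hmin (ω : ℝ) (n : ℕ) : ℝ := (n : ℝ)⁻¹ * Real.log n ^ ((1 : ℝ) + 2 / ω)

/-- `𝔥 = √(n⁻¹ ln^{1+1/ω}(n))`. -/
def frakh (ω : ℝ) (n : ℕ) : ℝ := Real.sqrt ((n : ℝ)⁻¹ * Real.log n ^ ((1 : ℝ) + 1 / ω))

/-- The oracle bandwidth `h*_{K,f}(y)`. -/
def hstar (K f : ℝ → ℝ) (ω : ℝ) (n : ℕ) (y : ℝ) : ℝ :=
  sSup {h | h ∈ Set.Icc (hmin ω n) 1 ∧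
    Real.sqrt (n * h) * DeltaStar K f h y ≤ Ksup K * Real.sqrt (Real.log n)}

/-- The minimal sample size `n₀`. -/
def n0 (β₀ M ω : ℝ) : ℕ :=
  sInf {m : ℕ | 1 ≤ m ∧ ∀ n : ℕ, m ≤ n →
    max M 1 * max (frakh ω n ^ β₀) (Real.log n ^ ((1 : ℝ) / ω) * hmin ω n ^ β₀) ≤ 1}

/-- The noise class `𝔓` (Assumption 1): symmetric densities with the prescribed tail bound. -/
def NoiseClass (Υ Ωc ω : ℝ) : Set (ℝ → ℝ) :=
  {p | (∀ y, 0 ≤ p y) ∧ (∫ y : ℝ, p y = 1) ∧ (∀ y, p (-y) = p y) ∧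
    ∀ x : ℝ, 0 ≤ x → ∫ y in Set.Ici x, p y ≤ Υ * Real.exp (-Ωc * x ^ ω)}

/-- Assumption 2 on the design density `g`: a density bounded below by `gl` on `[-3,3]²`. -/
def DesignOK (g : (Fin 2 → ℝ) → ℝ) (gl : ℝ) : Prop :=
  (∀ x, 0 ≤ g x) ∧ (∫ x : Fin 2 → ℝ, g x = 1) ∧
    ∀ x ∈ Set.Icc (fun _ : Fin 2 => (-3 : ℝ)) (fun _ : Fin 2 => (3 : ℝ)), gl ≤ g x

/-- Two-dimensional product kernel `K(u,v) = K(u)K(v)`. -/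
def K2 (K : ℝ → ℝ) (v : Fin 2 → ℝ) : ℝ := K (v 0) * K (v 1)

/-- The matrix `E_{(θ,h)}`. -/
def Emat (θ : Fin 2 → ℝ) (h : ℝ) : Matrix (Fin 2) (Fin 2) ℝ :=
  !![θ 0 / h, θ 1 / h; -θ 1, θ 0]

/-- The matrix `Ē_{(θ,h)(ν,h)}`. -/
def Ebar (θ ν : Fin 2 → ℝ) (h : ℝ) : Matrix (Fin 2) (Fin 2) ℝ :=
  !![(θ 0 + ν 0) / (2 * h * (1 + |dot2 ν θ|)), (θ 1 + ν 1) / (2 * h * (1 + |dot2 ν θ|));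
     -((θ 1 + ν 1) / (2 * (1 + |dot2 ν θ|))), (θ 0 + ν 0) / (2 * (1 + |dot2 ν θ|))]

/-- The matrix `E_{(θ,h)(ν,h)}` with the sign convention. -/
def Epair (θ ν : Fin 2 → ℝ) (h : ℝ) : Matrix (Fin 2) (Fin 2) ℝ :=
  if 0 ≤ dot2 ν θ then Ebar θ ν h else Ebar (-θ) ν h

/-- Generic kernel estimator associated with a matrix `E`, as a function of the data
`d : Fin n → (ℝ² × ℝ)`, `X_i = (d i).1`, `Y_i = (d i).2`. -/
def estM (K : ℝ → ℝ) (g : (Fin 2 → ℝ) → ℝ) (n : ℕ)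
    (E : Matrix (Fin 2) (Fin 2) ℝ) (t : Fin 2 → ℝ)
    (d : Fin n → (Fin 2 → ℝ) × ℝ) : ℝ :=
  (E.det / n) * ∑ i : Fin n, K2 K (E.mulVec ((d i).1 - t)) * (d i).2 / g ((d i).1)

/-- Joint law of a single observation `(X_i, Y_i)` where `Y_i = F(X_i) + ε_i`:
density `g(x) p(y - F(x))` w.r.t. Lebesgue measure on `ℝ² × ℝ`. -/
def jointLaw (g : (Fin 2 → ℝ) → ℝ) (p : ℝ → ℝ) (F : (Fin 2 → ℝ) → ℝ) :
    Measure ((Fin 2 → ℝ) × ℝ) :=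
  volume.withDensity fun z => ENNReal.ofReal (g z.1 * p (z.2 - F z.1))

/-- Law `P_F^{(n)}` of the i.i.d. sample `(X_1,Y_1),…,(X_n,Y_n)`. -/
def dataLaw (n : ℕ) (g : (Fin 2 → ℝ) → ℝ) (p : ℝ → ℝ) (F : (Fin 2 → ℝ) → ℝ) :
    Measure (Fin n → (Fin 2 → ℝ) × ℝ) :=
  Measure.pi fun _ => jointLaw g p F

end SingleIndex
namespace SingleIndex

/-- Parameters of the model and of the procedure. -/
structure Pars where
  /-- the univariate kernel -/
  K : ℝ → ℝ
  /-- Lipschitz constant of the kernel -/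
  Q : ℝ
  /-- the design density -/
  g : (Fin 2 → ℝ) → ℝ
  /-- lower bound of `g` on `[-3,3]²` -/
  gl : ℝ
  /-- tail constant of the noise class -/
  Υ : ℝ
  /-- tail exponent constant `Ω` of the noise class -/
  Ωc : ℝ
  /-- tail power `ω` of the noise class -/
  ω : ℝ
  /-- order of the risk -/
  r : ℝ

/-- `σ² = sup_{p ∈ 𝔓} ∫ x² p(x) dx`. -/
def sigma2 (P : Pars) : ℝ :=
  sSup {v | ∃ p ∈ NoiseClass P.Υ P.Ωc P.ω, v = ∫ x : ℝ, x ^ 2 * p x}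

/-- `τ = (Ω⁻¹(4r+1) ln n)^{1/ω}`. -/
def tauf (P : Pars) (n : ℕ) : ℝ := (P.Ωc⁻¹ * (4 * P.r + 1) * Real.log n) ^ ((1 : ℝ) / P.ω)

/-- The quantity `c₁(n)`. -/
def c1f (P : Pars) (n : ℕ) : ℝ :=
  730 * Real.log (16 * (n : ℝ) ^ 2 * P.gl ^ (-(1/2) : ℝ) * (12 * P.Q + Real.sqrt 2))
    + 8 * P.r * Real.log n + 394

/-- The quantity `c₂(n)`. -/
def c2f (P : Pars) (n : ℕ) : ℝ :=
  730 * Real.log (16 * (n : ℝ) ^ 2 * tauf P n * P.gl ^ (-(1/2) : ℝ) * (12 * P.Q + Real.sqrt 2))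
    + 8 * P.r * Real.log n + 394

/-- The quantity `c₃(n)`. -/
def c3f (P : Pars) (n : ℕ) : ℝ :=
  365 * Real.log (5 * (n : ℝ) ^ 2 * P.Q * P.gl ^ (-(1/2) : ℝ)) + 8 * P.r * Real.log n + 197

/-- The quantity `c₄(n)`. -/
def c4f (P : Pars) (n : ℕ) : ℝ :=
  365 * Real.log (5 * (n : ℝ) ^ 2 * tauf P n * P.Q * P.gl ^ (-(1/2) : ℝ))
    + 8 * P.r * Real.log n + 197

/-- The constant `C₁(n)`. -/
def C1f (P : Pars) (n : ℕ) : ℝ :=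
  2 * Real.sqrt 2 * P.gl ^ (-(1/2) : ℝ) * Ksup P.K ^ 2 * Real.sqrt (c1f P n)
    + 8 / 3 * c1f P n * Real.log n ^ (-((2 + P.ω) / (2 * P.ω))) * P.gl⁻¹ * Ksup P.K ^ 2

/-- The constant `C₂(n)`. -/
def C2f (P : Pars) (n : ℕ) : ℝ :=
  2 * Real.sqrt 2 * max (Real.sqrt (sigma2 P)) 1 * P.gl ^ (-(1/2) : ℝ) * Ksup P.K ^ 2
      * Real.sqrt (c2f P n)
    + 8 / 3 * c2f P n * Real.log n ^ (-(1/2) : ℝ) * P.gl⁻¹ * Ksup P.K ^ 2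
      * (P.Ωc⁻¹ * (4 * P.r + 1)) ^ ((1 : ℝ) / P.ω)

/-- The constant `C₃(n)`. -/
def C3f (P : Pars) (n : ℕ) : ℝ :=
  2 * Real.sqrt 2 * P.gl ^ (-(1/2) : ℝ) * Ksup P.K ^ 2 * Real.sqrt (c3f P n)
    + 8 / 3 * P.gl⁻¹ * Ksup P.K ^ 2 * c3f P n * ((n : ℝ) * frakh P.ω n ^ 2) ^ (-(1/2) : ℝ)

/-- The constant `C₄(n)`. -/
def C4f (P : Pars) (n : ℕ) : ℝ :=
  2 * Real.sqrt 2 * max (Real.sqrt (sigma2 P)) 1 * P.gl ^ (-(1/2) : ℝ) * Ksup P.K ^ 2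
      * Real.sqrt (c4f P n)
    + 8 / 3 * tauf P n * c4f P n * ((n : ℝ) * frakh P.ω n ^ 2) ^ (-(1/2) : ℝ)
      * P.gl⁻¹ * Ksup P.K ^ 2

/-- The constant `C₅(n)`. -/
def C5f (P : Pars) (n : ℕ) : ℝ :=
  K1 P.K ^ 2 + ((n : ℝ) * frakh P.ω n ^ 2) ^ (-(1/2) : ℝ) * C4f P n + 1 / 2

/-- `n₁`: the minimal sample size linked to `(n𝔥²)^{-1/2} C₃(n) ≤ 1/2`. -/
def n1 (P : Pars) : ℕ :=
  sInf {m : ℕ | 1 ≤ m ∧ ∀ n : ℕ, m ≤ n →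
    ((n : ℝ) * frakh P.ω n ^ 2) ^ (-(1/2) : ℝ) * C3f P n ≤ 1 / 2}

/-- The auxiliary estimator `F̂(v)` with bandwidth `𝔥`. -/
def FhatAux (P : Pars) (n : ℕ) (d : Fin n → (Fin 2 → ℝ) × ℝ) (v : Fin 2 → ℝ) : ℝ :=
  (n : ℝ)⁻¹ * ∑ i : Fin n, (P.g ((d i).1))⁻¹ * (frakh P.ω n) ^ (-2 : ℤ) *
    P.K (((d i).1 0 - v 0) / frakh P.ω n) * P.K (((d i).1 1 - v 1) / frakh P.ω n) * (d i).2

/-- `F̂_∞ = 2 sup_{v ∈ [-5/2,5/2]²} |F̂(v)| + 2C₅(n)`. -/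
def FhatInf (P : Pars) (n : ℕ) (d : Fin n → (Fin 2 → ℝ) × ℝ) : ℝ :=
  2 * sSup {w | ∃ v ∈ Set.Icc (fun _ : Fin 2 => -(5/2 : ℝ)) (fun _ : Fin 2 => (5/2 : ℝ)),
      w = |FhatAux P n d v|}
    + 2 * C5f P n

/-- The random threshold `TH(η)`. -/
def TH (P : Pars) (n : ℕ) (d : Fin n → (Fin 2 → ℝ) × ℝ) (η : ℝ) : ℝ :=
  2 * (Ksup P.K ^ 2 * Real.sqrt (Real.log n) + FhatInf P n d * C1f P n + C2f P n)
    * (η * n) ^ (-(1/2) : ℝ)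

/-- The dyadic bandwidth grid `H_n = {2^{-k} : k ∈ ℕ} ∩ [h_min/2, 1]`. -/
def Hgrid (ω : ℝ) (n : ℕ) : Set ℝ :=
  {h | (∃ k : ℕ, h = (2 : ℝ) ^ (-(k : ℤ))) ∧ hmin ω n / 2 ≤ h ∧ h ≤ 1}

/-- The quantity `R^{(1)}_t(θ,h)`. -/
def R1 (P : Pars) (n : ℕ) (t : Fin 2 → ℝ) (θ : Fin 2 → ℝ) (h : ℝ)
    (d : Fin n → (Fin 2 → ℝ) × ℝ) : ℝ :=
  sSup {v | ∃ η ∈ Hgrid P.ω n, η ≤ h ∧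
    v = max (sSup {w | ∃ ν ∈ S1,
          w = |estM P.K P.g n (Epair θ ν η) t d - estM P.K P.g n (Emat ν η) t d|}
        - TH P n d η) 0}

/-- The quantity `R^{(2)}_t(h)`. -/
def R2 (P : Pars) (n : ℕ) (t : Fin 2 → ℝ) (h : ℝ)
    (d : Fin n → (Fin 2 → ℝ) × ℝ) : ℝ :=
  sSup {v | ∃ η ∈ Hgrid P.ω n, η ≤ h ∧
    v = max (sSup {w | ∃ θ ∈ S1,
          w = |estM P.K P.g n (Emat θ h) t d - estM P.K P.g n (Emat θ η) t d|}
        - TH P n d η) 0}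

/-- `(θ̂, ĥ)`, as a function of the data, is a solution of the minimization problem
(2.5) defining the selection rule at the point `t`. -/
def IsSelector (P : Pars) (n : ℕ) (t : Fin 2 → ℝ)
    (sel : (Fin n → (Fin 2 → ℝ) × ℝ) → (Fin 2 → ℝ) × ℝ) : Prop :=
  ∀ d, (sel d).1 ∈ S1 ∧ (sel d).2 ∈ Hgrid P.ω n ∧
    ∀ θ ∈ S1, ∀ h ∈ Hgrid P.ω n,
      R1 P n t (sel d).1 (sel d).2 d + R2 P n t (sel d).2 d + TH P n d (sel d).2
        ≤ R1 P n t θ h d + R2 P n t h d + TH P n d h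

/-- The selected estimator `F̂_{(θ̂,ĥ)}(t)` as a function of the data. -/
def selEst (P : Pars) (n : ℕ) (t : Fin 2 → ℝ)
    (sel : (Fin n → (Fin 2 → ℝ) × ℝ) → (Fin 2 → ℝ) × ℝ)
    (d : Fin n → (Fin 2 → ℝ) × ℝ) : ℝ :=
  estM P.K P.g n (Emat (sel d).1 (sel d).2) t d

end SingleIndex

namespace SingleIndex

/-- Second-order bound for the moment generating function of a bounded function. -/
theorem integral_exp_le {Z : Type*} [MeasurableSpace Z] {μ : Measure Z} [IsProbabilityMeasure μ]
    {φ : Z → ℝ} (hφ : AEStronglyMeasurable φ μ) {B V l : ℝ} (hB : ∀ z, |φ z| ≤ B)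
    (hV : ∫ z, φ z ^ 2 ∂μ ≤ V) (hlB : |l| * B ≤ 1) :
    ∫ z, exp (l * φ z) ∂μ ≤ exp (l * (∫ z, φ z ∂μ) + l ^ 2 * V) := by
  have hl : ∀ z, |l * φ z| ≤ 1 := fun z => by
    rw [abs_mul]
    exact (mul_le_mul_of_nonneg_left (hB z) (abs_nonneg _)).trans hlB
  have i1 : Integrable φ μ :=
    Integrable.of_bound hφ B (Filter.Eventually.of_forall fun z => by simpa using hB z)
  have i2 : Integrable (fun z => φ z ^ 2) μ :=
    Integrable.of_bound (hφ.pow 2) (B ^ 2) (Filter.Eventually.of_forall fun z => by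
      have := pow_le_pow_left₀ (abs_nonneg _) (hB z) 2
      simpa using this)
  have i3 : Integrable (fun z => exp (l * φ z)) μ :=
    Integrable.of_bound (continuous_exp.comp_aestronglyMeasurable (hφ.const_mul l)) (exp 1)
      (Filter.Eventually.of_forall fun z => by
        simpa using (le_abs_self _).trans (hl z))
  have i4 : Integrable (fun z => 1 + l * φ z) μ := (integrable_const _).add (i1.const_mul l)
  calc ∫ z, exp (l * φ z) ∂μ ≤ ∫ z, (1 + l * φ z + l ^ 2 * φ z ^ 2) ∂μ := by
        refine integral_mono i3 (i4.add (i2.const_mul _)) fun z => ?_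
        have := (abs_le.1 (abs_exp_sub_one_sub_id_le (hl z))).2
        simp only
        nlinarith
    _ = 1 + l * (∫ z, φ z ∂μ) + l ^ 2 * (∫ z, φ z ^ 2 ∂μ) := by
        rw [integral_add i4 (i2.const_mul _),
          integral_add (integrable_const _) (i1.const_mul l), integral_const_mul,
          integral_const_mul]
        simp
    _ ≤ 1 + l * (∫ z, φ z ∂μ) + l ^ 2 * V := by gcongr
    _ ≤ _ := by
        have := add_one_le_exp (l * (∫ z, φ z ∂μ) + l ^ 2 * V)
        linarith

/-- Chernoff bound for the sum of a bounded function over an i.i.d. sample. -/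
theorem measure_sum_ge_le {Z : Type*} [MeasurableSpace Z] {μ : Measure Z} [IsProbabilityMeasure μ]
    {φ : Z → ℝ} (hφ : AEStronglyMeasurable φ μ) {B V l : ℝ} (hB : ∀ z, |φ z| ≤ B)
    (hV : ∫ z, φ z ^ 2 ∂μ ≤ V) (hl : 0 ≤ l) (hlB : l * B ≤ 1) (n : ℕ) (s : ℝ) :
    (Measure.pi fun _ : Fin n => μ) {d | s ≤ ∑ i, φ (d i) - n * ∫ z, φ z ∂μ}
      ≤ ENNReal.ofReal (exp (n * (l ^ 2 * V) - l * s)) := by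
  set m := ∫ z, φ z ∂μ
  set ν := Measure.pi fun _ : Fin n => μ
  have hmeas : AEStronglyMeasurable (fun d : Fin n → Z => ∑ i, φ (d i)) ν := by
    refine Finset.aestronglyMeasurable_fun_sum _ fun i _ => ?_
    exact hφ.comp_quasiMeasurePreserving (Measure.quasiMeasurePreserving_eval (fun _ => μ) i)
  have hint : Integrable (fun d : Fin n → Z => exp (l * ∑ i, φ (d i))) ν := by
    refine Integrable.of_bound (continuous_exp.comp_aestronglyMeasurable (hmeas.const_mul l))
      (exp (l * (n * B))) (Filter.Eventually.of_forall fun d => ?_)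
    rw [norm_of_nonneg (exp_pos _).le]
    refine exp_le_exp.2 (mul_le_mul_of_nonneg_left ?_ hl)
    calc ∑ i, φ (d i) ≤ ∑ _i : Fin n, B := Finset.sum_le_sum fun i _ => (le_abs_self _).trans (hB _)
      _ = n * B := by simp
  have h1 := ProbabilityTheory.measure_ge_le_exp_mul_mgf (μ := ν) (s + n * m) hl hint
  have h2 : ProbabilityTheory.mgf (fun d : Fin n → Z => ∑ i, φ (d i)) ν l
      = (∫ z, exp (l * φ z) ∂μ) ^ n := by
    rw [ProbabilityTheory.mgf]
    have := integral_fintype_prod_eq_pow (ι := Fin n) (𝕜 := ℝ) (fun z => exp (l * φ z)) (μ := μ)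
    rw [Fintype.card_fin] at this
    rw [← this]
    simp only [← exp_sum, Finset.mul_sum]
    rfl
  have h3 : (∫ z, exp (l * φ z) ∂μ) ^ n ≤ exp (l * m + l ^ 2 * V) ^ n := by
    refine pow_le_pow_left₀ (integral_nonneg fun z => (exp_pos _).le) ?_ n
    exact integral_exp_le hφ hB hV (by rwa [abs_of_nonneg hl])
  have h4 : {d : Fin n → Z | s ≤ ∑ i, φ (d i) - n * m} = {d | s + n * m ≤ ∑ i, φ (d i)} := by
    ext d
    simp only [Set.mem_ofPred_eq]
    constructor <;> intro h <;> linarith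
  rw [h4, ← ofReal_measureReal]
  refine ENNReal.ofReal_le_ofReal (h1.trans ?_)
  rw [h2]
  refine (mul_le_mul_of_nonneg_left h3 (exp_pos _).le).trans ?_
  rw [← exp_nat_mul, ← exp_add]
  exact exp_le_exp.2 (le_of_eq (by ring))

/-- One-sided Bernstein inequality. -/
theorem measure_bernstein_le {Z : Type*} [MeasurableSpace Z] {μ : Measure Z}
    [IsProbabilityMeasure μ] {φ : Z → ℝ} (hφ : AEStronglyMeasurable φ μ) {B V x : ℝ}
    (hB : ∀ z, |φ z| ≤ B) (hV : ∫ z, φ z ^ 2 ∂μ ≤ V) (hB0 : 0 < B) (hV0 : 0 < V) (hx : 0 < x)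
    {n : ℕ} (hn : 0 < n) :
    (Measure.pi fun _ : Fin n => μ)
        {d | 2 * √(x * V / n) + x * B / n ≤ (n : ℝ)⁻¹ * ∑ i, φ (d i) - ∫ z, φ z ∂μ}
      ≤ ENNReal.ofReal (exp (-x)) := by
  have hn' : (0 : ℝ) < n := by exact_mod_cast hn
  set q := √(x / (n * V)) with hq
  have hq0 : 0 < q := sqrt_pos.2 (by positivity)
  have hq2 : q ^ 2 = x / (n * V) := sq_sqrt (by positivity)
  have hroot : √(x * V / n) = q * V := by
    rw [show x * V / n = (q * V) ^ 2 by rw [mul_pow, hq2]; field_simp, sqrt_sq (by positivity)]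
  have hset : {d : Fin n → Z | 2 * √(x * V / n) + x * B / n
        ≤ (n : ℝ)⁻¹ * ∑ i, φ (d i) - ∫ z, φ z ∂μ}
      = {d | 2 * n * q * V + x * B ≤ ∑ i, φ (d i) - n * ∫ z, φ z ∂μ} := by
    ext d
    simp only [Set.mem_ofPred_eq]
    rw [hroot, ← mul_le_mul_iff_right₀ hn']
    have e1 : (n : ℝ) * (2 * (q * V) + x * B / n) = 2 * n * q * V + x * B := by field_simp
    have e2 : (n : ℝ) * ((n : ℝ)⁻¹ * ∑ i, φ (d i) - ∫ z, φ z ∂μ)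
        = ∑ i, φ (d i) - n * ∫ z, φ z ∂μ := by field_simp
    rw [e1, e2]
  rw [hset]
  have hnv : n * V * q ^ 2 = x := by rw [hq2]; field_simp
  rcases le_total (q * B) 1 with h | h
  · refine (measure_sum_ge_le hφ hB hV hq0.le h n _).trans
      (ENNReal.ofReal_le_ofReal (exp_le_exp.2 ?_))
    have : 0 < q * (x * B) := by positivity
    nlinarith
  · have hl : 1 / B * B ≤ 1 := by rw [one_div_mul_cancel hB0.ne']
    refine (measure_sum_ge_le hφ hB hV (by positivity) hl n _).trans
      (ENNReal.ofReal_le_ofReal (exp_le_exp.2 ?_))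
    have e : 1 / B * (2 * n * q * V + x * B) = 2 * (n * V * q) / B + x := by field_simp
    have e2 : n * ((1 / B) ^ 2 * V) ≤ n * V * q / B := by
      rw [show n * ((1 / B) ^ 2 * V) = n * V / B * (1 / B) by ring,
        show n * V * q / B = n * V / B * q by ring]
      refine mul_le_mul_of_nonneg_left ?_ (by positivity)
      rwa [div_le_iff₀ hB0]
    have : 0 < n * V * q / B := by positivity
    rw [e]
    have e3 : 2 * (n * V * q) / B = 2 * (n * V * q / B) := by ring
    linarith

/-- Two-sided Bernstein inequality, uniform over a finite family. -/
theorem measure_finset_bernstein_le {Z ι : Type*} [MeasurableSpace Z] {μ : Measure Z}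
    [IsProbabilityMeasure μ] (s : Finset ι) {φ : ι → Z → ℝ}
    (hφ : ∀ a ∈ s, AEStronglyMeasurable (φ a) μ) {B V x : ℝ}
    (hB : ∀ a ∈ s, ∀ z, |φ a z| ≤ B) (hV : ∀ a ∈ s, ∫ z, φ a z ^ 2 ∂μ ≤ V)
    (hB0 : 0 < B) (hV0 : 0 < V) (hx : 0 < x) {n : ℕ} (hn : 0 < n) :
    (Measure.pi fun _ : Fin n => μ)
        {d | ∃ a ∈ s, 2 * √(x * V / n) + x * B / n
          ≤ |(n : ℝ)⁻¹ * ∑ i, φ a (d i) - ∫ z, φ a z ∂μ|}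
      ≤ ENNReal.ofReal (2 * s.card * exp (-x)) := by
  set ν := Measure.pi fun _ : Fin n => μ
  set T := 2 * √(x * V / n) + x * B / n
  have hsub : {d : Fin n → Z | ∃ a ∈ s, T ≤ |(n : ℝ)⁻¹ * ∑ i, φ a (d i) - ∫ z, φ a z ∂μ|}
      ⊆ ⋃ a ∈ s, ({d | T ≤ (n : ℝ)⁻¹ * ∑ i, φ a (d i) - ∫ z, φ a z ∂μ}
        ∪ {d | T ≤ (n : ℝ)⁻¹ * ∑ i, (-φ a (d i)) - ∫ z, (-φ a z) ∂μ}) := by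
    rintro d ⟨a, ha, h⟩
    simp only [Set.mem_iUnion, Set.mem_union, Set.mem_ofPred_eq]
    refine ⟨a, ha, ?_⟩
    rw [Finset.sum_neg_distrib, integral_neg]
    rcases le_abs.1 h with h | h
    · exact Or.inl h
    · right; linarith
  refine (measure_mono hsub).trans ((measure_biUnion_finset_le s _).trans ?_)
  calc _ ≤ ∑ _a ∈ s, ENNReal.ofReal (2 * exp (-x)) := by
        refine Finset.sum_le_sum fun a ha => (measure_union_le _ _).trans ?_
        rw [two_mul, ENNReal.ofReal_add (exp_pos _).le (exp_pos _).le]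
        refine add_le_add (measure_bernstein_le (hφ a ha) (hB a ha) (hV a ha) hB0 hV0 hx hn)
          (measure_bernstein_le (φ := fun z => -φ a z) (hφ a ha).neg
            (fun z => by simpa using hB a ha z) (by simpa using hV a ha) hB0 hV0 hx hn)
    _ = _ := by
        rw [Finset.sum_const, nsmul_eq_mul, ← ENNReal.ofReal_natCast,
          ← ENNReal.ofReal_mul (by positivity)]
        congr 1; ring

namespace KernelHyp

variable {K : ℝ → ℝ} {Q : ℝ}

theorem Q_nonneg (hK : KernelHyp K Q) : 0 ≤ Q := by
  have := (abs_nonneg _).trans (hK.lip 1 0)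
  simpa using this

theorem cont (hK : KernelHyp K Q) : Continuous K := by
  refine (LipschitzWith.of_dist_le_mul (K := Q.toNNReal) fun u v => ?_).continuous
  rw [Real.dist_eq, Real.dist_eq, Real.coe_toNNReal _ hK.Q_nonneg]
  exact hK.lip u v

theorem eq_zero (hK : KernelHyp K Q) {u : ℝ} (hu : 1 / 2 < |u|) : K u = 0 := by
  refine hK.supp u fun h => ?_
  rw [Set.mem_Icc, ← abs_le] at h
  linarith

theorem abs_le_of_ne_zero (hK : KernelHyp K Q) {u : ℝ} (hu : K u ≠ 0) : |u| ≤ 1 / 2 := by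
  by_contra h
  exact hu (hK.eq_zero (not_le.1 h))

theorem abs_le_mul_Q (hK : KernelHyp K Q) (u : ℝ) : |K u| ≤ 2 * Q := by
  have hQ := hK.Q_nonneg
  by_cases hu : K u = 0
  · rw [hu, abs_zero]; positivity
  · have h1 := hK.lip u 1
    rw [hK.eq_zero (u := 1) (by norm_num), sub_zero] at h1
    have h2 := abs_le.1 (hK.abs_le_of_ne_zero hu)
    have h3 : |u - 1| ≤ 2 := abs_le.2 ⟨by linarith [h2.1], by linarith [h2.2]⟩
    nlinarith

theorem bddAbove (hK : KernelHyp K Q) : BddAbove (Set.range fun u => |K u|) :=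
  ⟨2 * Q, by rintro _ ⟨u, rfl⟩; exact hK.abs_le_mul_Q u⟩

theorem abs_le_Ksup (hK : KernelHyp K Q) (u : ℝ) : |K u| ≤ Ksup K := le_ciSup hK.bddAbove u

theorem Ksup_le (hK : KernelHyp K Q) : Ksup K ≤ 2 * Q := ciSup_le hK.abs_le_mul_Q

theorem hasCompactSupport (hK : KernelHyp K Q) : HasCompactSupport K :=
  HasCompactSupport.intro (K := Set.Icc (-(1/2) : ℝ) (1/2)) isCompact_Icc fun u hu => hK.supp u hu

theorem integrable (hK : KernelHyp K Q) : Integrable K :=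
  hK.cont.integrable_of_hasCompactSupport hK.hasCompactSupport

/-- Integrals against a function dominated by a multiple of the indicator of the support. -/
theorem integral_le_of_le (G : ℝ → ℝ) {C : ℝ} (hG : ∀ u, |u| ≤ 1 / 2 → G u ≤ C)
    (hG0 : ∀ u, 1 / 2 < |u| → G u = 0) (hGi : Integrable G) : ∫ u, G u ≤ C := by
  have h : ∫ u, G u = ∫ u in Set.Icc (-(1/2) : ℝ) (1/2), G u := by
    refine (setIntegral_eq_integral_of_forall_compl_eq_zero fun u hu => hG0 u ?_).symm
    rw [Set.mem_Icc, ← abs_le] at hu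
    exact not_le.1 hu
  rw [h]
  calc _ ≤ ∫ _u in Set.Icc (-(1/2) : ℝ) (1/2), C := by
        refine setIntegral_mono_on hGi.integrableOn (by simp) measurableSet_Icc fun u hu => hG u ?_
        rw [abs_le]; exact hu
    _ = C := by
        simp only [integral_const, MeasurableSet.univ, measureReal_restrict_apply, Set.univ_inter,
          Real.volume_real_Icc, smul_eq_mul]
        norm_num

theorem one_le_K1 (hK : KernelHyp K Q) : 1 ≤ K1 K := by
  rw [← hK.norm_one]
  exact integral_mono hK.integrable hK.integrable.abs fun u => le_abs_self _

theorem K1_le (hK : KernelHyp K Q) : K1 K ≤ Ksup K :=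
  integral_le_of_le _ (fun u _ => hK.abs_le_Ksup u) (fun u hu => by simp [hK.eq_zero hu])
    hK.integrable.abs

theorem one_le_Ksup (hK : KernelHyp K Q) : 1 ≤ Ksup K := hK.one_le_K1.trans hK.K1_le

theorem half_le_Q (hK : KernelHyp K Q) : 1 / 2 ≤ Q := by
  linarith [hK.one_le_Ksup, hK.Ksup_le]

theorem integrable_sq (hK : KernelHyp K Q) : Integrable fun u => K u ^ 2 :=
  (hK.cont.pow 2).integrable_of_hasCompactSupport
    (HasCompactSupport.intro (K := Set.Icc (-(1/2) : ℝ) (1/2)) isCompact_Icc fun u hu => by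
      simp [hK.supp u hu])

theorem integral_sq_le (hK : KernelHyp K Q) : ∫ u, K u ^ 2 ≤ Ksup K ^ 2 :=
  integral_le_of_le _ (fun u _ => by
    rw [← sq_abs]; exact pow_le_pow_left₀ (abs_nonneg _) (hK.abs_le_Ksup u) 2)
    (fun u hu => by simp [hK.eq_zero hu]) hK.integrable_sq

end KernelHyp

/-- The law of the design. -/
def designM (g : (Fin 2 → ℝ) → ℝ) : Measure (Fin 2 → ℝ) :=
  volume.withDensity fun x => ENNReal.ofReal (g x)

/-- The law of the noise. -/
def noiseM (p : ℝ → ℝ) : Measure ℝ := volume.withDensity fun x => ENNReal.ofReal (p x)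

theorem isProbabilityMeasure_withDensity_ofReal {X : Type*} [MeasurableSpace X] {μ : Measure X}
    {g : X → ℝ} (h0 : ∀ x, 0 ≤ g x) (h1 : ∫ x, g x ∂μ = 1) :
    IsProbabilityMeasure (μ.withDensity fun x => ENNReal.ofReal (g x)) := by
  have hi : Integrable g μ := by
    by_contra h
    rw [integral_undef h] at h1
    exact zero_ne_one h1
  constructor
  rw [withDensity_apply _ MeasurableSet.univ, Measure.restrict_univ,
    ← ofReal_integral_eq_lintegral_ofReal hi (Filter.Eventually.of_forall h0), h1,
    ENNReal.ofReal_one]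

theorem aemeasurable_of_integral_eq_one {X : Type*} [MeasurableSpace X] {μ : Measure X}
    {g : X → ℝ} (h1 : ∫ x, g x ∂μ = 1) : AEMeasurable g μ := by
  by_contra h
  rw [integral_undef fun hi => h hi.aestronglyMeasurable.aemeasurable] at h1
  exact zero_ne_one h1

theorem integral_withDensity_ofReal {X : Type*} [MeasurableSpace X] {μ : Measure X}
    {g : X → ℝ} (h0 : ∀ x, 0 ≤ g x) (hm : AEMeasurable g μ) (a : X → ℝ) :
    ∫ x, a x ∂(μ.withDensity fun x => ENNReal.ofReal (g x)) = ∫ x, g x * a x ∂μ := by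
  rw [integral_withDensity_eq_integral_toReal_smul₀ hm.ennreal_ofReal (by simp)]
  simp [ENNReal.toReal_ofReal (h0 _)]

/-- The map `(x, e) ↦ (x, e + F x)`. -/
def shear (F : (Fin 2 → ℝ) → ℝ) (hF : Measurable F) :
    (Fin 2 → ℝ) × ℝ ≃ᵐ (Fin 2 → ℝ) × ℝ where
  toFun z := (z.1, z.2 + F z.1)
  invFun z := (z.1, z.2 - F z.1)
  left_inv z := by simp
  right_inv z := by simp
  measurable_toFun := by
    exact measurable_fst.prodMk (measurable_snd.add (hF.comp measurable_fst))
  measurable_invFun := by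
    exact measurable_fst.prodMk (measurable_snd.sub (hF.comp measurable_fst))

theorem measurePreserving_shear (F : (Fin 2 → ℝ) → ℝ) (hF : Measurable F) :
    MeasurePreserving (shear F hF) volume volume := by
  refine (MeasurePreserving.id (volume : Measure (Fin 2 → ℝ))).skew_product
    (g := fun (x : Fin 2 → ℝ) (e : ℝ) => e + F x) ?_ ?_
  · exact measurable_snd.add (hF.comp measurable_fst)
  · exact Filter.Eventually.of_forall fun x => (measurePreserving_add_right volume (F x)).map_eq

theorem jointLaw_eq_map {g : (Fin 2 → ℝ) → ℝ} {p : ℝ → ℝ} (hg : AEMeasurable g)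
    (hg0 : ∀ x, 0 ≤ g x) (hp : AEMeasurable p) (F : (Fin 2 → ℝ) → ℝ) (hF : Measurable F) :
    jointLaw g p F = ((designM g).prod (noiseM p)).map (shear F hF) := by
  rw [designM, noiseM, prod_withDensity₀ hg.ennreal_ofReal hp.ennreal_ofReal]
  refine Measure.ext fun s hs => ?_
  rw [MeasurableEquiv.map_apply, jointLaw, withDensity_apply _ hs,
    withDensity_apply _ ((shear F hF).measurable hs),
    ← (measurePreserving_shear F hF).setLIntegral_comp_preimage_emb
      (shear F hF).measurableEmbedding]
  refine lintegral_congr fun z => ?_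
  have : (shear F hF z).2 - F (shear F hF z).1 = z.2 := by simp [shear]
  rw [this, ENNReal.ofReal_mul (hg0 _)]
  rfl

section Joint

variable {g : (Fin 2 → ℝ) → ℝ} {p : ℝ → ℝ} {gl Υ Ωc ω : ℝ} {F : (Fin 2 → ℝ) → ℝ}

theorem isProbabilityMeasure_jointLaw (hg : DesignOK g gl) (hp : p ∈ NoiseClass Υ Ωc ω)
    (hF : Measurable F) : IsProbabilityMeasure (jointLaw g p F) := by
  have h1 : IsProbabilityMeasure (designM g) :=
    isProbabilityMeasure_withDensity_ofReal hg.1 hg.2.1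
  have h2 : IsProbabilityMeasure (noiseM p) :=
    isProbabilityMeasure_withDensity_ofReal hp.1 hp.2.1
  rw [jointLaw_eq_map (aemeasurable_of_integral_eq_one hg.2.1) hg.1
    (aemeasurable_of_integral_eq_one hp.2.1) F hF]
  exact Measure.isProbabilityMeasure_map (shear F hF).measurable.aemeasurable

/-- The design and the noise are independent under the joint law. -/
theorem integral_jointLaw_mul (hg : DesignOK g gl) (hp : p ∈ NoiseClass Υ Ωc ω)
    (hF : Measurable F) (a : (Fin 2 → ℝ) → ℝ) (c : ℝ → ℝ) :
    ∫ z, a z.1 * c (z.2 - F z.1) ∂(jointLaw g p F) = (∫ x, g x * a x) * ∫ e, p e * c e := by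
  have h1 : IsProbabilityMeasure (designM g) :=
    isProbabilityMeasure_withDensity_ofReal hg.1 hg.2.1
  have h2 : IsProbabilityMeasure (noiseM p) :=
    isProbabilityMeasure_withDensity_ofReal hp.1 hp.2.1
  rw [jointLaw_eq_map (aemeasurable_of_integral_eq_one hg.2.1) hg.1
    (aemeasurable_of_integral_eq_one hp.2.1) F hF, integral_map_equiv]
  rw [← integral_withDensity_ofReal hg.1 (aemeasurable_of_integral_eq_one hg.2.1),
    ← integral_withDensity_ofReal hp.1 (aemeasurable_of_integral_eq_one hp.2.1)]
  rw [← integral_prod_mul]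
  simp [shear, designM, noiseM]

theorem lintegral_jointLaw_snd (hg : DesignOK g gl) (hp : p ∈ NoiseClass Υ Ωc ω)
    (hF : Measurable F) {c : ℝ → ENNReal} (hc : Measurable c) :
    ∫⁻ z, c (z.2 - F z.1) ∂(jointLaw g p F) = ∫⁻ e, c e ∂(noiseM p) := by
  have h1 : IsProbabilityMeasure (designM g) :=
    isProbabilityMeasure_withDensity_ofReal hg.1 hg.2.1
  have h2 : IsProbabilityMeasure (noiseM p) :=
    isProbabilityMeasure_withDensity_ofReal hp.1 hp.2.1
  rw [jointLaw_eq_map (aemeasurable_of_integral_eq_one hg.2.1) hg.1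
    (aemeasurable_of_integral_eq_one hp.2.1) F hF, lintegral_map_equiv]
  have : ∀ z : (Fin 2 → ℝ) × ℝ, (shear F hF z).2 - F (shear F hF z).1 = z.2 := by simp [shear]
  simp only [this]
  rw [lintegral_prod _ (by fun_prop)]
  simp

theorem aestronglyMeasurable_jointLaw (hF : Measurable F) {a : (Fin 2 → ℝ) → ℝ} {c : ℝ → ℝ}
    (ha : AEMeasurable a) (hc : Measurable c) :
    AEStronglyMeasurable (fun z : (Fin 2 → ℝ) × ℝ => a z.1 * c (z.2 - F z.1))
      (jointLaw g p F) := by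
  have h : AEMeasurable (fun z : (Fin 2 → ℝ) × ℝ => a z.1 * c (z.2 - F z.1))
      (volume : Measure ((Fin 2 → ℝ) × ℝ)) := by
    refine AEMeasurable.mul ?_ ?_
    · exact ha.comp_quasiMeasurePreserving Measure.quasiMeasurePreserving_fst
    · exact (hc.comp (measurable_snd.sub (hF.comp measurable_fst))).aemeasurable
  exact (h.mono_ac (withDensity_absolutelyContinuous _ _)).aestronglyMeasurable

end Joint

section Noise

variable {Υ Ωc ω : ℝ} {p : ℝ → ℝ}

theorem integrable_of_mem_NoiseClass (hp : p ∈ NoiseClass Υ Ωc ω) : Integrable p := by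
  by_contra h
  have := hp.2.1
  rw [integral_undef h] at this
  exact zero_ne_one this

theorem noiseM_tail_le (hp : p ∈ NoiseClass Υ Ωc ω) {x : ℝ} (hx : 0 ≤ x) :
    noiseM p {e | x ≤ |e|} ≤ ENNReal.ofReal (2 * Υ * exp (-Ωc * x ^ ω)) := by
  have hi := integrable_of_mem_NoiseClass hp
  have hset : {e : ℝ | x ≤ |e|} = Set.Iic (-x) ∪ Set.Ici x := by
    ext e
    simp only [Set.mem_ofPred_eq, Set.mem_union, Set.mem_Iic, Set.mem_Ici, le_abs]
    constructor
    · rintro (h | h)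
      · exact Or.inr h
      · left; linarith
    · rintro (h | h)
      · right; linarith
      · exact Or.inl h
  have key : ∀ s : Set ℝ, MeasurableSet s → noiseM p s = ENNReal.ofReal (∫ e in s, p e) := by
    intro s hs
    rw [noiseM, withDensity_apply _ hs,
      ofReal_integral_eq_lintegral_ofReal hi.integrableOn (Filter.Eventually.of_forall hp.1)]
  have hsym : ∫ e in Set.Iic (-x), p e = ∫ e in Set.Ici x, p e := by
    rw [integral_Ici_eq_integral_Ioi]
    have := integral_comp_neg_Iic (-x) p
    rw [neg_neg] at this
    rw [← this]
    simp only [hp.2.2.1]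
  rw [hset]
  refine (measure_union_le _ _).trans ?_
  rw [key _ measurableSet_Iic, key _ measurableSet_Ici, hsym,
    ← ENNReal.ofReal_add (integral_nonneg hp.1) (integral_nonneg hp.1)]
  have := hp.2.2.2 x hx
  exact ENNReal.ofReal_le_ofReal (by linarith)

/-- The noise class has uniformly bounded moments of every positive order. -/
theorem exists_noise_moment_le (hΥ : 0 < Υ) (hΩ : 0 < Ωc) (hω : 0 < ω) {q : ℝ} (hq : 0 < q) :
    ∃ C : ℝ, 0 ≤ C ∧ ∀ p ∈ NoiseClass Υ Ωc ω,
      ∫⁻ e, ENNReal.ofReal (|e| ^ q) ∂(noiseM p) ≤ ENNReal.ofReal C := by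
  have hint : IntegrableOn (fun x : ℝ => x ^ (q - 1) * exp (-Ωc * x ^ ω)) (Set.Ioi 0) :=
    integrableOn_rpow_mul_exp_neg_mul_rpow (by linarith) hω hΩ
  set I := ∫ x in Set.Ioi 0, x ^ (q - 1) * exp (-Ωc * x ^ ω)
  have hI : 0 ≤ I := setIntegral_nonneg measurableSet_Ioi fun x hx => by
    have : (0 : ℝ) < x := hx
    positivity
  refine ⟨q * (2 * Υ * I), by positivity, fun p hp => ?_⟩
  rw [lintegral_rpow_eq_lintegral_meas_le_mul _ (Filter.Eventually.of_forall fun e => abs_nonneg e)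
    measurable_id.abs.aemeasurable hq, ENNReal.ofReal_mul hq.le]
  refine mul_le_mul_right ?_ _
  calc _ ≤ ∫⁻ t in Set.Ioi (0 : ℝ), ENNReal.ofReal (2 * Υ * (t ^ (q - 1) * exp (-Ωc * t ^ ω))) := by
        refine setLIntegral_mono' measurableSet_Ioi fun t ht => ?_
        have ht' : (0 : ℝ) < t := ht
        refine (mul_le_mul_left (noiseM_tail_le hp ht'.le) _).trans ?_
        rw [← ENNReal.ofReal_mul (by positivity)]
        exact ENNReal.ofReal_le_ofReal (le_of_eq (by ring))
    _ = _ := by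
        rw [← ofReal_integral_eq_lintegral_ofReal (hint.const_mul _), integral_const_mul]
        refine (ae_restrict_iff' measurableSet_Ioi).2 (Filter.Eventually.of_forall fun x hx => ?_)
        have : (0 : ℝ) < x := hx
        simp only [Pi.zero_apply]
        positivity

theorem integrable_sq_mul_noise (hΥ : 0 < Υ) (hΩ : 0 < Ωc) (hω : 0 < ω)
    (hp : p ∈ NoiseClass Υ Ωc ω) : Integrable fun e => p e * e ^ 2 := by
  obtain ⟨C, -, hC⟩ := exists_noise_moment_le hΥ hΩ hω (q := 2) two_pos
  have hm := (integrable_of_mem_NoiseClass hp).aestronglyMeasurable.aemeasurable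
  refine ⟨(hm.mul (by fun_prop)).aestronglyMeasurable, ?_⟩
  rw [hasFiniteIntegral_iff_ofReal
    (Filter.Eventually.of_forall fun e => mul_nonneg (hp.1 e) (sq_nonneg e))]
  refine lt_of_le_of_lt ?_ (lt_of_le_of_lt (hC p hp) ENNReal.ofReal_lt_top)
  rw [noiseM, lintegral_withDensity_eq_lintegral_mul₀ hm.ennreal_ofReal (by fun_prop)]
  refine lintegral_mono fun e => ?_
  simp only [Pi.mul_apply]
  rw [← ENNReal.ofReal_mul (hp.1 e)]
  exact ENNReal.ofReal_le_ofReal (le_of_eq (by rw [Real.rpow_two, sq_abs]))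

theorem bddAbove_second_moments (hΥ : 0 < Υ) (hΩ : 0 < Ωc) (hω : 0 < ω) :
    BddAbove {v | ∃ p ∈ NoiseClass Υ Ωc ω, v = ∫ x : ℝ, x ^ 2 * p x} := by
  obtain ⟨C, hC0, hC⟩ := exists_noise_moment_le hΥ hΩ hω (q := 2) two_pos
  refine ⟨C, ?_⟩
  rintro _ ⟨p, hp, rfl⟩
  have hm := (integrable_of_mem_NoiseClass hp).aestronglyMeasurable.aemeasurable
  rw [← ENNReal.ofReal_le_ofReal_iff hC0]
  refine le_trans ?_ (hC p hp)
  rw [noiseM, lintegral_withDensity_eq_lintegral_mul₀ hm.ennreal_ofReal (by fun_prop),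
    ofReal_integral_eq_lintegral_ofReal]
  · refine lintegral_mono fun e => ?_
    simp only [Pi.mul_apply]
    rw [← ENNReal.ofReal_mul (hp.1 e)]
    exact ENNReal.ofReal_le_ofReal (le_of_eq (by rw [Real.rpow_two, sq_abs, mul_comm]))
  · exact (integrable_sq_mul_noise hΥ hΩ hω hp).congr
      (Filter.Eventually.of_forall fun e => mul_comm _ _)
  · exact Filter.Eventually.of_forall fun e => mul_nonneg (sq_nonneg e) (hp.1 e)

/-- Truncation at level `τ`. -/
def trunc (τ e : ℝ) : ℝ := if |e| ≤ τ then e else 0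

theorem measurable_trunc (τ : ℝ) : Measurable (trunc τ) :=
  Measurable.ite (measurableSet_le measurable_id.abs measurable_const) measurable_id
    measurable_const

theorem abs_trunc_le {τ : ℝ} (hτ : 0 ≤ τ) (e : ℝ) : |trunc τ e| ≤ τ := by
  rw [trunc]
  split_ifs with h
  · exact h
  · simpa using hτ

theorem integral_mul_trunc (hp : p ∈ NoiseClass Υ Ωc ω) (τ : ℝ) : ∫ e, p e * trunc τ e = 0 := by
  have h : ∫ e, p (-e) * trunc τ (-e) = ∫ e, p e * trunc τ e :=
    integral_neg_eq_self (fun e => p e * trunc τ e) volume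
  have h2 : ∀ e, p (-e) * trunc τ (-e) = -(p e * trunc τ e) := fun e => by
    rw [hp.2.2.1, trunc, trunc, abs_neg]
    split_ifs <;> ring
  simp only [h2, integral_neg] at h
  linarith

theorem integral_mul_trunc_sq_le {P : Pars} (hΥ : 0 < P.Υ) (hΩ : 0 < P.Ωc) (hω : 0 < P.ω)
    (hp : p ∈ NoiseClass P.Υ P.Ωc P.ω) (τ : ℝ) : ∫ e, p e * trunc τ e ^ 2 ≤ sigma2 P := by
  have h1 : ∫ e, p e * trunc τ e ^ 2 ≤ ∫ e, p e * e ^ 2 := by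
    refine integral_mono_of_nonneg
      (Filter.Eventually.of_forall fun e => mul_nonneg (hp.1 e) (sq_nonneg _))
      (integrable_sq_mul_noise hΥ hΩ hω hp)
      (Filter.Eventually.of_forall fun e => mul_le_mul_of_nonneg_left ?_ (hp.1 e))
    rw [trunc]
    split_ifs
    · exact le_rfl
    · simpa using sq_nonneg e
  refine h1.trans (le_csSup (bddAbove_second_moments hΥ hΩ hω) ⟨p, hp, ?_⟩)
  simp only [mul_comm]

end Noise

section ChangeOfVariables

theorem integral_fin_two (Φ : (Fin 2 → ℝ) → ℝ) : ∫ w, Φ w = ∫ z : ℝ × ℝ, Φ ![z.1, z.2] := by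
  rw [← (volume_preserving_finTwoArrow ℝ).symm.integral_comp']
  rfl

variable {M : Matrix (Fin 2) (Fin 2) ℝ} {Φ : (Fin 2 → ℝ) → ℝ}

theorem integrable_comp_mulVec_sub (hM : 0 < M.det) (hΦ : Continuous Φ) (hΦi : Integrable Φ)
    (t : Fin 2 → ℝ) : Integrable fun x => Φ (M.mulVec (x - t)) := by
  have h1 : Integrable (fun x => Φ (M.mulVec x)) := by
    have h := Real.map_matrix_volume_pi_eq_smul_volume_pi hM.ne'
    have hT : AEMeasurable (Matrix.toLin' M) (volume : Measure (Fin 2 → ℝ)) :=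
      (LinearMap.continuous_of_finiteDimensional _).aemeasurable
    have h2 : Integrable Φ (Measure.map (Matrix.toLin' M) volume) := by
      rw [h]
      exact hΦi.smul_measure ENNReal.ofReal_ne_top
    exact (integrable_map_measure hΦ.aestronglyMeasurable hT).1 h2
  exact h1.comp_sub_right t

theorem det_mul_integral_comp_mulVec_sub (hM : 0 < M.det) (hΦ : Continuous Φ) (t : Fin 2 → ℝ) :
    M.det * ∫ x, Φ (M.mulVec (x - t)) = ∫ w, Φ w := by
  rw [integral_sub_right_eq_self fun x => Φ (M.mulVec x)]
  have h := Real.map_matrix_volume_pi_eq_smul_volume_pi hM.ne'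
  have hT : AEMeasurable (Matrix.toLin' M) (volume : Measure (Fin 2 → ℝ)) :=
    (LinearMap.continuous_of_finiteDimensional _).aemeasurable
  have h2 : ∫ x, Φ (M.mulVec x) = ∫ w, Φ w ∂(Measure.map (Matrix.toLin' M) volume) := by
    rw [integral_map hT hΦ.aestronglyMeasurable]
    rfl
  rw [h2, h, integral_smul_measure, ENNReal.toReal_ofReal (abs_nonneg _),
    abs_of_pos (inv_pos.2 hM), smul_eq_mul, mul_inv_cancel_left₀ hM.ne']

end ChangeOfVariables

/-- The weight of an observation with design point `x` in a kernel estimator. -/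
def wt (K : ℝ → ℝ) (g : (Fin 2 → ℝ) → ℝ) (M : Matrix (Fin 2) (Fin 2) ℝ) (t x : Fin 2 → ℝ) : ℝ :=
  M.det * K2 K (M.mulVec (x - t)) / g x

theorem estM_eq (K : ℝ → ℝ) (g : (Fin 2 → ℝ) → ℝ) (n : ℕ) (M : Matrix (Fin 2) (Fin 2) ℝ)
    (t : Fin 2 → ℝ) (d : Fin n → (Fin 2 → ℝ) × ℝ) :
    estM K g n M t d = (n : ℝ)⁻¹ * ∑ i, wt K g M t (d i).1 * (d i).2 := by
  rw [estM, Finset.mul_sum, Finset.mul_sum]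
  refine Finset.sum_congr rfl fun i _ => ?_
  rw [wt]
  ring

namespace KernelHyp

variable {K : ℝ → ℝ} {Q gl : ℝ} {g : (Fin 2 → ℝ) → ℝ} {M : Matrix (Fin 2) (Fin 2) ℝ}
  {t : Fin 2 → ℝ}

theorem continuous_K2 (hK : KernelHyp K Q) : Continuous (K2 K) :=
  (hK.cont.comp (continuous_apply 0)).mul (hK.cont.comp (continuous_apply 1))

theorem abs_K2_le (hK : KernelHyp K Q) (w : Fin 2 → ℝ) : |K2 K w| ≤ Ksup K ^ 2 := by
  rw [K2, abs_mul, sq]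
  exact mul_le_mul (hK.abs_le_Ksup _) (hK.abs_le_Ksup _) (abs_nonneg _)
    (zero_le_one.trans hK.one_le_Ksup)

theorem abs_le_of_K2_ne_zero (hK : KernelHyp K Q) {w : Fin 2 → ℝ} (hw : K2 K w ≠ 0) :
    |w 0| ≤ 1 / 2 ∧ |w 1| ≤ 1 / 2 :=
  ⟨hK.abs_le_of_ne_zero (left_ne_zero_of_mul hw), hK.abs_le_of_ne_zero (right_ne_zero_of_mul hw)⟩

theorem hasCompactSupport_K2 (hK : KernelHyp K Q) : HasCompactSupport (K2 K) := by
  refine HasCompactSupport.intro (K := Set.Icc (fun _ => -(1/2) : Fin 2 → ℝ) (fun _ => 1/2))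
    isCompact_Icc fun w hw => ?_
  by_contra h
  obtain ⟨h0, h1⟩ := hK.abs_le_of_K2_ne_zero h
  rw [abs_le] at h0 h1
  refine hw ⟨fun i => ?_, fun i => ?_⟩
  · fin_cases i
    · exact h0.1
    · exact h1.1
  · fin_cases i
    · exact h0.2
    · exact h1.2

theorem integrable_K2_mul (hK : KernelHyp K Q) {G : (Fin 2 → ℝ) → ℝ} (hG : Continuous G) :
    Integrable fun w => K2 K w * G w :=
  (hK.continuous_K2.mul hG).integrable_of_hasCompactSupport hK.hasCompactSupport_K2.mul_right

theorem integral_K2_sq_le (hK : KernelHyp K Q) : ∫ w, K2 K w ^ 2 ≤ Ksup K ^ 4 := by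
  rw [integral_fin_two]
  have h : ∀ z : ℝ × ℝ, K2 K ![z.1, z.2] ^ 2 = K z.1 ^ 2 * K z.2 ^ 2 := fun z => by
    simp [K2, mul_pow]
  simp only [h]
  have h2 : ∫ z : ℝ × ℝ, K z.1 ^ 2 * K z.2 ^ 2 = (∫ u, K u ^ 2) * ∫ v, K v ^ 2 :=
    integral_prod_mul (fun u => K u ^ 2) (fun v => K v ^ 2)
  rw [h2]
  have h0 : 0 ≤ ∫ u, K u ^ 2 := integral_nonneg fun u => sq_nonneg _
  calc _ ≤ Ksup K ^ 2 * Ksup K ^ 2 :=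
        mul_le_mul hK.integral_sq_le hK.integral_sq_le h0 (sq_nonneg _)
    _ = _ := by ring

theorem abs_wt_le (hK : KernelHyp K Q) (hgl : 0 < gl) (hM : 0 < M.det) {x : Fin 2 → ℝ}
    (hR : K2 K (M.mulVec (x - t)) ≠ 0 → gl ≤ g x) : |wt K g M t x| ≤ M.det * Ksup K ^ 2 / gl := by
  by_cases h : K2 K (M.mulVec (x - t)) = 0
  · rw [wt, h]
    simp only [mul_zero, zero_div, abs_zero]
    positivity
  · have hg := hR h
    rw [wt, abs_div, abs_mul, abs_of_pos hM, abs_of_pos (hgl.trans_le hg)]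
    have := hK.abs_K2_le (M.mulVec (x - t))
    gcongr

theorem wt_second_moment_le (hK : KernelHyp K Q) (hgl : 0 < gl) (hg0 : ∀ x, 0 ≤ g x)
    (hM : 0 < M.det) {ψ : (Fin 2 → ℝ) → ℝ}
    (hR : ∀ x, K2 K (M.mulVec (x - t)) ≠ 0 → gl ≤ g x ∧ |ψ x| ≤ 1) :
    ∫ x, g x * (wt K g M t x * ψ x) ^ 2 ≤ Ksup K ^ 4 * M.det / gl := by
  have hc : Continuous fun w => K2 K w ^ 2 := hK.continuous_K2.pow 2
  have hi : Integrable fun w => K2 K w ^ 2 := by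
    have := hK.integrable_K2_mul hK.continuous_K2
    simpa only [sq] using this
  have hi2 := integrable_comp_mulVec_sub hM hc hi t
  calc ∫ x, g x * (wt K g M t x * ψ x) ^ 2
      ≤ ∫ x, M.det ^ 2 / gl * K2 K (M.mulVec (x - t)) ^ 2 := by
        refine integral_mono_of_nonneg (Filter.Eventually.of_forall fun x =>
          mul_nonneg (hg0 x) (sq_nonneg _)) (hi2.const_mul _)
          (Filter.Eventually.of_forall fun x => ?_)
        simp only
        by_cases h : K2 K (M.mulVec (x - t)) = 0
        · rw [wt, h]
          simp
        · obtain ⟨h1, h2⟩ := hR x h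
          have hgx := hgl.trans_le h1
          have h3 : ψ x ^ 2 ≤ 1 := by rw [← sq_abs]; exact pow_le_one₀ (abs_nonneg _) h2
          rw [wt]
          calc _ = (M.det ^ 2 * K2 K (M.mulVec (x - t)) ^ 2) * ψ x ^ 2 / g x := by
                field_simp
            _ ≤ (M.det ^ 2 * K2 K (M.mulVec (x - t)) ^ 2) * 1 / gl := by gcongr
            _ = _ := by ring
    _ = M.det / gl * (M.det * ∫ x, K2 K (M.mulVec (x - t)) ^ 2) := by
        rw [integral_const_mul]; ring
    _ = M.det / gl * ∫ w, K2 K w ^ 2 := by rw [det_mul_integral_comp_mulVec_sub hM hc]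
    _ ≤ M.det / gl * Ksup K ^ 4 := by
        have := hK.integral_K2_sq_le
        gcongr
    _ = _ := by ring

theorem integral_wt_mul (hK : KernelHyp K Q) (hgl : 0 < gl) (hM : 0 < M.det)
    {N : Matrix (Fin 2) (Fin 2) ℝ} (hN : N * M = 1) {G : (Fin 2 → ℝ) → ℝ} (hG : Continuous G)
    (hR : ∀ x, K2 K (M.mulVec (x - t)) ≠ 0 → gl ≤ g x) :
    ∫ x, g x * (wt K g M t x * G x) = ∫ w, K2 K w * G (t + N.mulVec w) := by
  have hc : Continuous fun w => K2 K w * G (t + N.mulVec w) :=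
    hK.continuous_K2.mul (hG.comp (continuous_const.add
      (Continuous.matrix_mulVec continuous_const continuous_id)))
  rw [← det_mul_integral_comp_mulVec_sub hM hc t, ← integral_const_mul]
  refine integral_congr_ae (Filter.Eventually.of_forall fun x => ?_)
  simp only
  rw [Matrix.mulVec_mulVec, hN, Matrix.one_mulVec, add_sub_cancel]
  by_cases h : K2 K (M.mulVec (x - t)) = 0
  · rw [wt, h]
    simp
  · have hgx := hgl.trans_le (hR x h)
    rw [wt]
    field_simp

theorem aemeasurable_wt (hK : KernelHyp K Q) (hg : AEMeasurable g) (M : Matrix (Fin 2) (Fin 2) ℝ)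
    (t : Fin 2 → ℝ) : AEMeasurable (wt K g M t) := by
  refine AEMeasurable.div (Continuous.aemeasurable ?_) hg
  exact continuous_const.mul (hK.continuous_K2.comp (Continuous.matrix_mulVec continuous_const
    (continuous_id.sub continuous_const)))

end KernelHyp

/-- Uniform Bernstein bound over a family of windows admitting a finite net. -/
theorem measure_windows_le {K g : _} {Q gl Υ Ωc ω : ℝ} {p : ℝ → ℝ} {F : (Fin 2 → ℝ) → ℝ}
    (hK : KernelHyp K Q) (hgl : 0 < gl) (hg : DesignOK g gl) (hp : p ∈ NoiseClass Υ Ωc ω)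
    (hF : Measurable F) {ι : Type*} {T : Set ι} {s : Finset ι} (hsT : ↑s ⊆ T)
    (M : ι → Matrix (Fin 2) (Fin 2) ℝ) (t : ι → Fin 2 → ℝ) {ψ₁ : (Fin 2 → ℝ) → ℝ} {ψ₂ : ℝ → ℝ}
    (hψ₁ : Measurable ψ₁) (hψ₂ : Measurable ψ₂) {D b v ε x : ℝ} (hD : 0 < D) (hb : 0 < b)
    (hv : 0 < v) (hx : 0 < x) (hM : ∀ a ∈ T, 0 < (M a).det ∧ (M a).det ≤ D)
    (hR : ∀ a ∈ T, ∀ x, K2 K ((M a).mulVec (x - t a)) ≠ 0 → gl ≤ g x ∧ |ψ₁ x| ≤ 1)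
    (hψb : ∀ e, |ψ₂ e| ≤ b) (hψv : ∫ e, p e * ψ₂ e ^ 2 ≤ v)
    (hnet : ∀ a ∈ T, ∃ a' ∈ s, ∀ x, |wt K g (M a) (t a) x - wt K g (M a') (t a') x| ≤ ε)
    {n : ℕ} (hn : 0 < n) :
    dataLaw n g p F {d | ∃ a ∈ T, 2 * √(x * (Ksup K ^ 4 * D / gl * v) / n)
          + x * (D * Ksup K ^ 2 / gl * b) / n + 2 * (ε * b)
        < |(n : ℝ)⁻¹ * ∑ i, wt K g (M a) (t a) (d i).1 * ψ₁ (d i).1 * ψ₂ ((d i).2 - F (d i).1)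
          - (∫ x, g x * (wt K g (M a) (t a) x * ψ₁ x)) * ∫ e, p e * ψ₂ e|}
      ≤ ENNReal.ofReal (2 * s.card * exp (-x)) := by
  have : IsProbabilityMeasure (jointLaw g p F) := isProbabilityMeasure_jointLaw hg hp hF
  have hgm := aemeasurable_of_integral_eq_one hg.2.1
  have hκ : 1 ≤ Ksup K := hK.one_le_Ksup
  have hn' : (0 : ℝ) < n := by exact_mod_cast hn
  set φ : ι → (Fin 2 → ℝ) × ℝ → ℝ := fun a z =>
    wt K g (M a) (t a) z.1 * ψ₁ z.1 * ψ₂ (z.2 - F z.1) with hφdef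
  have hφm : ∀ a, AEStronglyMeasurable (φ a) (jointLaw g p F) := fun a =>
    aestronglyMeasurable_jointLaw (a := fun x => wt K g (M a) (t a) x * ψ₁ x) hF
      ((hK.aemeasurable_wt hgm _ _).mul hψ₁.aemeasurable) hψ₂
  have hφB : ∀ a ∈ T, ∀ z, |φ a z| ≤ D * Ksup K ^ 2 / gl * b := by
    intro a ha z
    have hw : |wt K g (M a) (t a) z.1 * ψ₁ z.1| ≤ D * Ksup K ^ 2 / gl := by
      by_cases h : K2 K ((M a).mulVec (z.1 - t a)) = 0
      · simp only [wt, h, mul_zero, zero_div, zero_mul, abs_zero]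
        positivity
      · rw [abs_mul]
        have h1 := hK.abs_wt_le (t := t a) hgl (hM a ha).1 fun h => (hR a ha z.1 h).1
        calc _ ≤ (M a).det * Ksup K ^ 2 / gl * 1 :=
              mul_le_mul h1 (hR a ha z.1 h).2 (abs_nonneg _) ((abs_nonneg _).trans h1)
          _ ≤ _ := by
              have := (hM a ha).2
              rw [mul_one]
              gcongr
    rw [hφdef]
    simp only
    rw [abs_mul]
    exact mul_le_mul hw (hψb _) (abs_nonneg _) (by positivity)
  have hφi : ∀ a ∈ T, Integrable (φ a) (jointLaw g p F) := fun a ha =>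
    Integrable.of_bound (hφm a) _ (Filter.Eventually.of_forall (hφB a ha))
  have hφV : ∀ a ∈ T, ∫ z, φ a z ^ 2 ∂(jointLaw g p F) ≤ Ksup K ^ 4 * D / gl * v := by
    intro a ha
    have h1 := integral_jointLaw_mul hg hp hF (fun x => (wt K g (M a) (t a) x * ψ₁ x) ^ 2)
      (fun e => ψ₂ e ^ 2)
    simp only [hφdef, mul_pow] at h1 ⊢
    rw [h1]
    have h2 := hK.wt_second_moment_le hgl hg.1 (hM a ha).1 (hR a ha)
    simp only [mul_pow] at h2
    refine mul_le_mul (h2.trans ?_) hψv (integral_nonneg fun e => mul_nonneg (hp.1 e)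
      (sq_nonneg _)) (by positivity)
    have := (hM a ha).2
    gcongr
  have hφE : ∀ a, ∫ z, φ a z ∂(jointLaw g p F)
      = (∫ x, g x * (wt K g (M a) (t a) x * ψ₁ x)) * ∫ e, p e * ψ₂ e := fun a =>
    integral_jointLaw_mul hg hp hF (fun x => wt K g (M a) (t a) x * ψ₁ x) ψ₂
  have hε : ∀ a ∈ T, ∃ a' ∈ s, ∀ z, |φ a z - φ a' z| ≤ ε * b := by
    intro a ha
    obtain ⟨a', ha', h⟩ := hnet a ha
    refine ⟨a', ha', fun z => ?_⟩
    have hε0 : 0 ≤ ε := (abs_nonneg _).trans (h z.1)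
    have e1 : φ a z - φ a' z = (wt K g (M a) (t a) z.1 - wt K g (M a') (t a') z.1) * ψ₁ z.1
        * ψ₂ (z.2 - F z.1) := by simp only [hφdef]; ring
    rw [e1, abs_mul]
    refine mul_le_mul ?_ (hψb _) (abs_nonneg _) hε0
    by_cases h1 : |ψ₁ z.1| ≤ 1
    · rw [abs_mul]
      calc _ ≤ ε * 1 := mul_le_mul (h z.1) h1 (abs_nonneg _) hε0
        _ = ε := mul_one _
    · have e2 : wt K g (M a) (t a) z.1 = 0 := by
        rw [wt, of_not_not fun hne => h1 (hR a ha z.1 hne).2]; simp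
      have e3 : wt K g (M a') (t a') z.1 = 0 := by
        rw [wt, of_not_not fun hne => h1 (hR a' (hsT ha') z.1 hne).2]; simp
      simpa [e2, e3] using hε0
  refine le_trans (measure_mono ?_) (measure_finset_bernstein_le s (φ := φ) (fun a _ => hφm a)
    (fun a ha => hφB a (hsT ha)) (fun a ha => hφV a (hsT ha)) (by positivity) (by positivity)
    hx hn)
  rintro d ⟨a, ha, hd⟩
  obtain ⟨a', ha', h⟩ := hε a ha
  refine ⟨a', ha', ?_⟩
  rw [← hφE] at hd
  have hsum : |(n : ℝ)⁻¹ * ∑ i, φ a (d i) - (n : ℝ)⁻¹ * ∑ i, φ a' (d i)| ≤ ε * b := by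
    rw [← mul_sub, ← Finset.sum_sub_distrib, abs_mul, abs_of_pos (inv_pos.2 hn')]
    calc _ ≤ (n : ℝ)⁻¹ * ∑ _i : Fin n, (ε * b) := by
          gcongr
          exact (Finset.abs_sum_le_sum_abs _ _).trans (Finset.sum_le_sum fun i _ => h (d i))
      _ = ε * b := by
          simp only [Finset.sum_const, Finset.card_univ, Fintype.card_fin, nsmul_eq_mul]
          field_simp
  have hmean : |∫ z, φ a z ∂(jointLaw g p F) - ∫ z, φ a' z ∂(jointLaw g p F)| ≤ ε * b := by
    rw [← integral_sub (hφi a ha) (hφi a' (hsT ha'))]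
    have := norm_integral_le_of_norm_le_const (μ := jointLaw g p F) (C := ε * b)
      (f := fun z => φ a z - φ a' z) (Filter.Eventually.of_forall fun z => by
        rw [Real.norm_eq_abs]; exact h z)
    simpa using this
  change 2 * √(x * (Ksup K ^ 4 * D / gl * v) / n) + x * (D * Ksup K ^ 2 / gl * b) / n
      + 2 * (ε * b) < |(n : ℝ)⁻¹ * ∑ i, φ a (d i) - ∫ z, φ a z ∂(jointLaw g p F)| at hd
  set A := (n : ℝ)⁻¹ * ∑ i, φ a (d i)
  set A' := (n : ℝ)⁻¹ * ∑ i, φ a' (d i)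
  set E := ∫ z, φ a z ∂(jointLaw g p F)
  set E' := ∫ z, φ a' z ∂(jointLaw g p F)
  have : |A - E| ≤ |A - A'| + |A' - E'| + |E - E'| := by
    have e1 := abs_add_le (A - A') (A' - E')
    have e2 := abs_sub_le A E' E
    rw [abs_sub_comm E' E] at e2
    rw [show A - A' + (A' - E') = A - E' by ring] at e1
    linarith
  linarith

section Windows

/-- The window matrix with direction `e`, dilation `ρ` and bandwidth `h`; both `Emat` and `Epair`
are of this form. -/
def win (e : Fin 2 → ℝ) (ρ h : ℝ) : Matrix (Fin 2) (Fin 2) ℝ :=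
  !![e 0 / (h * ρ), e 1 / (h * ρ); -e 1 / ρ, e 0 / ρ]

/-- The inverse of `win e ρ h`. -/
def winInv (e : Fin 2 → ℝ) (ρ h : ℝ) : Matrix (Fin 2) (Fin 2) ℝ :=
  !![h * ρ * e 0, -(ρ * e 1); h * ρ * e 1, ρ * e 0]

/-- The coordinate of `b` along the normal of `a`. -/
def cross2 (a b : Fin 2 → ℝ) : ℝ := a 0 * b 1 - a 1 * b 0

variable {e θ ν t x : Fin 2 → ℝ} {ρ h : ℝ}

theorem matrix_fin_two_congr {a b c d a' b' c' d' : ℝ} (ha : a = a') (hb : b = b') (hc : c = c')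
    (hd : d = d') : !![a, b; c, d] = !![a', b'; c', d'] := by
  rw [ha, hb, hc, hd]

theorem abs_apply_le_one_of_mem_S1 (he : e ∈ S1) (i : Fin 2) : |e i| ≤ 1 := by
  have h : e 0 ^ 2 + e 1 ^ 2 = 1 := he
  rw [abs_le_one_iff_mul_self_le_one]
  fin_cases i
  · change e 0 * e 0 ≤ 1
    nlinarith [sq_nonneg (e 1)]
  · change e 1 * e 1 ≤ 1
    nlinarith [sq_nonneg (e 0)]

theorem abs_dot2_le_one (he : e ∈ S1) (hθ : θ ∈ S1) : |dot2 e θ| ≤ 1 := by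
  have h1 : e 0 ^ 2 + e 1 ^ 2 = 1 := he
  have h2 : θ 0 ^ 2 + θ 1 ^ 2 = 1 := hθ
  rw [abs_le_one_iff_mul_self_le_one, dot2]
  nlinarith [sq_nonneg (e 0 * θ 1 - e 1 * θ 0)]

theorem neg_mem_S1 (he : e ∈ S1) : -e ∈ S1 := by
  have h1 : e 0 ^ 2 + e 1 ^ 2 = 1 := he
  change (-e) 0 ^ 2 + (-e) 1 ^ 2 = 1
  simpa using h1

theorem det_win (he : e ∈ S1) (hρ : ρ ≠ 0) (hh : h ≠ 0) : (win e ρ h).det = 1 / (h * ρ ^ 2) := by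
  have h1 : e 0 ^ 2 + e 1 ^ 2 = 1 := he
  rw [win, Matrix.det_fin_two_of]
  field_simp
  linarith

theorem winInv_mul_win (he : e ∈ S1) (hρ : ρ ≠ 0) (hh : h ≠ 0) :
    winInv e ρ h * win e ρ h = 1 := by
  have h1 : e 0 ^ 2 + e 1 ^ 2 = 1 := he
  rw [winInv, win, Matrix.mul_fin_two, Matrix.one_fin_two]
  refine matrix_fin_two_congr ?_ ?_ ?_ ?_
  · field_simp; linarith
  · field_simp; ring
  · field_simp; ring
  · field_simp; linarith

theorem det_win_pos (he : e ∈ S1) (hρ : 1 ≤ ρ) (hh : 0 < h) : 0 < (win e ρ h).det := by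
  rw [det_win he (by positivity) hh.ne']
  positivity

theorem det_win_le (he : e ∈ S1) (hρ : 1 ≤ ρ) (hh : 0 < h) : (win e ρ h).det ≤ h⁻¹ := by
  rw [det_win he (by positivity) hh.ne', inv_eq_one_div]
  refine one_div_le_one_div_of_le hh (le_mul_of_one_le_right hh.le (one_le_pow₀ hρ))

theorem abs_sub_le_of_win (he : e ∈ S1) (hρ : ρ ∈ Set.Icc (1 : ℝ) 2) (hh : h ∈ Set.Ioc (0 : ℝ) 1)
    (h0 : |(win e ρ h).mulVec (x - t) 0| ≤ 1 / 2) (h1 : |(win e ρ h).mulVec (x - t) 1| ≤ 1 / 2)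
    (i : Fin 2) : |x i - t i| ≤ 2 := by
  have hρ0 : ρ ≠ 0 := by linarith [hρ.1]
  set w := (win e ρ h).mulVec (x - t) with hw
  have hx : x - t = (winInv e ρ h).mulVec w := by
    rw [hw, Matrix.mulVec_mulVec, winInv_mul_win he hρ0 hh.1.ne', Matrix.one_mulVec]
  have e0 := abs_apply_le_one_of_mem_S1 he 0
  have e1 := abs_apply_le_one_of_mem_S1 he 1
  have key : ∀ p q : ℝ, |p| ≤ 1 → |q| ≤ 1 → |h * ρ * p * w 0 + ρ * q * w 1| ≤ 2 := by
    intro p q hp hq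
    have a1 : |h * ρ * p * w 0| ≤ 1 := by
      rw [abs_mul, abs_mul, abs_mul, abs_of_pos hh.1, abs_of_pos (by linarith [hρ.1] : 0 < ρ)]
      calc h * ρ * |p| * |w 0| ≤ 1 * 2 * 1 * (1 / 2) := by
            have := hh.2; have := hρ.2; have := hρ.1; have := hh.1
            gcongr
        _ = 1 := by norm_num
    have a2 : |ρ * q * w 1| ≤ 1 := by
      rw [abs_mul, abs_mul, abs_of_pos (by linarith [hρ.1] : 0 < ρ)]
      calc ρ * |q| * |w 1| ≤ 2 * 1 * (1 / 2) := by
            have := hρ.2; have := hρ.1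
            gcongr
        _ = 1 := by norm_num
    linarith [abs_add_le (h * ρ * p * w 0) (ρ * q * w 1)]
  have hi : x i - t i = (winInv e ρ h).mulVec w i := by rw [← hx]; rfl
  rw [hi]
  fin_cases i
  · have := key (e 0) (-e 1) e0 (by rwa [abs_neg])
    simpa [winInv, Matrix.mulVec, dotProduct, Fin.sum_univ_two] using this
  · have := key (e 1) (e 0) e1 e0
    simpa [winInv, Matrix.mulVec, dotProduct, Fin.sum_univ_two] using this

theorem dot2_winInv (w : Fin 2 → ℝ) :
    dot2 (t + (winInv e ρ h).mulVec w) θ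
      = dot2 t θ + h * (ρ * dot2 e θ) * w 0 + ρ * cross2 e θ * w 1 := by
  simp [winInv, dotProduct, Fin.sum_univ_two, dot2, cross2]
  ring

theorem Emat_eq_win (ν : Fin 2 → ℝ) (h : ℝ) : Emat ν h = win ν 1 h := by
  simp [Emat, win]

theorem exists_Ebar_eq_win (hθ : θ ∈ S1) (hν : ν ∈ S1) (hh : h ≠ 0) (hc : 0 ≤ dot2 ν θ) :
    ∃ e ∈ S1, ∃ ρ ∈ Set.Icc (1 : ℝ) 2, Ebar θ ν h = win e ρ h ∧
      ρ * e 0 = θ 0 + ν 0 ∧ ρ * e 1 = θ 1 + ν 1 := by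
  have h1 : θ 0 ^ 2 + θ 1 ^ 2 = 1 := hθ
  have h2 : ν 0 ^ 2 + ν 1 ^ 2 = 1 := hν
  have h3 := (abs_le.1 (abs_dot2_le_one hν hθ)).2
  set c := dot2 ν θ with hcdef
  have h4 : ν 0 * θ 0 + ν 1 * θ 1 = c := rfl
  set ρ := √(2 * (1 + c)) with hρ
  have hρ2 : ρ ^ 2 = 2 * (1 + c) := Real.sq_sqrt (by linarith)
  have hρ1 : 1 ≤ ρ := Real.one_le_sqrt.2 (by linarith)
  have hρ0 : ρ ≠ 0 := by positivity
  have hρ2' : ρ ≤ 2 := by nlinarith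
  refine ⟨![(θ 0 + ν 0) / ρ, (θ 1 + ν 1) / ρ], ?_, ρ, ⟨hρ1, hρ2'⟩, ?_, ?_, ?_⟩
  · change ((θ 0 + ν 0) / ρ) ^ 2 + ((θ 1 + ν 1) / ρ) ^ 2 = 1
    rw [div_pow, div_pow, ← add_div, div_eq_one_iff_eq (by positivity), hρ2]
    nlinarith
  · rw [Ebar, ← hcdef, abs_of_nonneg hc,
      show 2 * h * (1 + c) = h * ρ ^ 2 by rw [hρ2]; ring, ← hρ2, win]
    refine matrix_fin_two_congr ?_ ?_ ?_ ?_
    · change _ = (θ 0 + ν 0) / ρ / _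
      field_simp
    · change _ = (θ 1 + ν 1) / ρ / _
      field_simp
    · change _ = -((θ 1 + ν 1) / ρ) / _
      field_simp
    · change _ = (θ 0 + ν 0) / ρ / _
      field_simp
  · simp; field_simp
  · simp; field_simp

/-- The pairwise window of `(θ, ν)`, seen from the index `θ`. -/
theorem exists_Epair_eq_win (hθ : θ ∈ S1) (hν : ν ∈ S1) (hh : h ≠ 0) :
    ∃ e ∈ S1, ∃ ρ ∈ Set.Icc (1 : ℝ) 2, Epair θ ν h = win e ρ h ∧
      |ρ * dot2 e θ| ≤ 2 ∧ ρ * cross2 e θ = cross2 ν θ := by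
  have h1 : θ 0 ^ 2 + θ 1 ^ 2 = 1 := hθ
  have h3 := abs_le.1 (abs_dot2_le_one hν hθ)
  have h4 : ν 0 * θ 0 + ν 1 * θ 1 = dot2 ν θ := rfl
  by_cases hc : 0 ≤ dot2 ν θ
  · obtain ⟨e, he, ρ, hρ, hE, e0, e1⟩ := exists_Ebar_eq_win hθ hν hh hc
    refine ⟨e, he, ρ, hρ, by rw [Epair, if_pos hc, hE], ?_, ?_⟩
    · have : ρ * dot2 e θ = 1 + dot2 ν θ := by
        rw [dot2]
        linear_combination θ 0 * e0 + θ 1 * e1 + h1 + h4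
      rw [this, abs_le]
      constructor <;> linarith
    · rw [cross2, cross2]
      linear_combination θ 1 * e0 - θ 0 * e1
  · have hc' : 0 ≤ dot2 ν (-θ) := by
      have : dot2 ν (-θ) = - dot2 ν θ := by simp [dot2]; ring
      rw [this]; linarith
    obtain ⟨e, he, ρ, hρ, hE, e0, e1⟩ := exists_Ebar_eq_win (neg_mem_S1 hθ) hν hh hc'
    simp only [Pi.neg_apply] at e0 e1
    refine ⟨e, he, ρ, hρ, by rw [Epair, if_neg hc, hE], ?_, ?_⟩
    · have : ρ * dot2 e θ = -1 + dot2 ν θ := by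
        rw [dot2]
        linear_combination θ 0 * e0 + θ 1 * e1 - h1 + h4
      rw [this, abs_le]
      push Not at hc
      constructor <;> linarith
    · rw [cross2, cross2]
      linear_combination θ 1 * e0 - θ 0 * e1

theorem dot2_comm (a b : Fin 2 → ℝ) : dot2 a b = dot2 b a := by
  rw [dot2, dot2]; ring

theorem Epair_comm (θ ν : Fin 2 → ℝ) (h : ℝ) :
    Epair θ ν h = Epair ν θ h ∨ Epair θ ν h = -Epair ν θ h := by
  rw [Epair, Epair, dot2_comm θ ν]
  split_ifs with hc
  · left
    rw [Ebar, Ebar, dot2_comm θ ν, add_comm (θ 0), add_comm (θ 1)]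
  · right
    have e1 : |dot2 ν (-θ)| = |dot2 ν θ| := by
      rw [show dot2 ν (-θ) = - dot2 ν θ by simp [dot2]; ring, abs_neg]
    have e2 : |dot2 θ (-ν)| = |dot2 ν θ| := by
      rw [show dot2 θ (-ν) = - dot2 ν θ by simp [dot2]; ring, abs_neg]
    rw [Ebar, Ebar, e1, e2]
    ext i j
    fin_cases i <;> fin_cases j <;> simp <;> ring

theorem estM_neg {K : ℝ → ℝ} {Q : ℝ} (hK : KernelHyp K Q) (g : (Fin 2 → ℝ) → ℝ) (n : ℕ)
    (M : Matrix (Fin 2) (Fin 2) ℝ) (t : Fin 2 → ℝ) (d : Fin n → (Fin 2 → ℝ) × ℝ) :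
    estM K g n (-M) t d = estM K g n M t d := by
  have h : ∀ w : Fin 2 → ℝ, K2 K (-w) = K2 K w := fun w => by simp [K2, hK.symm]
  simp only [estM, Matrix.neg_mulVec, h, Matrix.det_fin_two, Matrix.neg_apply, neg_mul_neg]

theorem estM_Epair_comm {K : ℝ → ℝ} {Q : ℝ} (hK : KernelHyp K Q) (g : (Fin 2 → ℝ) → ℝ) (n : ℕ)
    (θ ν : Fin 2 → ℝ) (h : ℝ) (t : Fin 2 → ℝ) (d : Fin n → (Fin 2 → ℝ) × ℝ) :
    estM K g n (Epair θ ν h) t d = estM K g n (Epair ν θ h) t d := by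
  rcases Epair_comm θ ν h with h | h <;> rw [h]
  exact estM_neg hK _ _ _ _ _

end Windows

section Bias

variable {K f : ℝ → ℝ} {Q β₀ M : ℝ}

theorem abs_le_of_mem_HolderBall (hf : f ∈ HolderBall β₀ M) (y : ℝ) : |f y| ≤ M := by
  obtain ⟨A, B, hAB, hA, hB⟩ := hf
  have h1 := hB 1 0
  rw [sub_zero, abs_one, one_rpow, mul_one] at h1
  linarith [hA y, abs_nonneg (f 1 - f 0)]

theorem abs_sub_le_of_mem_HolderBall (hf : f ∈ HolderBall β₀ M) (y z : ℝ) :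
    |f y - f z| ≤ M * |y - z| ^ β₀ := by
  obtain ⟨A, B, hAB, hA, hB⟩ := hf
  have h1 := (abs_nonneg _).trans (hA 0)
  refine (hB y z).trans ?_
  gcongr
  linarith

theorem continuous_of_mem_HolderBall (hβ : 0 < β₀) (hf : f ∈ HolderBall β₀ M) : Continuous f := by
  rw [continuous_iff_continuousAt]
  intro y
  rw [ContinuousAt, tendsto_iff_dist_tendsto_zero]
  have hlim : Filter.Tendsto (fun z => M * |z - y| ^ β₀) (nhds y) (nhds 0) := by
    have : Continuous fun z : ℝ => M * |z - y| ^ β₀ :=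
      continuous_const.mul ((continuous_id.sub continuous_const).abs.rpow_const fun _ =>
        Or.inr hβ.le)
    simpa [zero_rpow hβ.ne'] using this.tendsto y
  exact squeeze_zero (fun _ => dist_nonneg) (fun z => abs_sub_le_of_mem_HolderBall hf z y) hlim

/-- The local approximation error of `f` at `z` with signed bandwidth `δ`. -/
def locErr (K f : ℝ → ℝ) (δ z : ℝ) : ℝ := ∫ s, K s * (f (z + δ * s) - f z)

theorem inv_mul_integral_eq_locErr {δ : ℝ} (hδ : 0 < δ) (z : ℝ) :
    δ⁻¹ * ∫ u, K ((u - z) / δ) * (f u - f z) = locErr K f δ z := by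
  have h := Measure.integral_comp_mul_left
    (fun x => K ((z + x - z) / δ) * (f (z + x) - f z)) δ
  rw [integral_add_left_eq_self fun x => K ((x - z) / δ) * (f x - f z), smul_eq_mul,
    abs_of_pos (inv_pos.2 hδ)] at h
  rw [← h, locErr]
  refine integral_congr_ae (Filter.Eventually.of_forall fun s => ?_)
  simp only
  rw [add_sub_cancel_left, mul_div_cancel_left₀ _ hδ.ne']

theorem KernelHyp.abs_integral_mul_le (hK : KernelHyp K Q) {φ : ℝ → ℝ} {C : ℝ}
    (h : ∀ s, |s| ≤ 1 / 2 → |φ s| ≤ C) : |∫ s, K s * φ s| ≤ Ksup K * C := by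
  have h0 : 0 ≤ C := (abs_nonneg _).trans (h 0 (by simp))
  have h1 : |∫ s, K s * φ s| ≤ ∫ s, |K s| * C := by
    refine abs_integral_le_integral_abs.trans (integral_mono_of_nonneg
      (Filter.Eventually.of_forall fun _ => abs_nonneg _) (hK.integrable.abs.mul_const _)
      (Filter.Eventually.of_forall fun s => ?_))
    simp only [abs_mul]
    by_cases hs : K s = 0
    · simp [hs]
    · exact mul_le_mul_of_nonneg_left (h s (hK.abs_le_of_ne_zero hs)) (abs_nonneg _)
  rw [integral_mul_const] at h1
  exact h1.trans (mul_le_mul_of_nonneg_right hK.K1_le h0)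

theorem locErr_neg (hK : KernelHyp K Q) (δ z : ℝ) : locErr K f (-δ) z = locErr K f δ z := by
  rw [locErr, ← integral_neg_eq_self, locErr]
  simp only [hK.symm, neg_mul_neg]

theorem abs_locErr_le (hK : KernelHyp K Q) (hM : 0 < M) (hβ : 0 < β₀) (hf : f ∈ HolderBall β₀ M)
    {h δ : ℝ} (hδ : |δ| ≤ h) (z : ℝ) : |locErr K f δ z| ≤ Ksup K * (M * (h / 2) ^ β₀) := by
  refine hK.abs_integral_mul_le fun s hs => (abs_sub_le_of_mem_HolderBall hf _ _).trans ?_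
  rw [add_sub_cancel_left, abs_mul]
  have : |δ| * |s| ≤ h / 2 := by
    calc _ ≤ h * (1 / 2) := mul_le_mul hδ hs (abs_nonneg _) ((abs_nonneg _).trans hδ)
      _ = _ := by ring
  gcongr

theorem continuous_locErr (hK : KernelHyp K Q) (hβ : 0 < β₀)
    (hf : f ∈ HolderBall β₀ M) (δ : ℝ) : Continuous (locErr K f δ) := by
  have hc := continuous_of_mem_HolderBall hβ hf
  refine continuous_of_dominated (bound := fun s => |K s| * (M + M)) (fun z => ?_) (fun z => ?_)
    (hK.integrable.abs.mul_const _) (Filter.Eventually.of_forall fun s => ?_)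
  · have := hK.cont
    exact (by fun_prop : Continuous fun s => K s * (f (z + δ * s) - f z)).aestronglyMeasurable
  · refine Filter.Eventually.of_forall fun s => ?_
    rw [norm_eq_abs, abs_mul]
    gcongr
    exact (abs_sub _ _).trans (add_le_add (abs_le_of_mem_HolderBall hf _)
      (abs_le_of_mem_HolderBall hf _))
  · fun_prop

theorem Delta_eq_iSup (K f : ℝ → ℝ) (h z : ℝ) :
    Delta K f h z = ⨆ δ : Set.Ioc (0 : ℝ) h, |locErr K f δ z| := by
  rw [Delta, iSup]
  congr 1
  ext v
  constructor
  · rintro ⟨δ, h0, h1, rfl⟩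
    exact ⟨⟨δ, h0, h1⟩, by simp only [inv_mul_integral_eq_locErr h0]⟩
  · rintro ⟨⟨δ, h0, h1⟩, rfl⟩
    exact ⟨δ, h0, h1, by simp only [inv_mul_integral_eq_locErr h0]⟩

theorem bddAbove_locErr (hK : KernelHyp K Q) (hM : 0 < M) (hβ : 0 < β₀) (hf : f ∈ HolderBall β₀ M)
    (h z : ℝ) : BddAbove (Set.range fun δ : Set.Ioc (0 : ℝ) h => |locErr K f δ z|) := by
  refine ⟨Ksup K * (M * (h / 2) ^ β₀), ?_⟩
  rintro v ⟨δ, rfl⟩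
  exact abs_locErr_le hK hM hβ hf (h := h) (by rw [abs_of_pos δ.2.1]; exact δ.2.2) z

theorem Delta_nonneg (K f : ℝ → ℝ) (h z : ℝ) : 0 ≤ Delta K f h z := by
  rw [Delta_eq_iSup]
  exact Real.iSup_nonneg fun _ => abs_nonneg _

theorem Delta_le (hK : KernelHyp K Q) (hM : 0 < M) (hβ : 0 < β₀) (hf : f ∈ HolderBall β₀ M)
    {h : ℝ} (hh : 0 ≤ h) (z : ℝ) : Delta K f h z ≤ Ksup K * (M * (h / 2) ^ β₀) := by
  have := hK.one_le_Ksup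
  rw [Delta_eq_iSup]
  exact Real.iSup_le (fun δ => abs_locErr_le hK hM hβ hf
    (by rw [abs_of_pos δ.2.1]; exact δ.2.2) z) (by positivity)

theorem abs_locErr_le_Delta (hK : KernelHyp K Q) (hM : 0 < M) (hβ : 0 < β₀)
    (hf : f ∈ HolderBall β₀ M) {h δ : ℝ} (hδ : |δ| ≤ h) (z : ℝ) :
    |locErr K f δ z| ≤ Delta K f h z := by
  rcases eq_or_ne δ 0 with rfl | h0
  · simpa [locErr] using Delta_nonneg K f h z
  · have h1 : |locErr K f |δ| z| = |locErr K f δ z| := by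
      rcases abs_cases δ with ⟨e, _⟩ | ⟨e, _⟩ <;> rw [e]
      rw [locErr_neg hK]
    rw [← h1, Delta_eq_iSup]
    exact le_ciSup (bddAbove_locErr hK hM hβ hf h z) ⟨|δ|, abs_pos.2 h0, hδ⟩

theorem Delta_mono (hK : KernelHyp K Q) (hM : 0 < M) (hβ : 0 < β₀)
    (hf : f ∈ HolderBall β₀ M) {h h' : ℝ} (hh : h ≤ h') (z : ℝ) :
    Delta K f h z ≤ Delta K f h' z := by
  rw [Delta_eq_iSup K f h]
  exact Real.iSup_le (fun δ => abs_locErr_le_Delta hK hM hβ hf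
    (by rw [abs_of_pos δ.2.1]; exact δ.2.2.trans hh) z) (Delta_nonneg _ _ _ _)

theorem measurable_Delta (hK : KernelHyp K Q) (hM : 0 < M) (hβ : 0 < β₀)
    (hf : f ∈ HolderBall β₀ M) (h : ℝ) : Measurable (Delta K f h) := by
  have : Delta K f h = fun z => ⨆ δ : Set.Ioc (0 : ℝ) h, |locErr K f δ z| :=
    funext (Delta_eq_iSup K f h)
  rw [this]
  exact (lowerSemicontinuous_ciSup (bddAbove_locErr hK hM hβ hf h) fun δ =>
    (continuous_locErr hK hβ hf δ).abs.lowerSemicontinuous).measurable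

theorem integrableOn_Delta (hK : KernelHyp K Q) (hM : 0 < M) (hβ : 0 < β₀)
    (hf : f ∈ HolderBall β₀ M) {h : ℝ} (hh : 0 ≤ h) (a b : ℝ) :
    IntegrableOn (Delta K f h) (Set.Icc a b) :=
  Measure.integrableOn_of_bounded (by simp)
    (measurable_Delta hK hM hβ hf h).aestronglyMeasurable
    (Filter.Eventually.of_forall fun z => by
      rw [norm_eq_abs, abs_of_nonneg (Delta_nonneg K f h z)]
      exact Delta_le hK hM hβ hf hh z)

theorem average_le_of_le {φ : ℝ → ℝ} {C y a : ℝ} (ha : 0 < a)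
    (hi : IntegrableOn φ (Set.Icc (y - a) (y + a))) (hφ : ∀ z ∈ Set.Icc (y - a) (y + a), φ z ≤ C) :
    (2 * a)⁻¹ * ∫ z in Set.Icc (y - a) (y + a), φ z ≤ C := by
  have h1 : ∫ z in Set.Icc (y - a) (y + a), φ z ≤ ∫ _z in Set.Icc (y - a) (y + a), C :=
    setIntegral_mono_on hi (by simp) measurableSet_Icc hφ
  rw [setIntegral_const, Measure.real, Real.volume_Icc, ENNReal.toReal_ofReal (by linarith),
    smul_eq_mul] at h1
  rw [inv_mul_le_iff₀ (by positivity)]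
  linarith

theorem le_average_of_le {φ : ℝ → ℝ} {C y a : ℝ} (ha : 0 < a)
    (hi : IntegrableOn φ (Set.Icc (y - a) (y + a))) (hφ : ∀ z ∈ Set.Icc (y - a) (y + a), C ≤ φ z) :
    C ≤ (2 * a)⁻¹ * ∫ z in Set.Icc (y - a) (y + a), φ z := by
  have h1 : ∫ _z in Set.Icc (y - a) (y + a), C ≤ ∫ z in Set.Icc (y - a) (y + a), φ z :=
    setIntegral_mono_on (by simp) hi measurableSet_Icc hφ
  rw [setIntegral_const, Measure.real, Real.volume_Icc, ENNReal.toReal_ofReal (by linarith),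
    smul_eq_mul] at h1
  rw [le_inv_mul_iff₀ (by positivity)]
  linarith

theorem average_le_DeltaStar (hK : KernelHyp K Q) (hM : 0 < M) (hβ : 0 < β₀)
    (hf : f ∈ HolderBall β₀ M) {h a : ℝ} (hh : 0 ≤ h) (ha : 0 < a) (y : ℝ) :
    (2 * a)⁻¹ * ∫ z in Set.Icc (y - a) (y + a), Delta K f h z ≤ DeltaStar K f h y := by
  refine le_csSup ⟨Ksup K * (M * (h / 2) ^ β₀), ?_⟩ ⟨a, ha, rfl⟩
  rintro v ⟨a, ha, rfl⟩
  exact average_le_of_le ha (integrableOn_Delta hK hM hβ hf hh _ _) fun z _ =>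
    Delta_le hK hM hβ hf hh z

theorem DeltaStar_le (hK : KernelHyp K Q) (hM : 0 < M) (hβ : 0 < β₀) (hf : f ∈ HolderBall β₀ M)
    {h : ℝ} (hh : 0 ≤ h) (y : ℝ) : DeltaStar K f h y ≤ Ksup K * (M * (h / 2) ^ β₀) := by
  refine csSup_le ⟨_, 1, one_pos, rfl⟩ ?_
  rintro v ⟨a, ha, rfl⟩
  exact average_le_of_le ha (integrableOn_Delta hK hM hβ hf hh _ _) fun z _ =>
    Delta_le hK hM hβ hf hh z

theorem DeltaStar_mono (hK : KernelHyp K Q) (hM : 0 < M) (hβ : 0 < β₀) (hf : f ∈ HolderBall β₀ M)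
    {h h' : ℝ} (h0 : 0 ≤ h) (hh : h ≤ h') (y : ℝ) : DeltaStar K f h y ≤ DeltaStar K f h' y := by
  refine csSup_le ⟨_, 1, one_pos, rfl⟩ ?_
  rintro v ⟨a, ha, rfl⟩
  refine le_trans ?_ (average_le_DeltaStar hK hM hβ hf (h0.trans hh) ha y)
  have := setIntegral_mono (μ := volume) (integrableOn_Delta hK hM hβ hf h0 (y - a) (y + a))
    (integrableOn_Delta hK hM hβ hf (h0.trans hh) (y - a) (y + a))
    fun z => Delta_mono hK hM hβ hf hh z
  gcongr

theorem DeltaStar_nonneg (K f : ℝ → ℝ) (h y : ℝ) : 0 ≤ DeltaStar K f h y := by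
  refine Real.sSup_nonneg ?_
  rintro v ⟨a, ha, rfl⟩
  exact mul_nonneg (by positivity) (integral_nonneg fun z => Delta_nonneg K f h z)

theorem Delta_le_DeltaStar (hK : KernelHyp K Q) (hM : 0 < M) (hβ : 0 < β₀)
    (hf : f ∈ HolderBall β₀ M) {h : ℝ} (hh : 0 ≤ h) (y : ℝ) :
    Delta K f h y ≤ DeltaStar K f h y := by
  rw [Delta_eq_iSup]
  refine Real.iSup_le (fun δ => ?_) (DeltaStar_nonneg K f h y)
  refine le_of_forall_pos_sub_le fun ε hε => ?_
  have hc := (continuous_locErr hK hβ hf δ).abs.continuousAt (x := y)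
  obtain ⟨a, ha, hd⟩ := Metric.continuousAt_iff.1 hc ε hε
  refine le_trans ?_ (average_le_DeltaStar hK hM hβ hf hh (half_pos ha) y)
  refine le_average_of_le (half_pos ha) (integrableOn_Delta hK hM hβ hf hh _ _) fun z hz => ?_
  have h1 : dist z y < a := by
    rw [Real.dist_eq, abs_lt]
    constructor <;> linarith [hz.1, hz.2]
  have h2 := hd h1
  rw [Real.dist_eq, abs_lt] at h2
  have h3 := abs_locErr_le_Delta hK hM hβ hf (δ := δ) (h := h)
    (by rw [abs_of_pos δ.2.1]; exact δ.2.2) z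
  linarith [h2.1]

/-- Smoothing of `f` along a window whose axes project on the index as `a` and `b`. -/
def smooth (K f : ℝ → ℝ) (y a b : ℝ) : ℝ := ∫ w : Fin 2 → ℝ, K2 K w * f (y + a * w 0 + b * w 1)

theorem smooth_eq (hK : KernelHyp K Q) (hβ : 0 < β₀) (hf : f ∈ HolderBall β₀ M) (y a b : ℝ) :
    smooth K f y a b
      = (∫ v, K v * locErr K f a (y + b * v)) + ∫ v, K v * f (y + b * v) := by
  have hc := continuous_of_mem_HolderBall hβ hf
  have hKc := hK.cont
  have hKi := hK.integrable
  have hfb : ∀ z, ‖f z‖ ≤ M := fun z => abs_le_of_mem_HolderBall hf z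
  have e1 : smooth K f y a b
      = ∫ z : ℝ × ℝ, K z.1 * K z.2 * f (y + a * z.1 + b * z.2) := by
    rw [smooth, integral_fin_two]
    simp [K2]
  have hi : Integrable (fun z : ℝ × ℝ => K z.1 * K z.2 * f (y + a * z.1 + b * z.2)) :=
    (hKi.mul_prod hKi).mul_bdd (c := M)
      (by fun_prop : Continuous fun z : ℝ × ℝ => f (y + a * z.1 + b * z.2)).aestronglyMeasurable
      (Filter.Eventually.of_forall fun z => hfb _)
  rw [e1, Measure.volume_eq_prod, integral_prod_symm _ hi, ← integral_add]
  · refine integral_congr_ae (Filter.Eventually.of_forall fun v => ?_)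
    simp only
    rw [← mul_add, locErr]
    simp only [mul_sub]
    rw [integral_sub, integral_mul_const, hK.norm_one, one_mul, sub_add_cancel,
      ← integral_const_mul]
    · refine integral_congr_ae (Filter.Eventually.of_forall fun u => ?_)
      simp only
      rw [show y + a * u + b * v = y + b * v + a * u by ring]
      ring
    · exact hKi.mul_bdd (c := M)
        (by fun_prop : Continuous fun s => f (y + b * v + a * s)).aestronglyMeasurable
        (Filter.Eventually.of_forall fun z => hfb _)
    · exact hKi.mul_const _
  · refine hKi.mul_bdd (c := Ksup K * (M + M))
      ((continuous_locErr hK hβ hf a).comp (by fun_prop)).aestronglyMeasurable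
      (Filter.Eventually.of_forall fun z => hK.abs_integral_mul_le fun s _ => ?_)
    exact (abs_sub _ _).trans (add_le_add (hfb _) (hfb _))
  · exact hKi.mul_bdd (c := M)
      (by fun_prop : Continuous fun v => f (y + b * v)).aestronglyMeasurable
      (Filter.Eventually.of_forall fun z => hfb _)

theorem abs_smooth_sub_le (hK : KernelHyp K Q) (hM : 0 < M) (hβ : 0 < β₀)
    (hf : f ∈ HolderBall β₀ M) {h a : ℝ} (ha : |a| ≤ h) (y b : ℝ) :
    |smooth K f y a b - ∫ v, K v * f (y + b * v)| ≤ Ksup K * DeltaStar K f h y := by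
  have hh : 0 ≤ h := (abs_nonneg _).trans ha
  have hκ : 0 ≤ Ksup K := zero_le_one.trans hK.one_le_Ksup
  rw [smooth_eq hK hβ hf, add_sub_cancel_right]
  rcases eq_or_ne b 0 with rfl | hb
  · refine hK.abs_integral_mul_le fun s _ => ?_
    rw [zero_mul, add_zero]
    exact (abs_locErr_le_Delta hK hM hβ hf ha y).trans (Delta_le_DeltaStar hK hM hβ hf hh y)
  · set D : ℝ → ℝ := fun v => Delta K f h (y + b * v) with hD
    have hDm : Measurable D := (measurable_Delta hK hM hβ hf h).comp (by fun_prop)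
    have hDi : IntegrableOn D (Set.Icc (-(1/2)) (1/2)) :=
      Measure.integrableOn_of_bounded (by simp) hDm.aestronglyMeasurable
        (M := Ksup K * (M * (h / 2) ^ β₀)) (Filter.Eventually.of_forall fun z => by
          rw [norm_eq_abs, abs_of_nonneg (Delta_nonneg K f h _)]
          exact Delta_le hK hM hβ hf hh _)
    have h1 : |∫ v, K v * locErr K f a (y + b * v)|
        ≤ Ksup K * ∫ v in Set.Icc (-(1/2) : ℝ) (1/2), D v := by
      rw [← integral_const_mul, ← integral_indicator measurableSet_Icc]
      refine abs_integral_le_integral_abs.trans (integral_mono_of_nonneg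
        (Filter.Eventually.of_forall fun _ => abs_nonneg _) ?_
        (Filter.Eventually.of_forall fun v => ?_))
      · exact (integrable_indicator_iff measurableSet_Icc).2 (hDi.const_mul _)
      · simp only
        by_cases hv : v ∈ Set.Icc (-(1/2) : ℝ) (1/2)
        · rw [Set.indicator_of_mem hv, abs_mul]
          exact mul_le_mul (hK.abs_le_Ksup v) (abs_locErr_le_Delta hK hM hβ hf ha _)
            (abs_nonneg _) hκ
        · rw [Set.indicator_of_notMem hv, hK.supp v hv, zero_mul, abs_zero]
    refine h1.trans (mul_le_mul_of_nonneg_left ?_ hκ)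
    refine le_trans (le_of_eq ?_)
      (average_le_DeltaStar hK hM hβ hf hh (half_pos (abs_pos.2 hb)) y)
    rw [integral_Icc_eq_integral_Ioc, integral_Icc_eq_integral_Ioc,
      ← intervalIntegral.integral_of_le (by norm_num),
      ← intervalIntegral.integral_of_le (by linarith [abs_nonneg b]), hD,
      intervalIntegral.integral_comp_add_mul _ hb, smul_eq_mul,
      show 2 * (|b| / 2) = |b| by ring]
    rcases abs_cases b with ⟨e, _⟩ | ⟨e, _⟩ <;> rw [e]
    · congr 2 <;> ring
    · rw [intervalIntegral.integral_symm, mul_neg, inv_neg, neg_mul]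
      congr 3 <;> ring

end Bias

section SampleSize

/-- The consequences of the sample size condition used in the analysis. -/
structure Regime (P : Pars) (β₀ M : ℝ) (n : ℕ) : Prop where
  three_le : 3 ≤ n
  one_le_log : 1 ≤ log n
  frakh_pos : 0 < frakh P.ω n
  frakh_le : frakh P.ω n ≤ 1
  holder_frakh : M * frakh P.ω n ^ β₀ ≤ 1
  inv_le_hmin : (n : ℝ)⁻¹ ≤ hmin P.ω n
  hmin_le : hmin P.ω n ≤ 1
  holder_hmin : M * (log n ^ ((1 : ℝ) / P.ω) * hmin P.ω n ^ β₀) ≤ 1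
  C3_le : ((n : ℝ) * frakh P.ω n ^ 2) ^ (-(1/2) : ℝ) * C3f P n ≤ 1 / 2

theorem tendsto_log_rpow_div_rpow (a : ℝ) {s : ℝ} (hs : 0 < s) :
    Filter.Tendsto (fun n : ℕ => log n ^ a / (n : ℝ) ^ s) Filter.atTop (nhds 0) :=
  (isLittleO_log_rpow_rpow_atTop a hs).tendsto_div_nhds_zero.comp tendsto_natCast_atTop_atTop

theorem tendsto_log_natCast : Filter.Tendsto (fun n : ℕ => log n) Filter.atTop Filter.atTop :=
  tendsto_log_atTop.comp tendsto_natCast_atTop_atTop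

theorem eventually_n0 {β₀ ω : ℝ} (hβ : 0 < β₀) (M : ℝ) :
    ∀ᶠ n : ℕ in Filter.atTop,
      max M 1 * max (frakh ω n ^ β₀) (log n ^ ((1 : ℝ) / ω) * hmin ω n ^ β₀) ≤ 1 := by
  have h1 : Filter.Tendsto (fun n : ℕ => frakh ω n ^ β₀) Filter.atTop (nhds 0) := by
    have h := (tendsto_log_rpow_div_rpow ((1 : ℝ) + 1 / ω) one_pos).sqrt.rpow_const
      (p := β₀) (Or.inr hβ.le)
    rw [sqrt_zero, zero_rpow hβ.ne'] at h
    refine h.congr fun n => ?_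
    rw [frakh, rpow_one, div_eq_inv_mul]
  have h2 : Filter.Tendsto (fun n : ℕ => log n ^ ((1 : ℝ) / ω) * hmin ω n ^ β₀)
      Filter.atTop (nhds 0) := by
    refine (tendsto_log_rpow_div_rpow (1 / ω + (1 + 2 / ω) * β₀) hβ).congr' ?_
    filter_upwards [Filter.eventually_ge_atTop 3] with n hn
    have hn' : (1 : ℝ) < n := by exact_mod_cast (by omega : 1 < n)
    have hL : 0 < log n := log_pos hn'
    rw [hmin, mul_rpow (by positivity) (by positivity), ← rpow_mul hL.le, rpow_add hL,
      inv_rpow (by positivity)]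
    field_simp
  have h3 : Filter.Tendsto (fun n : ℕ => max M 1 *
      max (frakh ω n ^ β₀) (log n ^ ((1 : ℝ) / ω) * hmin ω n ^ β₀)) Filter.atTop (nhds 0) := by
    simpa using (h1.max h2).const_mul (max M 1)
  exact (h3.eventually_lt_const one_pos).mono fun n h => h.le

variable {P : Pars}

theorem nat_mul_frakh_sq (ω : ℝ) {n : ℕ} (hn : 1 ≤ n) :
    (n : ℝ) * frakh ω n ^ 2 = log n ^ ((1 : ℝ) + 1 / ω) := by
  have hn' : (1 : ℝ) ≤ n := by exact_mod_cast hn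
  have hL : 0 ≤ log n := log_nonneg hn'
  rw [frakh, sq_sqrt (by positivity), mul_inv_cancel_left₀ (by positivity)]

theorem nat_mul_hmin (ω : ℝ) {n : ℕ} (hn : 1 ≤ n) :
    (n : ℝ) * hmin ω n = log n ^ ((1 : ℝ) + 2 / ω) := by
  have hn' : (1 : ℝ) ≤ n := by exact_mod_cast hn
  rw [hmin, mul_inv_cancel_left₀ (by positivity)]

theorem one_le_gl_rpow (hgl : P.gl ∈ Set.Ioo (0 : ℝ) 1) : 1 ≤ P.gl ^ (-(1/2) : ℝ) :=
  one_le_rpow_of_pos_of_le_one_of_nonpos hgl.1 hgl.2.le (by norm_num)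

theorem c3f_eq (hK : KernelHyp P.K P.Q) (hgl : P.gl ∈ Set.Ioo (0 : ℝ) 1) {n : ℕ} (hn : 1 ≤ n) :
    c3f P n = (365 * log (5 * P.Q * P.gl ^ (-(1/2) : ℝ)) + 197) + (730 + 8 * P.r) * log n := by
  have hn' : (1 : ℝ) ≤ n := by exact_mod_cast hn
  have hQ : 0 < P.Q := by linarith [hK.half_le_Q]
  have hg := one_le_gl_rpow hgl
  have : 5 * (n : ℝ) ^ 2 * P.Q * P.gl ^ (-(1/2) : ℝ)
      = (n : ℝ) ^ 2 * (5 * P.Q * P.gl ^ (-(1/2) : ℝ)) := by ring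
  rw [c3f, this, log_mul (by positivity) (by positivity), log_pow]
  push_cast
  ring

theorem le_c3f (hK : KernelHyp P.K P.Q) (hgl : P.gl ∈ Set.Ioo (0 : ℝ) 1) (hr : 1 ≤ P.r) {n : ℕ}
    (hn : 1 ≤ n) : 197 ≤ c3f P n := by
  have hn' : (1 : ℝ) ≤ n := by exact_mod_cast hn
  have hQ := hK.half_le_Q
  have hg := one_le_gl_rpow hgl
  have h1 : 0 ≤ log (5 * (n : ℝ) ^ 2 * P.Q * P.gl ^ (-(1/2) : ℝ)) := by
    apply log_nonneg
    calc (1 : ℝ) ≤ 5 * 1 ^ 2 * (1 / 2) * 1 := by norm_num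
      _ ≤ _ := by gcongr
  have h2 : 0 ≤ log n := log_nonneg hn'
  rw [c3f]
  nlinarith [mul_nonneg (by linarith : (0 : ℝ) ≤ P.r) h2]

theorem eventually_n1 (hK : KernelHyp P.K P.Q) (hgl : P.gl ∈ Set.Ioo (0 : ℝ) 1) (hω : 0 < P.ω)
    (hr : 1 ≤ P.r) : ∀ᶠ n : ℕ in Filter.atTop,
      ((n : ℝ) * frakh P.ω n ^ 2) ^ (-(1/2) : ℝ) * C3f P n ≤ 1 / 2 := by
  set α := 365 * log (5 * P.Q * P.gl ^ (-(1/2) : ℝ)) + 197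
  set b := 730 + 8 * P.r
  have h1 : Filter.Tendsto (fun n : ℕ => c3f P n * log n ^ (-(1 + 1 / P.ω) : ℝ)) Filter.atTop
      (nhds 0) := by
    have ha := ((tendsto_rpow_neg_atTop (y := 1 + 1 / P.ω) (by positivity)).comp
      tendsto_log_natCast).const_mul α
    have hb := ((tendsto_rpow_neg_atTop (y := 1 / P.ω) (by positivity)).comp
      tendsto_log_natCast).const_mul b
    have hab := ha.add hb
    simp only [mul_zero, add_zero] at hab
    refine hab.congr' ?_
    filter_upwards [Filter.eventually_ge_atTop 3] with n hn
    have hn' : (1 : ℝ) < n := by exact_mod_cast (by omega : 1 < n)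
    have hL : 0 < log n := log_pos hn'
    rw [c3f_eq hK hgl (by omega), Function.comp, Function.comp, neg_add, rpow_add hL,
      rpow_neg_one]
    linear_combination (-b * log n ^ (-(1 / P.ω))) * mul_inv_cancel₀ hL.ne'
  set A := 2 * √2 * P.gl ^ (-(1/2) : ℝ) * Ksup P.K ^ 2
  set B := 8 / 3 * P.gl⁻¹ * Ksup P.K ^ 2
  have h2 : Filter.Tendsto (fun n : ℕ => A * √(c3f P n * log n ^ (-(1 + 1 / P.ω) : ℝ))
      + B * (c3f P n * log n ^ (-(1 + 1 / P.ω) : ℝ))) Filter.atTop (nhds 0) := by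
    simpa using (h1.sqrt.const_mul A).add (h1.const_mul B)
  filter_upwards [h2.eventually_lt_const (by norm_num : (0 : ℝ) < 1 / 2),
    Filter.eventually_ge_atTop 3] with n h hn
  refine le_of_eq_of_le ?_ h.le
  have hn' : (1 : ℝ) < n := by exact_mod_cast (by omega : 1 < n)
  have hL : 0 < log n := log_pos hn'
  have hc := le_c3f hK hgl hr (by omega : 1 ≤ n)
  rw [C3f, nat_mul_frakh_sq _ (by omega)]
  set u := (log n ^ ((1 : ℝ) + 1 / P.ω)) ^ (-(1/2) : ℝ) with hu
  have hu0 : 0 ≤ u := by positivity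
  have hu2 : log n ^ (-(1 + 1 / P.ω) : ℝ) = u ^ 2 := by
    rw [hu, ← rpow_mul hL.le, ← rpow_natCast, ← rpow_mul hL.le]
    congr 1
    push_cast
    ring
  rw [hu2, sqrt_mul (by linarith), sqrt_sq hu0]
  ring

theorem three_le_n1 (hK : KernelHyp P.K P.Q) (hgl : P.gl ∈ Set.Ioo (0 : ℝ) 1) (hω : 0 < P.ω)
    (hr : 1 ≤ P.r) (h : ((2 : ℕ) : ℝ) * frakh P.ω 2 ^ 2 = log (2 : ℕ) ^ ((1 : ℝ) + 1 / P.ω)) :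
    ¬ (((2 : ℕ) : ℝ) * frakh P.ω 2 ^ 2) ^ (-(1/2) : ℝ) * C3f P 2 ≤ 1 / 2 := by
  have hL0 : 0 < log (2 : ℕ) := log_pos (by norm_num)
  have hL1 : log (2 : ℕ) ≤ 1 := by
    have := log_two_lt_d9
    norm_num at this ⊢
    linarith
  have hc := le_c3f hK hgl hr (by norm_num : 1 ≤ 2)
  have hu : 1 ≤ (log (2 : ℕ) ^ ((1 : ℝ) + 1 / P.ω)) ^ (-(1/2) : ℝ) := by
    refine one_le_rpow_of_pos_of_le_one_of_nonpos (by positivity) ?_ (by norm_num)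
    exact rpow_le_one hL0.le hL1 (by positivity)
  have hg := one_le_gl_rpow hgl
  have hκ := hK.one_le_Ksup
  have hgl0 := hgl.1
  have h1 : 1 ≤ C3f P 2 := by
    rw [C3f, h]
    have hs2 : 1 ≤ √2 := one_le_sqrt.2 (by norm_num)
    have hs : 1 ≤ √(c3f P 2) := one_le_sqrt.2 (by linarith)
    have : 0 ≤ 8 / 3 * P.gl⁻¹ * Ksup P.K ^ 2 * c3f P 2
        * (log (2 : ℕ) ^ ((1 : ℝ) + 1 / P.ω)) ^ (-(1/2) : ℝ) := by positivity
    refine le_add_of_le_of_nonneg ?_ this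
    calc (1 : ℝ) ≤ 2 * 1 * 1 * 1 ^ 2 * 1 := by norm_num
      _ ≤ _ := by gcongr
  rw [h]
  nlinarith

theorem regime {β₀ M : ℝ} (hβ : 0 < β₀) (hM : 0 < M) (hK : KernelHyp P.K P.Q)
    (hgl : P.gl ∈ Set.Ioo (0 : ℝ) 1) (hω : 0 < P.ω) (hr : 1 ≤ P.r) {n : ℕ}
    (hn : max (n0 β₀ M P.ω) (n1 P) ≤ n) : Regime P β₀ M n := by
  have s0 : {m : ℕ | 1 ≤ m ∧ ∀ n : ℕ, m ≤ n → max M 1 * max (frakh P.ω n ^ β₀)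
      (log n ^ ((1 : ℝ) / P.ω) * hmin P.ω n ^ β₀) ≤ 1}.Nonempty := by
    obtain ⟨m, hm⟩ := Filter.eventually_atTop.1 (eventually_n0 (ω := P.ω) hβ M)
    exact ⟨max m 1, le_max_right _ _, fun n h => hm n ((le_max_left _ _).trans h)⟩
  have s1 : {m : ℕ | 1 ≤ m ∧ ∀ n : ℕ, m ≤ n →
      ((n : ℝ) * frakh P.ω n ^ 2) ^ (-(1/2) : ℝ) * C3f P n ≤ 1 / 2}.Nonempty := by
    obtain ⟨m, hm⟩ := Filter.eventually_atTop.1 (eventually_n1 hK hgl hω hr)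
    exact ⟨max m 1, le_max_right _ _, fun n h => hm n ((le_max_left _ _).trans h)⟩
  have h0 := (Nat.sInf_mem s0).2 n ((le_max_left _ _).trans hn)
  have h1 := (Nat.sInf_mem s1).2
  have hn3 : 3 ≤ n := by
    refine le_trans ?_ ((le_max_right _ _).trans hn)
    by_contra h
    exact three_le_n1 hK hgl hω hr (nat_mul_frakh_sq P.ω (by norm_num : 1 ≤ 2))
      (h1 2 (by rw [n1] at h; omega))
  have hn' : (3 : ℝ) ≤ n := by exact_mod_cast hn3
  have hL : 1 ≤ log n := by
    rw [le_log_iff_exp_le (by linarith)]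
    linarith [exp_one_lt_d9]
  have hM1 : 1 ≤ max M 1 := le_max_right _ _
  have hf0 : 0 < frakh P.ω n := sqrt_pos.2 (by positivity)
  have hm0 : 0 < hmin P.ω n := by rw [hmin]; positivity
  have hLω : 1 ≤ log n ^ ((1 : ℝ) / P.ω) := one_le_rpow hL (by positivity)
  have hmax : ∀ a, 0 ≤ a → a ≤ max (frakh P.ω n ^ β₀) (log n ^ ((1 : ℝ) / P.ω) *
      hmin P.ω n ^ β₀) → a ≤ 1 ∧ M * a ≤ 1 := fun a ha0 ha => by
    have e1 : max M 1 * a ≤ 1 := (mul_le_mul_of_nonneg_left ha (by positivity)).trans h0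
    constructor
    · exact (le_mul_of_one_le_left ha0 hM1).trans e1
    · exact (mul_le_mul_of_nonneg_right (le_max_left M 1) ha0).trans e1
  have hA := hmax _ (by positivity) (le_max_left _ _)
  have hB := hmax _ (by positivity) (le_max_right _ _)
  refine ⟨hn3, hL, hf0, ?_, hA.2, ?_, ?_, hB.2, h1 n ((le_max_right _ _).trans hn)⟩
  · by_contra h
    push Not at h
    linarith [hA.1, one_lt_rpow h hβ]
  · rw [hmin]
    exact le_mul_of_one_le_right (by positivity) (one_le_rpow hL (by positivity))
  · by_contra h
    push Not at h
    have := one_lt_rpow h hβ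
    nlinarith [hB.1]

/-- A dyadic bandwidth comparable to the oracle one, at which the bias is under control. -/
theorem exists_oracle_bandwidth {β₀ M : ℝ} (hβ : 0 < β₀) (hM : 0 < M) (hK : KernelHyp P.K P.Q)
    {n : ℕ} (H : Regime P β₀ M n) {f : ℝ → ℝ} (hf : f ∈ HolderBall β₀ M) (y : ℝ) :
    0 < hstar P.K f P.ω n y ∧ ∃ h ∈ Hgrid P.ω n, hstar P.K f P.ω n y ≤ 4 * h ∧
      √(n * h) * DeltaStar P.K f (2 * h) y ≤ Ksup P.K * √(log n) := by
  have hn' : (3 : ℝ) ≤ n := by exact_mod_cast H.three_le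
  have hL := H.one_le_log
  have hm0 : 0 < hmin P.ω n := (by positivity : 0 < (n : ℝ)⁻¹).trans_le H.inv_le_hmin
  have hκ := hK.one_le_Ksup
  have small : ∀ h, 0 ≤ h → h ≤ hmin P.ω n →
      √(n * h) * DeltaStar P.K f (2 * h) y ≤ Ksup P.K * √(log n) := by
    intro h h0 hh
    have e1 : √(n * h) ≤ √(log n) * log n ^ ((1 : ℝ) / P.ω) := by
      calc √(n * h) ≤ √(n * hmin P.ω n) := by gcongr
        _ = √(log n) * log n ^ ((1 : ℝ) / P.ω) := by
          rw [nat_mul_hmin _ (by have := H.three_le; omega), sqrt_eq_rpow, sqrt_eq_rpow,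
            ← rpow_mul (by linarith), ← rpow_add (by linarith)]
          congr 1
          ring
    have e2 : DeltaStar P.K f (2 * h) y ≤ Ksup P.K * (M * hmin P.ω n ^ β₀) := by
      refine (DeltaStar_le hK hM hβ hf (by linarith) y).trans ?_
      rw [mul_div_cancel_left₀ _ two_ne_zero]
      gcongr
    calc _ ≤ (√(log n) * log n ^ ((1 : ℝ) / P.ω)) * (Ksup P.K * (M * hmin P.ω n ^ β₀)) :=
          mul_le_mul e1 e2 (DeltaStar_nonneg _ _ _ _) (by positivity)
      _ = Ksup P.K * √(log n) * (M * (log n ^ ((1 : ℝ) / P.ω) * hmin P.ω n ^ β₀)) := by ring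
      _ ≤ Ksup P.K * √(log n) * 1 := by
          gcongr
          exact H.holder_hmin
      _ = _ := mul_one _
  set S := {h | h ∈ Set.Icc (hmin P.ω n) 1 ∧
    √(n * h) * DeltaStar P.K f h y ≤ Ksup P.K * √(log n)} with hS
  have hSb : BddAbove S := ⟨1, fun h hh => hh.1.2⟩
  have hSm : hmin P.ω n ∈ S := by
    refine ⟨⟨le_rfl, H.hmin_le⟩, le_trans ?_ (small _ hm0.le le_rfl)⟩
    gcongr
    exact DeltaStar_mono hK hM hβ hf hm0.le (by linarith) y
  have hlo : hmin P.ω n ≤ hstar P.K f P.ω n y := le_csSup hSb hSm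
  have hhi : hstar P.K f P.ω n y ≤ 1 := csSup_le ⟨_, hSm⟩ fun h hh => hh.1.2
  set s := hstar P.K f P.ω n y with hs
  have hs0 : 0 < s := hm0.trans_le hlo
  refine ⟨hs0, ?_⟩
  have hex : ∃ k : ℕ, ((1 : ℝ) / 2) ^ k < s / 2 :=
    exists_pow_lt_of_lt_one (by linarith) (by norm_num)
  classical
  have hk := Nat.find_spec hex
  have hmink := fun m => Nat.find_min hex (m := m)
  generalize Nat.find hex = k at hk hmink
  have hzpow : ∀ j : ℕ, ((1 : ℝ) / 2) ^ j = (2 : ℝ) ^ (-(j : ℤ)) := fun j => by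
    rw [zpow_neg, zpow_natCast, one_div, inv_pow]
  obtain ⟨j, rfl⟩ : ∃ j, k = j + 1 := by
    refine Nat.exists_eq_succ_of_ne_zero ?_
    rintro rfl
    rw [pow_zero] at hk
    linarith
  have hj : s / 2 ≤ ((1 : ℝ) / 2) ^ j := not_lt.1 (hmink j (Nat.lt_succ_self j))
  have hj1 : ((1 : ℝ) / 2) ^ j ≤ 1 := pow_le_one₀ (by norm_num) (by norm_num)
  have hjs : ((1 : ℝ) / 2) ^ (j + 1) = ((1 : ℝ) / 2) ^ j / 2 := by rw [pow_succ]; ring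
  by_cases hc : hmin P.ω n / 2 ≤ ((1 : ℝ) / 2) ^ (j + 1)
  · refine ⟨((1 : ℝ) / 2) ^ (j + 1), ⟨⟨j + 1, hzpow _⟩, hc, by linarith⟩, by linarith, ?_⟩
    set h := ((1 : ℝ) / 2) ^ (j + 1) with hh
    have h0 : 0 < h := by positivity
    obtain ⟨h', hh', hlt⟩ := exists_lt_of_lt_csSup ⟨_, hSm⟩ (by linarith : 2 * h < s)
    refine le_trans ?_ hh'.2
    have := DeltaStar_mono hK hM hβ hf (by linarith : (0 : ℝ) ≤ 2 * h) hlt.le y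
    have h3 : h ≤ h' := by linarith
    have := DeltaStar_nonneg P.K f (2 * h) y
    gcongr
  · push Not at hc
    refine ⟨((1 : ℝ) / 2) ^ j, ⟨⟨j, hzpow _⟩, by linarith, hj1⟩, by linarith, ?_⟩
    exact small _ (by positivity) (by linarith)

end SampleSize

section Budget

theorem rpow_neg_half_sq {a : ℝ} (ha : 0 < a) : (a ^ (-(1/2) : ℝ)) ^ 2 = a⁻¹ := by
  rw [← rpow_natCast, ← rpow_mul ha.le, ← rpow_neg_one]
  norm_num

/-- The Bernstein threshold is dominated by the thresholds of the selection rule. -/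
theorem bernstein_threshold_le {κ gl D b s c u w ε n : ℝ} (hκ : 1 ≤ κ) (hgl : 0 < gl)
    (hgl1 : gl ≤ 1) (hb : 0 < b) (hs : 1 ≤ s) (hc : 1 ≤ c) (hn : 0 < n) (hu : 0 < u)
    (hD : D / n = u ^ 2) (hw : u ≤ √2 * w) (hε : 2 * (ε * b) ≤ κ * u) :
    2 * √(c / 2 * (κ ^ 4 * D / gl * s ^ 2) / n) + c / 2 * (D * κ ^ 2 / gl * b) / n + 2 * (ε * b)
      ≤ (2 * √2 * s * gl ^ (-(1/2) : ℝ) * κ ^ 2 * √c + 8 / 3 * c * b * w * gl⁻¹ * κ ^ 2) * u := by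
  set γ := gl ^ (-(1/2) : ℝ) with hγ
  have hγ1 : 1 ≤ γ := one_le_rpow_of_pos_of_le_one_of_nonpos hgl hgl1 (by norm_num)
  have hγ2 : gl⁻¹ = γ ^ 2 := (rpow_neg_half_sq hgl).symm
  have hD' : D = u ^ 2 * n := by rw [← hD]; field_simp
  have s2 : √2 ^ 2 = 2 := sq_sqrt (by norm_num)
  have s2p : 0 < √2 := by positivity
  have s21 : √2 ≤ 3 / 2 := by rw [sqrt_le_left (by norm_num)]; norm_num
  have s22 : 1 ≤ √2 := one_le_sqrt.2 (by norm_num)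
  have sc : √c ^ 2 = c := sq_sqrt (by linarith)
  have sc1 : 1 ≤ √c := one_le_sqrt.2 hc
  have e1 : 2 * √(c / 2 * (κ ^ 4 * D / gl * s ^ 2) / n) = √2 * s * γ * κ ^ 2 * √c * u := by
    have : c / 2 * (κ ^ 4 * D / gl * s ^ 2) / n = (√2 / 2 * s * γ * κ ^ 2 * √c * u) ^ 2 := by
      rw [hD', div_eq_mul_inv _ gl, hγ2]
      simp only [mul_pow, div_pow, sc, s2]
      field_simp
    rw [this, sqrt_sq (by positivity)]
    ring
  have e2 : c / 2 * (D * κ ^ 2 / gl * b) / n ≤ 8 / 3 * c * b * w * gl⁻¹ * κ ^ 2 * u := by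
    have hw' : u / 2 ≤ 8 / 3 * w := by nlinarith
    have : c / 2 * (D * κ ^ 2 / gl * b) / n = u / 2 * (c * b * gl⁻¹ * κ ^ 2 * u) := by
      rw [hD']; field_simp
    rw [this]
    have h0 : 0 ≤ c * b * gl⁻¹ * κ ^ 2 * u := by positivity
    calc _ ≤ 8 / 3 * w * (c * b * gl⁻¹ * κ ^ 2 * u) := mul_le_mul_of_nonneg_right hw' h0
      _ = _ := by ring
  have e3 : κ * u ≤ √2 * s * γ * κ ^ 2 * √c * u := by
    have : 1 * 1 * 1 * κ ^ 1 * 1 * u ≤ √2 * s * γ * κ ^ 2 * √c * u := by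
      gcongr
      norm_num
    linarith
  rw [e1]
  linarith

/-- Absorption of the net cardinality in the exponent. -/
theorem card_mul_exp_le {A n r c C : ℝ} {a q : ℝ} (hA : 1 ≤ A) (hn : 0 < n) (hC : C ≤ A ^ a)
    (hc : a * log A + 4 * r * log n ≤ c / 2) (hq : q = n ^ (-(4 * r))) :
    C * exp (-(c / 2)) ≤ q := by
  have hA0 : 0 < A := by linarith
  rw [hq, rpow_def_of_pos hn]
  rw [rpow_def_of_pos hA0] at hC
  calc C * exp (-(c / 2)) ≤ exp (log A * a) * exp (-(c / 2)) := by gcongr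
    _ = exp (log A * a + -(c / 2)) := (exp_add _ _).symm
    _ ≤ _ := by
      apply exp_le_exp.2
      linarith

end Budget

section Nets

variable {K : ℝ → ℝ} {Q gl : ℝ} {g : (Fin 2 → ℝ) → ℝ}

/-- Lipschitz dependence of the kernel weights on the window. -/
theorem abs_wt_sub_le (hK : KernelHyp K Q) (hgl : 0 < gl) {M M' : Matrix (Fin 2) (Fin 2) ℝ}
    {t t' x : Fin 2 → ℝ} {D ζ η : ℝ} (hM' : 0 ≤ M'.det) (hD : M'.det ≤ D)
    (hdet : |M.det - M'.det| ≤ ζ)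
    (hη : ∀ i, |M.mulVec (x - t) i - M'.mulVec (x - t') i| ≤ η) (hg : gl ≤ g x) :
    |wt K g M t x - wt K g M' t' x| ≤ (ζ * Ksup K ^ 2 + D * (2 * Ksup K * Q * η)) / gl := by
  have hκ : 0 ≤ Ksup K := zero_le_one.trans hK.one_le_Ksup
  have hQ := hK.Q_nonneg
  have hgx := hgl.trans_le hg
  have hη0 := (abs_nonneg _).trans (hη 0)
  set w := M.mulVec (x - t)
  set w' := M'.mulVec (x - t')
  have h1 : |K2 K w - K2 K w'| ≤ 2 * Ksup K * Q * η := by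
    have e : K2 K w - K2 K w' = (K (w 0) - K (w' 0)) * K (w 1) + K (w' 0) * (K (w 1) - K (w' 1)) :=
      by rw [K2, K2]; ring
    rw [e]
    refine (abs_add_le _ _).trans ?_
    rw [abs_mul, abs_mul]
    have a0 : |K (w 0) - K (w' 0)| ≤ Q * η :=
      (hK.lip _ _).trans (mul_le_mul_of_nonneg_left (hη 0) hQ)
    have a1 : |K (w 1) - K (w' 1)| ≤ Q * η :=
      (hK.lip _ _).trans (mul_le_mul_of_nonneg_left (hη 1) hQ)
    have b0 := mul_le_mul a0 (hK.abs_le_Ksup (w 1)) (abs_nonneg _) (by positivity)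
    have b1 := mul_le_mul (hK.abs_le_Ksup (w' 0)) a1 (abs_nonneg _) hκ
    linarith
  have h2 : wt K g M t x - wt K g M' t' x
      = ((M.det - M'.det) * K2 K w + M'.det * (K2 K w - K2 K w')) / g x := by
    rw [wt, wt]; ring
  rw [h2, abs_div, abs_of_pos hgx]
  have h3 : |(M.det - M'.det) * K2 K w + M'.det * (K2 K w - K2 K w')|
      ≤ ζ * Ksup K ^ 2 + D * (2 * Ksup K * Q * η) := by
    refine (abs_add_le _ _).trans ?_
    rw [abs_mul, abs_mul, abs_of_nonneg hM']
    exact add_le_add (mul_le_mul hdet (hK.abs_K2_le w) (abs_nonneg _) ((abs_nonneg _).trans hdet))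
      (mul_le_mul hD h1 (abs_nonneg _) (hM'.trans hD))
  gcongr
  exact (abs_nonneg _).trans h3

theorem exists_floor_net {a L : ℝ} (hL : 0 < L) {N : ℕ} (hN : 0 < N) {x : ℝ}
    (hx : x ∈ Set.Icc a (a + L)) :
    ∃ j ∈ Finset.range (N + 1), |x - (a + L * j / N)| ≤ L / N := by
  have hN' : (0 : ℝ) < N := by exact_mod_cast hN
  have h0 : 0 ≤ (x - a) * N / L := by
    have : 0 ≤ x - a := by linarith [hx.1]
    positivity
  have h1 := Nat.floor_le h0
  have h2 := Nat.lt_floor_add_one ((x - a) * N / L)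
  rw [le_div_iff₀ hL] at h1
  rw [div_lt_iff₀ hL] at h2
  refine ⟨⌊(x - a) * N / L⌋₊, ?_, ?_⟩
  · rw [Finset.mem_range, Nat.lt_succ_iff]
    apply Nat.floor_le_of_le
    rw [div_le_iff₀ hL]
    nlinarith [hx.2]
  · rw [abs_le, le_div_iff₀ hN', ← neg_div, div_le_iff₀ hN']
    have : (x - (a + L * (⌊(x - a) * N / L⌋₊ : ℝ) / N)) * N
        = (x - a) * N - ⌊(x - a) * N / L⌋₊ * L := by
      field_simp
      ring
    rw [this]
    constructor <;> nlinarith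

theorem exists_angle {e : Fin 2 → ℝ} (he : e ∈ S1) :
    ∃ φ ∈ Set.Icc (-π) (-π + 2 * π), e 0 = cos φ ∧ e 1 = sin φ := by
  have h1 : e 0 ^ 2 + e 1 ^ 2 = 1 := he
  set z : ℂ := ⟨e 0, e 1⟩ with hz
  have hn : ‖z‖ = 1 := by
    rw [Complex.norm_def, Complex.normSq_apply, ← sq, ← sq]
    simp [hz, h1]
  have hz0 : z ≠ 0 := by
    rw [← norm_ne_zero_iff, hn]
    exact one_ne_zero
  refine ⟨z.arg, ⟨(Complex.neg_pi_lt_arg z).le, by linarith [Complex.arg_le_pi z]⟩, ?_, ?_⟩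
  · rw [Complex.cos_arg hz0, hn, div_one]
  · rw [Complex.sin_arg, hn, div_one]

variable {t : Fin 2 → ℝ}

/-- A finite net for the windows with bandwidth `h`. -/
theorem exists_win_net (hK : KernelHyp K Q) (hgl : 0 < gl) (hg : DesignOK g gl)
    (ht : ∀ i, |t i| ≤ 1 / 2) {n : ℝ} (hn : 1 ≤ n) {h : ℝ} (hh : h ∈ Set.Ioc (0 : ℝ) 1)
    (hhn : h⁻¹ ≤ 2 * n) {N : ℕ} (hN : 0 < N) :
    ∃ s : Finset ((Fin 2 → ℝ) × ℝ), ↑s ⊆ S1 ×ˢ Set.Icc (1 : ℝ) 2 ∧ s.card ≤ (N + 1) * (N + 1) ∧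
      ∀ a ∈ S1 ×ˢ Set.Icc (1 : ℝ) 2, ∃ a' ∈ s, ∀ x,
        |wt K g (win a.1 a.2 h) t x - wt K g (win a'.1 a'.2 h) t x|
          ≤ 264 * n ^ 2 * Ksup K * Q / (gl * N) := by
  have hN' : (0 : ℝ) < N := by exact_mod_cast hN
  have hκ := hK.one_le_Ksup
  have hκQ := hK.Ksup_le
  have hQ := hK.half_le_Q
  have hh0 := hh.1
  classical
  set pt : ℕ × ℕ → (Fin 2 → ℝ) × ℝ := fun j =>
    (![cos (-π + 2 * π * j.1 / N), sin (-π + 2 * π * j.1 / N)], 1 + 1 * j.2 / N) with hpt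
  refine ⟨(Finset.range (N + 1) ×ˢ Finset.range (N + 1)).image pt, ?_, ?_, ?_⟩
  · intro a ha
    simp only [Finset.coe_image, Set.mem_image, Finset.mem_coe, Finset.mem_product,
      Finset.mem_range] at ha
    obtain ⟨⟨j, l⟩, ⟨_, hl⟩, rfl⟩ := ha
    refine ⟨?_, ?_, ?_⟩
    · change cos _ ^ 2 + sin _ ^ 2 = 1
      exact cos_sq_add_sin_sq _
    · simp only [hpt]
      have : (0 : ℝ) ≤ 1 * l / N := by positivity
      linarith
    · simp only [hpt]
      have : (1 * l / N : ℝ) ≤ 1 := by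
        rw [div_le_one hN', one_mul]
        exact_mod_cast Nat.lt_succ_iff.1 hl
      linarith
  · refine Finset.card_image_le.trans ?_
    rw [Finset.card_product, Finset.card_range]
  · rintro ⟨e, ρ⟩ ⟨he, hρ⟩
    simp only at he hρ
    obtain ⟨φ, hφ, e0, e1⟩ := exists_angle he
    obtain ⟨j, hj, hφj⟩ := exists_floor_net (by positivity) hN hφ
    obtain ⟨l, hl, hρl⟩ := exists_floor_net (a := 1) one_pos hN (x := ρ)
      (by rwa [show (1 : ℝ) + 1 = 2 by norm_num])
    refine ⟨pt (j, l), Finset.mem_image_of_mem _ (Finset.mem_product.2 ⟨hj, hl⟩), fun x => ?_⟩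
    have hmem : pt (j, l) ∈ S1 ×ˢ Set.Icc (1 : ℝ) 2 := by
      refine ⟨?_, ?_, ?_⟩
      · change cos _ ^ 2 + sin _ ^ 2 = 1
        exact cos_sq_add_sin_sq _
      · simp only [hpt]
        have : (0 : ℝ) ≤ 1 * l / N := by positivity
        linarith
      · simp only [hpt]
        have : (1 * l / N : ℝ) ≤ 1 := by
          rw [div_le_one hN', one_mul]
          exact_mod_cast Nat.lt_succ_iff.1 (Finset.mem_range.1 hl)
        linarith
    have hde : ∀ i, |e i - (pt (j, l)).1 i| ≤ 7 / N := by
      have h7 : 2 * π / N ≤ 7 / N := by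
        gcongr
        linarith [pi_lt_d2]
      intro i
      refine le_trans ?_ (hφj.trans h7)
      fin_cases i
      · change |e 0 - cos _| ≤ _
        rw [e0]
        simpa [Real.dist_eq] using (lipschitzWith_cos).dist_le_mul φ (-π + 2 * π * j / N)
      · change |e 1 - sin _| ≤ _
        rw [e1]
        simpa [Real.dist_eq] using (lipschitzWith_sin).dist_le_mul φ (-π + 2 * π * j / N)
    have hdρ : |ρ - (pt (j, l)).2| ≤ 1 / N := hρl
    generalize pt (j, l) = a' at hmem hde hdρ
    obtain ⟨e', ρ'⟩ := a'
    obtain ⟨he', hρ'⟩ := hmem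
    simp only at he' hρ' hde hdρ ⊢
    have hρ0 : 0 < ρ := by linarith [hρ.1]
    have hρ0' : 0 < ρ' := by linarith [hρ'.1]
    by_cases hx : ∀ i, |x i - t i| ≤ 2
    · have hgx : gl ≤ g x := by
        refine hg.2.2 x ⟨fun i => ?_, fun i => ?_⟩ <;>
        · have h1 := abs_le.1 (hx i)
          have h2 := abs_le.1 (ht i)
          simp only
          linarith
      have hdet : |(win e ρ h).det - (win e' ρ' h).det| ≤ 2 * n * (2 / N) := by
        rw [det_win he hρ0.ne' hh0.ne', det_win he' hρ0'.ne' hh0.ne']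
        have : 1 / (h * ρ ^ 2) - 1 / (h * ρ' ^ 2)
            = h⁻¹ * ((ρ' - ρ) * ((1 / ρ + 1 / ρ') * (1 / (ρ * ρ')))) := by
          field_simp
          ring
        rw [this, abs_mul, abs_of_pos (inv_pos.2 hh0), abs_mul, abs_sub_comm]
        have a1 : 1 / ρ ≤ 1 := by rw [div_le_one hρ0]; exact hρ.1
        have a2 : 1 / ρ' ≤ 1 := by rw [div_le_one hρ0']; exact hρ'.1
        have a3 : 1 / (ρ * ρ') ≤ 1 := by
          rw [div_le_one (by positivity)]; nlinarith [hρ.1, hρ'.1]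
        have a4 : |(1 / ρ + 1 / ρ') * (1 / (ρ * ρ'))| ≤ 2 := by
          rw [abs_of_pos (by positivity)]
          calc _ ≤ (1 + 1) * (1 : ℝ) := by gcongr
            _ = 2 := by norm_num
        calc _ ≤ 2 * n * (1 / N * 2) := by gcongr
          _ = _ := by ring
      have hq : ∀ i, |e i / ρ - e' i / ρ'| ≤ 8 / N := by
        intro i
        have : e i / ρ - e' i / ρ' = (e i - e' i) * (1 / ρ) + e' i * ((ρ' - ρ) * (1 / (ρ * ρ'))) := by
          field_simp
          ring
        rw [this]
        refine (abs_add_le _ _).trans ?_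
        rw [abs_mul, abs_mul, abs_mul, abs_sub_comm ρ']
        have a1 : |1 / ρ| ≤ 1 := by
          rw [abs_of_pos (by positivity), div_le_one hρ0]; exact hρ.1
        have a3 : |1 / (ρ * ρ')| ≤ 1 := by
          rw [abs_of_pos (by positivity), div_le_one (by positivity)]; nlinarith [hρ.1, hρ'.1]
        calc |e i - e' i| * |1 / ρ| + |e' i| * (|ρ - ρ'| * |1 / (ρ * ρ')|)
            ≤ 7 / (N : ℝ) * 1 + 1 * (1 / (N : ℝ) * 1) := by
              have := hde i
              have := abs_apply_le_one_of_mem_S1 he' i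
              gcongr
          _ = 8 / (N : ℝ) := by ring
      have hdot : ∀ p q p' q' : ℝ, |p - p'| ≤ 8 / N → |q - q'| ≤ 8 / N →
          |p * (x 0 - t 0) + q * (x 1 - t 1) - (p' * (x 0 - t 0) + q' * (x 1 - t 1))| ≤ 32 / N := by
        intro p q p' q' hp hq'
        rw [show p * (x 0 - t 0) + q * (x 1 - t 1) - (p' * (x 0 - t 0) + q' * (x 1 - t 1))
          = (p - p') * (x 0 - t 0) + (q - q') * (x 1 - t 1) by ring]
        refine (abs_add_le _ _).trans ?_
        rw [abs_mul, abs_mul]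
        calc _ ≤ 8 / N * 2 + 8 / N * (2 : ℝ) := by
              have := hx 0
              have := hx 1
              gcongr
          _ = 32 / N := by ring
      have hη : ∀ i, |(win e ρ h).mulVec (x - t) i - (win e' ρ' h).mulVec (x - t) i|
          ≤ 2 * n * (32 / N) := by
        intro i
        fin_cases i
        · have h1 := hdot _ _ _ _ (hq 0) (hq 1)
          have h2 : (win e ρ h).mulVec (x - t) 0 - (win e' ρ' h).mulVec (x - t) 0
              = h⁻¹ * (e 0 / ρ * (x 0 - t 0) + e 1 / ρ * (x 1 - t 1)
                - (e' 0 / ρ' * (x 0 - t 0) + e' 1 / ρ' * (x 1 - t 1))) := by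
            simp [win, dotProduct, Fin.sum_univ_two]
            field_simp
          change |(win e ρ h).mulVec (x - t) 0 - (win e' ρ' h).mulVec (x - t) 0| ≤ _
          rw [h2, abs_mul, abs_of_pos (inv_pos.2 hh0)]
          gcongr
        · have h0 : |-e 1 / ρ - -e' 1 / ρ'| ≤ 8 / N := by
            rw [show -e 1 / ρ - -e' 1 / ρ' = -(e 1 / ρ - e' 1 / ρ') by ring, abs_neg]
            exact hq 1
          have h1 := hdot _ _ _ _ h0 (hq 0)
          have h2 : (win e ρ h).mulVec (x - t) 1 - (win e' ρ' h).mulVec (x - t) 1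
              = -e 1 / ρ * (x 0 - t 0) + e 0 / ρ * (x 1 - t 1)
                - (-e' 1 / ρ' * (x 0 - t 0) + e' 0 / ρ' * (x 1 - t 1)) := by
            simp [win, dotProduct, Fin.sum_univ_two]
          change |(win e ρ h).mulVec (x - t) 1 - (win e' ρ' h).mulVec (x - t) 1| ≤ _
          rw [h2]
          refine h1.trans (le_mul_of_one_le_left (by positivity) (by linarith))
      refine (abs_wt_sub_le hK hgl (det_win_pos he' hρ'.1 hh0).le
        ((det_win_le he' hρ'.1 hh0).trans hhn) hdet hη hgx).trans ?_
      have e1 : 2 * n * (2 / N) * Ksup K ^ 2 ≤ 8 * n ^ 2 * Ksup K * Q / N := by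
        rw [le_div_iff₀ hN']
        calc 2 * n * (2 / N) * Ksup K ^ 2 * N = 4 * n * (Ksup K * Ksup K) := by field_simp; ring
          _ ≤ 4 * (n * n) * (Ksup K * (2 * Q)) := by
              gcongr
              exact le_mul_of_one_le_left (by linarith) hn
          _ = _ := by ring
      have e2 : 2 * n * (2 * Ksup K * Q * (2 * n * (32 / N))) = 256 * n ^ 2 * Ksup K * Q / N := by
        ring
      rw [mul_comm gl, ← div_div]
      gcongr
      rw [e2]
      calc _ ≤ 8 * n ^ 2 * Ksup K * Q / N + 256 * n ^ 2 * Ksup K * Q / N := by gcongr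
        _ = _ := by ring
    · have hz : ∀ a : (Fin 2 → ℝ) × ℝ, a.1 ∈ S1 → a.2 ∈ Set.Icc (1 : ℝ) 2 →
          wt K g (win a.1 a.2 h) t x = 0 := by
        intro a ha1 ha2
        rw [wt]
        have : K2 K ((win a.1 a.2 h).mulVec (x - t)) = 0 := by
          by_contra hne
          obtain ⟨h0, h1⟩ := hK.abs_le_of_K2_ne_zero hne
          exact hx (abs_sub_le_of_win ha1 ha2 hh h0 h1)
        rw [this]
        simp
      rw [hz (e, ρ) he hρ, hz (e', ρ') he' hρ', sub_zero, abs_zero]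
      positivity

end Nets

section AuxNet

variable {K : ℝ → ℝ} {Q gl : ℝ} {g : (Fin 2 → ℝ) → ℝ}

/-- The isotropic window of the auxiliary estimator. -/
def auxWin (h : ℝ) : Matrix (Fin 2) (Fin 2) ℝ := !![1 / h, 0; 0, 1 / h]

/-- The inverse of the isotropic window. -/
def auxWinInv (h : ℝ) : Matrix (Fin 2) (Fin 2) ℝ := !![h, 0; 0, h]

theorem det_auxWin (h : ℝ) : (auxWin h).det = (h ^ 2)⁻¹ := by
  simp [auxWin, Matrix.det_fin_two, sq]

theorem auxWinInv_mul_auxWin {h : ℝ} (hh : h ≠ 0) : auxWinInv h * auxWin h = 1 := by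
  rw [auxWinInv, auxWin, Matrix.mul_fin_two, Matrix.one_fin_two]
  refine matrix_fin_two_congr ?_ ?_ ?_ ?_ <;> field_simp <;> simp

theorem auxWin_mulVec (h : ℝ) (w : Fin 2 → ℝ) (i : Fin 2) : (auxWin h).mulVec w i = w i / h := by
  fin_cases i <;> simp [auxWin, dotProduct, Fin.sum_univ_two, div_eq_inv_mul]

theorem auxWinInv_mulVec (h : ℝ) (w : Fin 2 → ℝ) (i : Fin 2) :
    (auxWinInv h).mulVec w i = h * w i := by
  fin_cases i <;> simp [auxWinInv, dotProduct, Fin.sum_univ_two]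

theorem FhatAux_eq (P : Pars) (n : ℕ) (d : Fin n → (Fin 2 → ℝ) × ℝ) (v : Fin 2 → ℝ) :
    FhatAux P n d v = estM P.K P.g n (auxWin (frakh P.ω n)) v d := by
  rw [FhatAux, estM_eq]
  congr 1
  refine Finset.sum_congr rfl fun i _ => ?_
  rw [wt, K2, auxWin_mulVec, auxWin_mulVec, det_auxWin, zpow_neg]
  simp only [Pi.sub_apply]
  norm_cast
  ring

theorem abs_sub_le_of_auxWin (hK : KernelHyp K Q) {h : ℝ} (hh : 0 < h) {v x : Fin 2 → ℝ}
    (hne : K2 K ((auxWin h).mulVec (x - v)) ≠ 0) (i : Fin 2) : |x i - v i| ≤ h / 2 := by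
  obtain ⟨h0, h1⟩ := hK.abs_le_of_K2_ne_zero hne
  have : |(auxWin h).mulVec (x - v) i| ≤ 1 / 2 := by
    fin_cases i
    · exact h0
    · exact h1
  rw [auxWin_mulVec, abs_div, abs_of_pos hh, div_le_iff₀ hh] at this
  simp only [Pi.sub_apply] at this
  linarith

/-- A finite net for the centres of the auxiliary estimator. -/
theorem exists_aux_net (hK : KernelHyp K Q) (hgl : 0 < gl) (hg : DesignOK g gl)
    {n : ℝ} {h : ℝ} (hh : h ∈ Set.Ioc (0 : ℝ) 1)
    (hhn : (h ^ 2)⁻¹ ≤ n) {N : ℕ} (hN : 0 < N) :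
    ∃ s : Finset (Fin 2 → ℝ), ↑s ⊆ Set.Icc (fun _ : Fin 2 => -(5/2 : ℝ)) (fun _ => (5/2 : ℝ)) ∧
      s.card ≤ (N + 1) * (N + 1) ∧
      ∀ v ∈ Set.Icc (fun _ : Fin 2 => -(5/2 : ℝ)) (fun _ => (5/2 : ℝ)), ∃ v' ∈ s, ∀ x,
        |wt K g (auxWin h) v x - wt K g (auxWin h) v' x| ≤ 10 * n ^ 2 * Ksup K * Q / (gl * N) := by
  have hN' : (0 : ℝ) < N := by exact_mod_cast hN
  have hκ := hK.one_le_Ksup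
  have hQ := hK.half_le_Q
  have hh0 := hh.1
  classical
  set pt : ℕ × ℕ → (Fin 2 → ℝ) := fun j => ![-(5/2) + 5 * j.1 / N, -(5/2) + 5 * j.2 / N] with hpt
  have hmem : ∀ j ∈ Finset.range (N + 1) ×ˢ Finset.range (N + 1),
      pt j ∈ Set.Icc (fun _ : Fin 2 => -(5/2 : ℝ)) (fun _ => (5/2 : ℝ)) := by
    have key : ∀ j ∈ Finset.range (N + 1), (5 * j / N : ℝ) ∈ Set.Icc 0 5 := by
      intro j hj
      refine ⟨by positivity, ?_⟩
      rw [div_le_iff₀ hN']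
      have : (j : ℝ) ≤ N := by exact_mod_cast Nat.lt_succ_iff.1 (Finset.mem_range.1 hj)
      linarith
    rintro ⟨j, l⟩ hjl
    rw [Finset.mem_product] at hjl
    have h1 := key j hjl.1
    have h2 := key l hjl.2
    constructor <;> intro i <;> fin_cases i <;> simp only [hpt] <;>
      simp <;> linarith [h1.1, h1.2, h2.1, h2.2]
  refine ⟨(Finset.range (N + 1) ×ˢ Finset.range (N + 1)).image pt, ?_, ?_, ?_⟩
  · intro a ha
    rw [Finset.coe_image] at ha
    obtain ⟨j, hj, rfl⟩ := ha
    exact hmem j hj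
  · refine Finset.card_image_le.trans ?_
    rw [Finset.card_product, Finset.card_range]
  · intro v hv
    have h5 : (-(5/2) : ℝ) + 5 = 5 / 2 := by norm_num
    obtain ⟨j, hj, hjv⟩ := exists_floor_net (by norm_num : (0 : ℝ) < 5) hN (a := -(5/2)) (x := v 0)
      (by rw [h5]; exact ⟨hv.1 0, hv.2 0⟩)
    obtain ⟨l, hl, hlv⟩ := exists_floor_net (by norm_num : (0 : ℝ) < 5) hN (a := -(5/2)) (x := v 1)
      (by rw [h5]; exact ⟨hv.1 1, hv.2 1⟩)
    have hjl := Finset.mk_mem_product hj hl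
    refine ⟨pt (j, l), Finset.mem_image_of_mem _ hjl, fun x => ?_⟩
    have hd : ∀ i, |v i - pt (j, l) i| ≤ 5 / N := by
      intro i
      fin_cases i
      · exact hjv
      · exact hlv
    have hv' := hmem _ hjl
    generalize pt (j, l) = v' at hd hv'
    by_cases hx : ∀ i, |x i| ≤ 3
    · have hgx : gl ≤ g x := hg.2.2 x ⟨fun i => (abs_le.1 (hx i)).1, fun i => (abs_le.1 (hx i)).2⟩
      have hη : ∀ i, |(auxWin h).mulVec (x - v) i - (auxWin h).mulVec (x - v') i|
          ≤ h⁻¹ * (5 / N) := by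
        intro i
        rw [auxWin_mulVec, auxWin_mulVec]
        simp only [Pi.sub_apply]
        rw [show (x i - v i) / h - (x i - v' i) / h = -(h⁻¹ * (v i - v' i)) by ring, abs_neg,
          abs_mul, abs_of_pos (inv_pos.2 hh0)]
        exact mul_le_mul_of_nonneg_left (hd i) (inv_nonneg.2 hh0.le)
      have hpos : 0 ≤ (auxWin h).det := by rw [det_auxWin]; positivity
      refine (abs_wt_sub_le (ζ := 0) hK hgl hpos ((det_auxWin h).trans_le hhn) (by simp) hη
        hgx).trans ?_
      have hn0 : 0 ≤ n := le_trans (by positivity) hhn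
      have hhn' : h⁻¹ ≤ n := by
        refine le_trans ?_ hhn
        rw [sq]
        gcongr
        exact mul_le_of_le_one_left hh0.le hh.2
      rw [mul_comm gl, ← div_div]
      gcongr
      rw [zero_mul, zero_add]
      calc n * (2 * Ksup K * Q * (h⁻¹ * (5 / N))) ≤ n * (2 * Ksup K * Q * (n * (5 / N))) := by
            gcongr
        _ = _ := by ring
    · have hz : ∀ v ∈ Set.Icc (fun _ : Fin 2 => -(5/2 : ℝ)) (fun _ => (5/2 : ℝ)),
          wt K g (auxWin h) v x = 0 := by
        intro v hv
        have : K2 K ((auxWin h).mulVec (x - v)) = 0 := by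
          by_contra hne
          refine hx fun i => ?_
          have h1 := abs_le.1 (abs_sub_le_of_auxWin hK hh0 hne i)
          have h2 := hv.1 i
          have h3 := hv.2 i
          simp only at h2 h3
          rw [abs_le]
          constructor <;> linarith [hh.2]
        rw [wt, this]
        simp
      have hn0 : 0 ≤ n := le_trans (by positivity) hhn
      rw [hz v hv, hz v' hv', sub_zero, abs_zero]
      positivity

end AuxNet

section Deviations

variable {K : ℝ → ℝ} {g : (Fin 2 → ℝ) → ℝ} {Q gl Υ Ωc ω : ℝ} {p : ℝ → ℝ} {F : (Fin 2 → ℝ) → ℝ}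

theorem ceil_sq_add_one_mul_le {A : ℝ} (hA : 1 ≤ A) :
    (((⌈A ^ 2⌉₊ + 1) * (⌈A ^ 2⌉₊ + 1) : ℕ) : ℝ) ≤ 9 * A ^ 4 := by
  have h1 : (⌈A ^ 2⌉₊ : ℝ) < A ^ 2 + 1 := Nat.ceil_lt_add_one (by positivity)
  have h2 : 1 ≤ A ^ 2 := one_le_pow₀ hA
  have h3 : ((⌈A ^ 2⌉₊ : ℝ) + 1) ≤ 3 * A ^ 2 := by linarith
  push_cast
  calc ((⌈A ^ 2⌉₊ : ℝ) + 1) * ((⌈A ^ 2⌉₊ : ℝ) + 1) ≤ (3 * A ^ 2) * (3 * A ^ 2) := by gcongr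
    _ = _ := by ring

theorem inv_le_rpow_neg_half {x n : ℝ} (hn : 1 ≤ n) (hx : 0 < x) (hxn : x ≤ n) :
    1 / n ≤ x ^ (-(1/2) : ℝ) := by
  calc 1 / n = n ^ (-1 : ℝ) := by rw [rpow_neg_one, one_div]
    _ ≤ n ^ (-(1/2) : ℝ) := rpow_le_rpow_of_exponent_le hn (by norm_num)
    _ ≤ _ := rpow_le_rpow_of_nonpos hx hxn (by norm_num)

/-- Uniform deviation of the kernel sums over all windows of all grid bandwidths. -/
theorem measure_win_dev_le (hK : KernelHyp K Q) (hgl : gl ∈ Set.Ioo (0 : ℝ) 1)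
    (hg : DesignOK g gl) (hp : p ∈ NoiseClass Υ Ωc ω) (hω : 0 < ω)
    (hF : Measurable F) {n : ℕ} (hn3 : 3 ≤ n)
    (hmn : (n : ℝ)⁻¹ ≤ hmin ω n) {t : Fin 2 → ℝ} (ht : ∀ i, |t i| ≤ 1 / 2)
    {ψ₁ : (Fin 2 → ℝ) → ℝ} {ψ₂ : ℝ → ℝ} (hψ₁ : Measurable ψ₁) (hψ₂ : Measurable ψ₂) {b s c r : ℝ}
    (hb : 1 ≤ b) (hs : 1 ≤ s) (hr : 0 ≤ r)
    (hψ1 : ∀ x : Fin 2 → ℝ, (∀ i, |x i| ≤ 5 / 2) → |ψ₁ x| ≤ 1)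
    (hψb : ∀ e, |ψ₂ e| ≤ b) (hψv : ∫ e, p e * ψ₂ e ^ 2 ≤ s ^ 2)
    (hc : c = 730 * log (16 * (n : ℝ) ^ 2 * b * gl ^ (-(1/2) : ℝ) * (12 * Q + √2))
      + 8 * r * log n + 394) :
    dataLaw n g p F {d | ∃ h ∈ Hgrid ω n, ∃ e ∈ S1, ∃ ρ ∈ Set.Icc (1 : ℝ) 2,
        (2 * √2 * s * gl ^ (-(1/2) : ℝ) * Ksup K ^ 2 * √c
          + 8 / 3 * c * b * log n ^ (-((2 + ω) / (2 * ω))) * gl⁻¹ * Ksup K ^ 2)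
            * (h * n) ^ (-(1/2) : ℝ)
        < |(n : ℝ)⁻¹ * ∑ i, wt K g (win e ρ h) t (d i).1 * ψ₁ (d i).1 * ψ₂ ((d i).2 - F (d i).1)
          - (∫ x, g x * (wt K g (win e ρ h) t x * ψ₁ x)) * ∫ e, p e * ψ₂ e|}
      ≤ ENNReal.ofReal ((n : ℝ) ^ (-(4 * r))) := by
  classical
  have hn' : (3 : ℝ) ≤ n := by exact_mod_cast hn3
  have hn0 : (0 : ℝ) < n := by linarith
  have hκ := hK.one_le_Ksup
  have hQ := hK.half_le_Q
  have hs21 : 1 ≤ √2 := one_le_sqrt.2 (by norm_num)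
  have hL : 0 ≤ log n := log_nonneg (by linarith)
  set γ := gl ^ (-(1/2) : ℝ) with hγ
  have hγ1 : 1 ≤ γ := one_le_rpow_of_pos_of_le_one_of_nonpos hgl.1 hgl.2.le (by norm_num)
  have hγ2 : γ ^ 2 = gl⁻¹ := rpow_neg_half_sq hgl.1
  set A := 16 * (n : ℝ) ^ 2 * b * γ * (12 * Q + √2) with hA
  have hA1 : 36 * n ≤ A := by
    calc 36 * (n : ℝ) ≤ 16 * ((n : ℝ) * 3) * 1 * 1 * (12 * (1 / 2) + 1) := by nlinarith
      _ ≤ 16 * ((n : ℝ) * n) * b * γ * (12 * Q + √2) := by gcongr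
      _ = A := by rw [hA]; ring
  have hA2 : 1 ≤ A := by linarith
  have hA0 : 0 < A := by linarith
  have hAsq : 2 * 264 * n ^ 2 * Q * b * (n : ℝ) ≤ gl * A ^ 2 := by
    have e : gl * A ^ 2 = 256 * (n : ℝ) ^ 4 * b ^ 2 * (12 * Q + √2) ^ 2 := by
      rw [hA]
      simp only [mul_pow, hγ2]
      have := hgl.1.ne'
      field_simp
      ring
    rw [e]
    calc 2 * 264 * n ^ 2 * Q * b * (n : ℝ)
        = 256 * ((n : ℝ) ^ 3 * 1) * (b * 1) * (12 * Q * (11 / 64)) := by ring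
      _ ≤ 256 * ((n : ℝ) ^ 3 * n) * (b * b) * ((12 * Q + √2) * (12 * Q + √2)) := by
          gcongr <;> linarith
      _ = _ := by ring
  set N := ⌈A ^ 2⌉₊ with hNdef
  have hN : 0 < N := Nat.ceil_pos.2 (by positivity)
  have hNA : A ^ 2 ≤ N := Nat.le_ceil _
  have hN0 : (0 : ℝ) < N := by exact_mod_cast hN
  have hc1 : 1 ≤ c := by
    have := log_nonneg hA2
    rw [hc]
    nlinarith [mul_nonneg hr hL]
  have hc0 : 0 < c := by linarith
  set Bad : ℝ → Set (Fin n → (Fin 2 → ℝ) × ℝ) := fun h => {d | ∃ a ∈ S1 ×ˢ Set.Icc (1 : ℝ) 2,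
    (2 * √2 * s * γ * Ksup K ^ 2 * √c
          + 8 / 3 * c * b * log n ^ (-((2 + ω) / (2 * ω))) * gl⁻¹ * Ksup K ^ 2)
            * (h * n) ^ (-(1/2) : ℝ)
        < |(n : ℝ)⁻¹ * ∑ i, wt K g (win a.1 a.2 h) t (d i).1 * ψ₁ (d i).1
            * ψ₂ ((d i).2 - F (d i).1)
          - (∫ x, g x * (wt K g (win a.1 a.2 h) t x * ψ₁ x)) * ∫ e, p e * ψ₂ e|} with hBad
  have hone : ∀ h ∈ Hgrid ω n, dataLaw n g p F (Bad h)
      ≤ ENNReal.ofReal (18 * A ^ 4 * exp (-(c / 2))) := by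
    rintro h ⟨_, hhm, hh1⟩
    have hhn : (n : ℝ)⁻¹ / 2 ≤ h := by linarith
    have hh0 : 0 < h := (by positivity : 0 < (n : ℝ)⁻¹ / 2).trans_le hhn
    have hhn2 : h⁻¹ ≤ 2 * n := by
      rw [inv_le_comm₀ hh0 (by positivity), mul_inv]
      linarith
    obtain ⟨S, hS, hScard, hnet⟩ := exists_win_net hK hgl.1 hg ht (n := n) (by linarith)
      ⟨hh0, hh1⟩ hhn2 hN
    have hu : (0 : ℝ) < (h * n) ^ (-(1/2) : ℝ) := by positivity
    have hun : 1 / (n : ℝ) ≤ (h * n) ^ (-(1/2) : ℝ) :=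
      inv_le_rpow_neg_half (by linarith) (by positivity) (mul_le_of_le_one_left hn0.le hh1)
    have hD : h⁻¹ / n = ((h * n) ^ (-(1/2) : ℝ)) ^ 2 := by
      rw [rpow_neg_half_sq (by positivity), mul_inv]
      rfl
    have hw : (h * n) ^ (-(1/2) : ℝ) ≤ √2 * log n ^ (-((2 + ω) / (2 * ω))) := by
      have hLp : 0 < log n := log_pos (by linarith)
      have h1 : log n ^ ((1 : ℝ) + 2 / ω) / 2 ≤ h * n := by
        rw [← nat_mul_hmin ω (by omega)]
        nlinarith
      refine (rpow_le_rpow_of_nonpos (by positivity) h1 (by norm_num)).trans_eq ?_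
      rw [div_rpow (by positivity) (by norm_num), ← rpow_mul hLp.le, rpow_neg (by norm_num),
        ← sqrt_eq_rpow, div_inv_eq_mul, mul_comm]
      congr 2
      field_simp
      ring
    have hε : 2 * (264 * n ^ 2 * Ksup K * Q / (gl * N) * b)
        ≤ Ksup K * (h * n) ^ (-(1/2) : ℝ) := by
      refine le_trans ?_ (mul_le_mul_of_nonneg_left hun (by linarith))
      have hg0 := hgl.1
      rw [mul_one_div, le_div_iff₀ hn0]
      have h1 : gl * A ^ 2 ≤ gl * N := by gcongr
      calc 2 * (264 * n ^ 2 * Ksup K * Q / (gl * N) * b) * n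
          = Ksup K * ((2 * 264 * n ^ 2 * Q * b * n) / (gl * N)) := by ring
        _ ≤ Ksup K * 1 := by
            gcongr
            rw [div_le_one (by positivity)]
            exact hAsq.trans h1
        _ = _ := mul_one _
    have key := bernstein_threshold_le hκ hgl.1 hgl.2.le (zero_lt_one.trans_le hb) hs hc1 hn0 hu
      hD hw hε
    have := measure_windows_le hK hgl.1 hg hp hF hS (fun a => win a.1 a.2 h) (fun _ => t) hψ₁ hψ₂
      (D := h⁻¹) (b := b) (v := s ^ 2) (x := c / 2) (inv_pos.2 hh0) (by linarith)
      (by positivity) (by linarith)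
      (fun a ha => ⟨det_win_pos ha.1 ha.2.1 hh0, det_win_le ha.1 ha.2.1 hh0⟩) ?_ hψb hψv hnet
      (by omega : 0 < n)
    · refine (measure_mono ?_).trans (this.trans (ENNReal.ofReal_le_ofReal ?_))
      · rintro d ⟨a, ha, hd⟩
        exact ⟨a, ha, key.trans_lt hd⟩
      · have h2 : (S.card : ℝ) ≤ 9 * A ^ 4 :=
          le_trans (by exact_mod_cast hScard) (ceil_sq_add_one_mul_le hA2)
        calc 2 * (S.card : ℝ) * exp (-(c / 2)) ≤ 2 * (9 * A ^ 4) * exp (-(c / 2)) := by gcongr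
          _ = _ := by ring
    · intro a ha x hne
      obtain ⟨h0, h1⟩ := hK.abs_le_of_K2_ne_zero hne
      have hx := abs_sub_le_of_win ha.1 ha.2 ⟨hh0, hh1⟩ h0 h1
      have hx' : ∀ i, |x i| ≤ 5 / 2 := fun i => by
        have := abs_sub_abs_le_abs_sub (x i) (t i)
        linarith [hx i, ht i]
      refine ⟨hg.2.2 x ⟨fun i => ?_, fun i => ?_⟩, hψ1 x hx'⟩ <;>
      · have := abs_le.1 (hx' i)
        simp only
        linarith
  have hsub : {d | ∃ h ∈ Hgrid ω n, ∃ e ∈ S1, ∃ ρ ∈ Set.Icc (1 : ℝ) 2,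
        (2 * √2 * s * γ * Ksup K ^ 2 * √c
          + 8 / 3 * c * b * log n ^ (-((2 + ω) / (2 * ω))) * gl⁻¹ * Ksup K ^ 2)
            * (h * n) ^ (-(1/2) : ℝ)
        < |(n : ℝ)⁻¹ * ∑ i, wt K g (win e ρ h) t (d i).1 * ψ₁ (d i).1 * ψ₂ ((d i).2 - F (d i).1)
          - (∫ x, g x * (wt K g (win e ρ h) t x * ψ₁ x)) * ∫ e, p e * ψ₂ e|}
      ⊆ ⋃ k ∈ (Finset.range (2 * n)).filter fun k : ℕ => (2 : ℝ) ^ (-(k : ℤ)) ∈ Hgrid ω n,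
          Bad ((2 : ℝ) ^ (-(k : ℤ))) := by
    rintro d ⟨h, hh, e, he, ρ, hρ, hd⟩
    obtain ⟨⟨k, rfl⟩, hhm, hh1⟩ := hh
    simp only [Set.mem_iUnion]
    refine ⟨k, ?_, ⟨(e, ρ), ⟨he, hρ⟩, hd⟩⟩
    rw [Finset.mem_filter, Finset.mem_range]
    refine ⟨?_, ⟨k, rfl⟩, hhm, hh1⟩
    have h1 : (n : ℝ)⁻¹ / 2 ≤ ((2 : ℝ) ^ k)⁻¹ := by
      rw [← zpow_natCast, ← zpow_neg]
      linarith
    have h2 : (2 : ℝ) ^ k ≤ 2 * n := by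
      rw [le_inv_comm₀ (by positivity) (by positivity)] at h1
      refine h1.trans_eq ?_
      field_simp
    have h3 : 2 ^ k ≤ 2 * n := by exact_mod_cast h2
    exact Nat.lt_two_pow_self.trans_le h3
  refine (measure_mono hsub).trans ((measure_biUnion_finset_le _ _).trans ?_)
  refine (Finset.sum_le_sum fun k hk => hone _ (Finset.mem_filter.1 hk).2).trans ?_
  rw [Finset.sum_const, nsmul_eq_mul]
  have hcard : ((((Finset.range (2 * n)).filter fun k : ℕ =>
      (2 : ℝ) ^ (-(k : ℤ)) ∈ Hgrid ω n).card : ℕ) : ENNReal) ≤ ENNReal.ofReal (2 * n) := by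
    rw [← ENNReal.ofReal_natCast]
    refine ENNReal.ofReal_le_ofReal ?_
    have := (Finset.card_filter_le (Finset.range (2 * n))
      fun k : ℕ => (2 : ℝ) ^ (-(k : ℤ)) ∈ Hgrid ω n)
    rw [Finset.card_range] at this
    exact_mod_cast this
  refine (mul_le_mul_left hcard _).trans ?_
  rw [← ENNReal.ofReal_mul (by positivity)]
  refine ENNReal.ofReal_le_ofReal ?_
  rw [← mul_assoc]
  refine card_mul_exp_le (a := 5) (r := r) hA2 hn0 ?_ ?_ rfl
  · calc 2 * n * (18 * A ^ 4) = 36 * n * A ^ 4 := by ring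
      _ ≤ A * A ^ 4 := by gcongr
      _ = A ^ (5 : ℝ) := by rw [← pow_succ', show (5 : ℝ) = ((4 + 1 : ℕ) : ℝ) by norm_num, rpow_natCast]
  · have := log_nonneg hA2
    rw [hc]
    linarith

end Deviations

section AuxDeviations

variable {K : ℝ → ℝ} {g : (Fin 2 → ℝ) → ℝ} {Q gl Υ Ωc ω : ℝ} {p : ℝ → ℝ} {F : (Fin 2 → ℝ) → ℝ}

/-- Uniform deviation of the kernel sums over all centres of the auxiliary estimator. -/
theorem measure_aux_dev_le (hK : KernelHyp K Q) (hgl : gl ∈ Set.Ioo (0 : ℝ) 1)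
    (hg : DesignOK g gl) (hp : p ∈ NoiseClass Υ Ωc ω)
    (hF : Measurable F) {n : ℕ} (hn3 : 3 ≤ n) {h : ℝ} (hh : h ∈ Set.Ioc (0 : ℝ) 1)
    (hhn : 1 ≤ n * h ^ 2)
    {ψ₁ : (Fin 2 → ℝ) → ℝ} {ψ₂ : ℝ → ℝ} (hψ₁ : Measurable ψ₁) (hψ₂ : Measurable ψ₂) {b s c r : ℝ}
    (hb : 1 ≤ b) (hs : 1 ≤ s) (hr : 0 ≤ r)
    (hψ1 : ∀ v ∈ Set.Icc (fun _ : Fin 2 => -(5/2 : ℝ)) (fun _ => (5/2 : ℝ)),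
      ∀ x : Fin 2 → ℝ, (∀ i, |x i - v i| ≤ h / 2) → |ψ₁ x| ≤ 1)
    (hψb : ∀ e, |ψ₂ e| ≤ b) (hψv : ∫ e, p e * ψ₂ e ^ 2 ≤ s ^ 2)
    (hc : c = 365 * log (5 * (n : ℝ) ^ 2 * b * Q * gl ^ (-(1/2) : ℝ)) + 8 * r * log n + 197) :
    dataLaw n g p F {d | ∃ v ∈ Set.Icc (fun _ : Fin 2 => -(5/2 : ℝ)) (fun _ => (5/2 : ℝ)),
        (2 * √2 * s * gl ^ (-(1/2) : ℝ) * Ksup K ^ 2 * √c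
          + 8 / 3 * c * b * (n * h ^ 2) ^ (-(1/2) : ℝ) * gl⁻¹ * Ksup K ^ 2)
            * (n * h ^ 2) ^ (-(1/2) : ℝ)
        < |(n : ℝ)⁻¹ * ∑ i, wt K g (auxWin h) v (d i).1 * ψ₁ (d i).1 * ψ₂ ((d i).2 - F (d i).1)
          - (∫ x, g x * (wt K g (auxWin h) v x * ψ₁ x)) * ∫ e, p e * ψ₂ e|}
      ≤ ENNReal.ofReal ((n : ℝ) ^ (-(4 * r))) := by
  have hn' : (3 : ℝ) ≤ n := by exact_mod_cast hn3
  have hn0 : (0 : ℝ) < n := by linarith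
  have hκ := hK.one_le_Ksup
  have hQ := hK.half_le_Q
  have hh0 := hh.1
  have hs21 : 1 ≤ √2 := one_le_sqrt.2 (by norm_num)
  have hL : 0 ≤ log n := log_nonneg (by linarith)
  set γ := gl ^ (-(1/2) : ℝ) with hγ
  have hγ1 : 1 ≤ γ := one_le_rpow_of_pos_of_le_one_of_nonpos hgl.1 hgl.2.le (by norm_num)
  have hγ2 : γ ^ 2 = gl⁻¹ := rpow_neg_half_sq hgl.1
  set A := 5 * (n : ℝ) ^ 2 * b * Q * γ with hA
  have hA18 : 18 ≤ A := by
    calc (18 : ℝ) ≤ 5 * 3 ^ 2 * 1 * (1 / 2) * 1 := by norm_num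
      _ ≤ A := by rw [hA]; gcongr
  have hA2 : 1 ≤ A := by linarith
  have hA0 : 0 < A := by linarith
  have hAsq : 2 * 10 * n ^ 2 * Q * b * (n : ℝ) ≤ gl * A ^ 2 := by
    have e : gl * A ^ 2 = 25 * (n : ℝ) ^ 4 * b ^ 2 * Q ^ 2 := by
      rw [hA]
      simp only [mul_pow, hγ2]
      have := hgl.1.ne'
      field_simp
      ring
    rw [e]
    calc 2 * 10 * n ^ 2 * Q * b * (n : ℝ)
        = 25 * ((n : ℝ) ^ 3 * (8 / 5)) * (b * 1) * (Q * (1 / 2)) := by ring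
      _ ≤ 25 * ((n : ℝ) ^ 3 * n) * (b * b) * (Q * Q) := by
          gcongr
          linarith
      _ = _ := by ring
  set N := ⌈A ^ 2⌉₊ with hNdef
  have hN : 0 < N := Nat.ceil_pos.2 (by positivity)
  have hNA : A ^ 2 ≤ N := Nat.le_ceil _
  have hN0 : (0 : ℝ) < N := by exact_mod_cast hN
  have hc1 : 1 ≤ c := by
    have := log_nonneg hA2
    rw [hc]
    nlinarith [mul_nonneg hr hL]
  have hhn' : (h ^ 2)⁻¹ ≤ n := by
    rw [inv_le_comm₀ (by positivity) hn0, inv_le_iff_one_le_mul₀ hn0]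
    linarith
  obtain ⟨S, hS, hScard, hnet⟩ := exists_aux_net hK hgl.1 hg (n := n) hh hhn' hN
  have hu : (0 : ℝ) < (n * h ^ 2) ^ (-(1/2) : ℝ) := by positivity
  have hun : 1 / (n : ℝ) ≤ (n * h ^ 2) ^ (-(1/2) : ℝ) :=
    inv_le_rpow_neg_half (by linarith) (by positivity)
      (mul_le_of_le_one_right hn0.le (pow_le_one₀ hh0.le hh.2))
  have hD : (h ^ 2)⁻¹ / n = ((n * h ^ 2) ^ (-(1/2) : ℝ)) ^ 2 := by
    rw [rpow_neg_half_sq (by positivity), mul_inv]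
    ring
  have hw : (n * h ^ 2) ^ (-(1/2) : ℝ) ≤ √2 * (n * h ^ 2) ^ (-(1/2) : ℝ) :=
    le_mul_of_one_le_left hu.le hs21
  have hε : 2 * (10 * n ^ 2 * Ksup K * Q / (gl * N) * b)
      ≤ Ksup K * (n * h ^ 2) ^ (-(1/2) : ℝ) := by
    refine le_trans ?_ (mul_le_mul_of_nonneg_left hun (by linarith))
    have hg0 := hgl.1
    rw [mul_one_div, le_div_iff₀ hn0]
    have h1 : gl * A ^ 2 ≤ gl * N := by gcongr
    calc 2 * (10 * n ^ 2 * Ksup K * Q / (gl * N) * b) * n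
        = Ksup K * ((2 * 10 * n ^ 2 * Q * b * n) / (gl * N)) := by ring
      _ ≤ Ksup K * 1 := by
          gcongr
          rw [div_le_one (by positivity)]
          exact hAsq.trans h1
      _ = _ := mul_one _
  have key := bernstein_threshold_le hκ hgl.1 hgl.2.le (zero_lt_one.trans_le hb) hs hc1 hn0 hu
    hD hw hε
  have hdet : 0 < (auxWin h).det := by rw [det_auxWin]; positivity
  have := measure_windows_le hK hgl.1 hg hp hF hS (fun _ => auxWin h) (fun v => v) hψ₁ hψ₂
    (D := (h ^ 2)⁻¹) (b := b) (v := s ^ 2) (x := c / 2) (by positivity) (by linarith)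
    (by positivity) (by linarith) (fun a _ => ⟨hdet, (det_auxWin h).le⟩) ?_ hψb hψv hnet
    (by omega : 0 < n)
  · refine (measure_mono ?_).trans (this.trans (ENNReal.ofReal_le_ofReal ?_))
    · rintro d ⟨a, ha, hd⟩
      exact ⟨a, ha, key.trans_lt hd⟩
    · have h2 : (S.card : ℝ) ≤ 9 * A ^ 4 :=
        le_trans (by exact_mod_cast hScard) (ceil_sq_add_one_mul_le hA2)
      refine card_mul_exp_le (a := 5) (r := r) hA2 hn0 ?_ ?_ rfl
      · calc 2 * (S.card : ℝ) ≤ 2 * (9 * A ^ 4) := by gcongr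
          _ = 18 * A ^ 4 := by ring
          _ ≤ A * A ^ 4 := by gcongr
          _ = A ^ (5 : ℝ) := by
            rw [← pow_succ', show (5 : ℝ) = ((4 + 1 : ℕ) : ℝ) by norm_num, rpow_natCast]
      · have := log_nonneg hA2
        rw [hc]
        linarith
  · intro a ha x hne
    have hx := abs_sub_le_of_auxWin hK hh0 hne
    refine ⟨hg.2.2 x ⟨fun i => ?_, fun i => ?_⟩, hψ1 a ha x hx⟩ <;>
    · have h1 := abs_le.1 (hx i)
      have h2 := ha.1 i
      have h3 := ha.2 i
      simp only at h2 h3 ⊢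
      linarith [hh.2]

/-- With high probability no noise variable exceeds the truncation level. -/
theorem measure_noise_large_le (hg : DesignOK g gl) (hp : p ∈ NoiseClass Υ Ωc ω)
    (hF : Measurable F) (n : ℕ) {τ : ℝ} (hτ : 0 ≤ τ) :
    dataLaw n g p F {d | ∃ i, τ ≤ |(d i).2 - F (d i).1|}
      ≤ ENNReal.ofReal (n * (2 * Υ * exp (-Ωc * τ ^ ω))) := by
  have : IsProbabilityMeasure (jointLaw g p F) := isProbabilityMeasure_jointLaw hg hp hF
  have hset : MeasurableSet {z : (Fin 2 → ℝ) × ℝ | τ ≤ |z.2 - F z.1|} :=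
    measurableSet_le measurable_const (measurable_snd.sub (hF.comp measurable_fst)).abs
  have hone : jointLaw g p F {z | τ ≤ |z.2 - F z.1|}
      ≤ ENNReal.ofReal (2 * Υ * exp (-Ωc * τ ^ ω)) := by
    refine le_trans (le_of_eq ?_) (noiseM_tail_le hp hτ)
    have hs : MeasurableSet {e : ℝ | τ ≤ |e|} := measurableSet_le measurable_const measurable_id.abs
    have h := lintegral_jointLaw_snd hg hp hF (c := Set.indicator {e : ℝ | τ ≤ |e|} 1)
      (measurable_one.indicator hs)
    rw [lintegral_indicator_one hs] at h
    rw [← h, ← lintegral_indicator_one hset]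
    rfl
  have hsub : {d : Fin n → (Fin 2 → ℝ) × ℝ | ∃ i, τ ≤ |(d i).2 - F (d i).1|}
      ⊆ ⋃ i ∈ (Finset.univ : Finset (Fin n)),
        Function.eval i ⁻¹' {z : (Fin 2 → ℝ) × ℝ | τ ≤ |z.2 - F z.1|} := by
    rintro d ⟨i, hi⟩
    simp only [Set.mem_iUnion]
    exact ⟨i, Finset.mem_univ _, hi⟩
  refine (measure_mono hsub).trans ((measure_biUnion_finset_le _ _).trans ?_)
  refine (Finset.sum_le_sum fun i _ => ((measurePreserving_eval
    (fun _ : Fin n => jointLaw g p F) i).measure_preimage hset.nullMeasurableSet).trans_le hone).trans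
    ?_
  rw [Finset.sum_const, nsmul_eq_mul, Finset.card_univ, Fintype.card_fin,
    ENNReal.ofReal_mul (p := (n : ℝ)) n.cast_nonneg, ENNReal.ofReal_natCast]

end AuxDeviations

section GoodEvent

variable {P : Pars}

theorem one_le_tauf (hΩ : P.Ωc ∈ Set.Ioc (0 : ℝ) 1) (hω : 0 < P.ω) (hr : 1 ≤ P.r) {n : ℕ}
    (hL : 1 ≤ log n) : 1 ≤ tauf P n := by
  apply one_le_rpow _ (by positivity)
  have h1 : 1 ≤ P.Ωc⁻¹ := (one_le_inv₀ hΩ.1).2 hΩ.2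
  calc (1 : ℝ) = 1 * 1 * 1 := by norm_num
    _ ≤ _ := by gcongr; linarith

theorem tauf_mul_log_rpow (hΩ : P.Ωc ∈ Set.Ioc (0 : ℝ) 1) (hω : 0 < P.ω) (hr : 1 ≤ P.r) {n : ℕ}
    (hL : 1 ≤ log n) : tauf P n * log n ^ (-((2 + P.ω) / (2 * P.ω)))
      = (P.Ωc⁻¹ * (4 * P.r + 1)) ^ ((1 : ℝ) / P.ω) * log n ^ (-(1/2) : ℝ) := by
  have hL0 : 0 < log n := by linarith
  have h1 : 0 ≤ P.Ωc⁻¹ * (4 * P.r + 1) := mul_nonneg (inv_nonneg.2 hΩ.1.le) (by linarith)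
  rw [tauf, mul_rpow h1 hL0.le, mul_assoc, ← rpow_add hL0]
  congr 2
  field_simp
  ring

theorem mul_exp_tauf (hΩ : P.Ωc ∈ Set.Ioc (0 : ℝ) 1) (hω : 0 < P.ω) (hr : 1 ≤ P.r) {n : ℕ}
    (hn : 1 ≤ n) : n * (2 * P.Υ * exp (-P.Ωc * tauf P n ^ P.ω))
      = 2 * P.Υ * (n : ℝ) ^ (-(4 * P.r)) := by
  have hn' : (1 : ℝ) ≤ n := by exact_mod_cast hn
  have hL : 0 ≤ log n := log_nonneg hn'
  have h1 : 0 ≤ P.Ωc⁻¹ * (4 * P.r + 1) * log n :=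
    mul_nonneg (mul_nonneg (inv_nonneg.2 hΩ.1.le) (by linarith)) hL
  have h2 : -P.Ωc * tauf P n ^ P.ω = log n * (-1 + -(4 * P.r)) := by
    rw [tauf, ← rpow_mul h1, one_div_mul_cancel hω.ne', rpow_one]
    have := hΩ.1.ne'
    field_simp
    ring
  have hn0 : (0 : ℝ) < n := by linarith
  rw [h2, ← rpow_def_of_pos hn0, rpow_add hn0, rpow_neg_one]
  field_simp

variable {K : ℝ → ℝ} {g : (Fin 2 → ℝ) → ℝ} {Q gl Υ Ωc ω : ℝ} {p : ℝ → ℝ} {F : (Fin 2 → ℝ) → ℝ}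

/-- Bias and noise decomposition of a kernel estimator on the event of small deviations. -/
theorem abs_estM_sub_le (hK : KernelHyp K Q) (hgl : 0 < gl) (hp : p ∈ NoiseClass Υ Ωc ω)
    (hF : Continuous F) {n : ℕ} {M N : Matrix (Fin 2) (Fin 2) ℝ} {t : Fin 2 → ℝ} (hM : 0 < M.det)
    (hN : N * M = 1) {B : ℝ}
    (hR : ∀ x, K2 K (M.mulVec (x - t)) ≠ 0 → gl ≤ g x ∧ |F x| ≤ B)
    {d : Fin n → (Fin 2 → ℝ) × ℝ} {τ : ℝ} (hτ : ∀ i, |(d i).2 - F (d i).1| ≤ τ) {D₁ D₂ : ℝ}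
    (hB : 0 ≤ B)
    (h₁ : |(n : ℝ)⁻¹ * ∑ i, wt K g M t (d i).1 * (F (d i).1 / B) * 1
          - (∫ x, g x * (wt K g M t x * (F x / B))) * ∫ e, p e * 1| ≤ D₁)
    (h₂ : |(n : ℝ)⁻¹ * ∑ i, wt K g M t (d i).1 * 1 * trunc τ ((d i).2 - F (d i).1)
          - (∫ x, g x * (wt K g M t x * 1)) * ∫ e, p e * trunc τ e| ≤ D₂) :
    |estM K g n M t d - ∫ w, K2 K w * F (t + N.mulVec w)| ≤ B * D₁ + D₂ := by
  have key : ∀ x, wt K g M t x * F x = B * (wt K g M t x * (F x / B)) := by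
    intro x
    by_cases h : K2 K (M.mulVec (x - t)) = 0
    · rw [wt, h]
      simp
    · have h2 := (hR x h).2
      rcases hB.eq_or_lt with h0 | h0
      · have : F x = 0 := abs_nonpos_iff.1 (h2.trans_eq h0.symm)
        simp [this]
      · field_simp
  rw [integral_mul_trunc hp, mul_zero, sub_zero] at h₂
  simp only [mul_one, hp.2.1] at h₁ h₂
  have e1 : ∫ w, K2 K w * F (t + N.mulVec w)
      = B * ∫ x, g x * (wt K g M t x * (F x / B)) := by
    rw [← hK.integral_wt_mul hgl hM hN hF fun x hx => (hR x hx).1, ← integral_const_mul]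
    refine integral_congr_ae (Filter.Eventually.of_forall fun x => ?_)
    simp only
    rw [key]
    ring
  have e2 : estM K g n M t d = B * ((n : ℝ)⁻¹ * ∑ i, wt K g M t (d i).1 * (F (d i).1 / B))
      + (n : ℝ)⁻¹ * ∑ i, wt K g M t (d i).1 * trunc τ ((d i).2 - F (d i).1) := by
    rw [estM_eq, mul_left_comm, ← mul_add, Finset.mul_sum (a := B), ← Finset.sum_add_distrib]
    congr 1
    refine Finset.sum_congr rfl fun i _ => ?_
    rw [← key, trunc, if_pos (hτ i)]
    ring
  rw [e1, e2, add_sub_right_comm, ← mul_sub]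
  refine (abs_add_le _ _).trans ?_
  rw [abs_mul, abs_of_nonneg hB]
  gcongr

theorem threshold_C1f (P : Pars) (n : ℕ) :
    2 * √2 * 1 * P.gl ^ (-(1/2) : ℝ) * Ksup P.K ^ 2 * √(c1f P n)
          + 8 / 3 * c1f P n * 1 * log n ^ (-((2 + P.ω) / (2 * P.ω))) * P.gl⁻¹ * Ksup P.K ^ 2
      = C1f P n := by
  rw [C1f]
  ring

theorem threshold_C2f (hΩ : P.Ωc ∈ Set.Ioc (0 : ℝ) 1) (hω : 0 < P.ω) (hr : 1 ≤ P.r) {n : ℕ}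
    (hL : 1 ≤ log n) :
    2 * √2 * max √(sigma2 P) 1 * P.gl ^ (-(1/2) : ℝ) * Ksup P.K ^ 2 * √(c2f P n)
          + 8 / 3 * c2f P n * tauf P n * log n ^ (-((2 + P.ω) / (2 * P.ω))) * P.gl⁻¹ * Ksup P.K ^ 2
      = C2f P n := by
  rw [C2f, mul_assoc (8 / 3 * c2f P n), tauf_mul_log_rpow hΩ hω hr hL]
  ring

theorem threshold_C3f (P : Pars) (n : ℕ) :
    2 * √2 * 1 * P.gl ^ (-(1/2) : ℝ) * Ksup P.K ^ 2 * √(c3f P n)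
          + 8 / 3 * c3f P n * 1 * (n * frakh P.ω n ^ 2) ^ (-(1/2) : ℝ) * P.gl⁻¹ * Ksup P.K ^ 2
      = C3f P n := by
  rw [C3f]
  ring

theorem threshold_C4f (P : Pars) (n : ℕ) :
    2 * √2 * max √(sigma2 P) 1 * P.gl ^ (-(1/2) : ℝ) * Ksup P.K ^ 2 * √(c4f P n)
          + 8 / 3 * c4f P n * tauf P n * (n * frakh P.ω n ^ 2) ^ (-(1/2) : ℝ) * P.gl⁻¹
            * Ksup P.K ^ 2
      = C4f P n := by
  rw [C4f]
  ring

theorem exists_set_of_measure_setOf_le {α : Type*} [MeasurableSpace α] {μ : Measure α}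
    {q : α → Prop} {c : ENNReal} (h : μ {a | q a} ≤ c) : ∃ B, μ B ≤ c ∧ ∀ a ∉ B, ¬ q a :=
  ⟨_, h, fun _ => id⟩

/-- Outside of an event of polynomially small probability all kernel estimators are uniformly
close to their means. -/
theorem exists_bad_event {β₀ M : ℝ} {n : ℕ} (H : Regime P β₀ M n) (hΥ : 0 < P.Υ)
    (hΩ : P.Ωc ∈ Set.Ioc (0 : ℝ) 1) (hω : 0 < P.ω) (hK : KernelHyp P.K P.Q)
    (hgl : P.gl ∈ Set.Ioo (0 : ℝ) 1) (hg : DesignOK P.g P.gl) (hr : 1 ≤ P.r)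
    (hp : p ∈ NoiseClass P.Υ P.Ωc P.ω) (hF : Continuous F) {t : Fin 2 → ℝ}
    (ht : ∀ i, |t i| ≤ 1 / 2) {S : ℝ} (hS : 0 ≤ S)
    (hS₁ : ∀ x : Fin 2 → ℝ, (∀ i, |x i| ≤ 5 / 2) → |F x| ≤ S)
    (hS₂ : ∀ v ∈ Set.Icc (fun _ : Fin 2 => -(5/2 : ℝ)) (fun _ => (5/2 : ℝ)),
      ∀ x : Fin 2 → ℝ, (∀ i, |x i - v i| ≤ frakh P.ω n / 2) → |F x| ≤ S + 1) :
    ∃ Bad : Set (Fin n → (Fin 2 → ℝ) × ℝ),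
      dataLaw n P.g p F Bad ≤ ENNReal.ofReal ((2 * P.Υ + 4) * (n : ℝ) ^ (-(4 * P.r))) ∧
      ∀ d ∉ Bad,
        (∀ h ∈ Hgrid P.ω n, ∀ e ∈ S1, ∀ ρ ∈ Set.Icc (1 : ℝ) 2,
          |estM P.K P.g n (win e ρ h) t d - ∫ w, K2 P.K w * F (t + (winInv e ρ h).mulVec w)|
            ≤ (S * C1f P n + C2f P n) * (h * n) ^ (-(1/2) : ℝ)) ∧
        ∀ v ∈ Set.Icc (fun _ : Fin 2 => -(5/2 : ℝ)) (fun _ => (5/2 : ℝ)),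
          |FhatAux P n d v - ∫ w, K2 P.K w * F (v + (auxWinInv (frakh P.ω n)).mulVec w)|
            ≤ (S + 1) * (C3f P n * (n * frakh P.ω n ^ 2) ^ (-(1/2) : ℝ))
              + C4f P n * (n * frakh P.ω n ^ 2) ^ (-(1/2) : ℝ) := by
  have hL := H.one_le_log
  have hτ := one_le_tauf hΩ hω hr hL
  have hn1 : 1 ≤ n := by linarith [H.three_le]
  have hn' : (3 : ℝ) ≤ n := by exact_mod_cast H.three_le
  have hh : frakh P.ω n ∈ Set.Ioc (0 : ℝ) 1 := ⟨H.frakh_pos, H.frakh_le⟩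
  have hhn : 1 ≤ n * frakh P.ω n ^ 2 := by
    rw [nat_mul_frakh_sq _ hn1]
    exact one_le_rpow hL (by positivity)
  have hm0 : 0 < hmin P.ω n := (by positivity : 0 < (n : ℝ)⁻¹).trans_le H.inv_le_hmin
  have hσ : sigma2 P ≤ max √(sigma2 P) 1 ^ 2 := by
    rcases le_total (sigma2 P) 0 with h | h
    · exact h.trans (sq_nonneg _)
    · calc sigma2 P = √(sigma2 P) ^ 2 := (sq_sqrt h).symm
        _ ≤ _ := by gcongr; exact le_max_left _ _
  have hv : ∫ e, p e * trunc (tauf P n) e ^ 2 ≤ max √(sigma2 P) 1 ^ 2 :=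
    (integral_mul_trunc_sq_le hΥ hΩ.1 hω hp _).trans hσ
  have hone : ∫ e, p e * (fun _ => (1 : ℝ)) e ^ 2 ≤ 1 ^ 2 := by
    simp [hp.2.1]
  have hdiv : ∀ {B x : ℝ}, 0 ≤ B → |x| ≤ B → |x / B| ≤ 1 := by
    intro B x hB hx
    rw [abs_div, abs_of_nonneg hB]
    exact div_le_one_of_le₀ hx hB
  have hr0 : 0 ≤ P.r := by linarith
  have hs1 : 1 ≤ max √(sigma2 P) 1 := le_max_right _ _
  have b1 := measure_noise_large_le hg hp hF.measurable n (zero_le_one.trans hτ)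
  rw [mul_exp_tauf hΩ hω hr hn1] at b1
  have b2 := measure_win_dev_le (ψ₁ := fun x => F x / S) (ψ₂ := fun _ => 1) hK hgl hg hp hω
    hF.measurable H.three_le H.inv_le_hmin ht (hF.measurable.div_const S) measurable_const le_rfl
    le_rfl hr0 (fun x hx => hdiv hS (hS₁ x hx)) (by simp) hone (c := c1f P n)
    (by rw [c1f, mul_one])
  have b3 := measure_win_dev_le (ψ₁ := fun _ => 1) (ψ₂ := trunc (tauf P n)) hK hgl hg hp hω
    hF.measurable H.three_le H.inv_le_hmin ht measurable_const (measurable_trunc _) hτ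
    hs1 hr0 (by simp) (abs_trunc_le (zero_le_one.trans hτ)) hv (c := c2f P n) rfl
  have b4 := measure_aux_dev_le (ψ₁ := fun x => F x / (S + 1)) (ψ₂ := fun _ => 1) hK hgl hg hp
    hF.measurable H.three_le hh hhn (hF.measurable.div_const _) measurable_const le_rfl
    le_rfl hr0 (fun v hv x hx => hdiv (by linarith) (hS₂ v hv x hx)) (by simp) hone (c := c3f P n)
    (by rw [c3f, mul_one])
  have b5 := measure_aux_dev_le (ψ₁ := fun _ => 1) (ψ₂ := trunc (tauf P n)) hK hgl hg hp
    hF.measurable H.three_le hh hhn measurable_const (measurable_trunc _) hτ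
    hs1 hr0 (by simp) (abs_trunc_le (zero_le_one.trans hτ)) hv (c := c4f P n) rfl
  rw [threshold_C1f] at b2
  rw [threshold_C2f hΩ hω hr hL] at b3
  rw [threshold_C3f] at b4
  rw [threshold_C4f] at b5
  obtain ⟨B₁, b1, c1⟩ := exists_set_of_measure_setOf_le b1
  obtain ⟨B₂, b2, c2⟩ := exists_set_of_measure_setOf_le b2
  obtain ⟨B₃, b3, c3⟩ := exists_set_of_measure_setOf_le b3
  obtain ⟨B₄, b4, c4⟩ := exists_set_of_measure_setOf_le b4
  obtain ⟨B₅, b5, c5⟩ := exists_set_of_measure_setOf_le b5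
  refine ⟨B₁ ∪ (B₂ ∪ (B₃ ∪ (B₄ ∪ B₅))), ?_, ?_⟩
  · refine (measure_union_le _ _).trans (le_trans (add_le_add b1
      ((measure_union_le _ _).trans (add_le_add b2 ((measure_union_le _ _).trans
      (add_le_add b3 ((measure_union_le _ _).trans (add_le_add b4 b5))))))) ?_)
    have hq : 0 ≤ (n : ℝ) ^ (-(4 * P.r)) := by positivity
    rw [← ENNReal.ofReal_add hq hq, ← ENNReal.ofReal_add hq (by positivity),
      ← ENNReal.ofReal_add hq (by positivity), ← ENNReal.ofReal_add (by positivity) (by positivity)]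
    exact ENNReal.ofReal_le_ofReal (by linarith)
  · intro d hd
    simp only [Set.mem_union, not_or] at hd
    have d1 := c1 d hd.1
    have d2 := c2 d hd.2.1
    have d3 := c3 d hd.2.2.1
    have d4 := c4 d hd.2.2.2.1
    have d5 := c5 d hd.2.2.2.2
    simp only [not_exists, not_and, not_le, not_lt] at d1 d2 d3 d4 d5
    refine ⟨fun h hh' e he ρ hρ => ?_, fun v hv => ?_⟩
    · have hh0 : 0 < h := by linarith [hh'.2.1]
      refine (abs_estM_sub_le hK hgl.1 hp hF (det_win_pos he hρ.1 hh0) (winInv_mul_win he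
        (by linarith [hρ.1]) hh0.ne') ?_ (fun i => (d1 i).le) hS (d2 h hh' e he ρ hρ)
        (d3 h hh' e he ρ hρ)).trans_eq (by ring)
      intro x hne
      obtain ⟨h0, h1⟩ := hK.abs_le_of_K2_ne_zero hne
      have hx := abs_sub_le_of_win he hρ ⟨hh0, hh'.2.2⟩ h0 h1
      have hx' : ∀ i, |x i| ≤ 5 / 2 := fun i => by
        have := abs_sub_abs_le_abs_sub (x i) (t i)
        linarith [hx i, ht i]
      refine ⟨hg.2.2 x ⟨fun i => ?_, fun i => ?_⟩, hS₁ x hx'⟩ <;>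
      · have := abs_le.1 (hx' i)
        simp only
        linarith
    · rw [FhatAux_eq]
      have hdet : 0 < (auxWin (frakh P.ω n)).det := by
        have := hh.1
        rw [det_auxWin]
        positivity
      refine abs_estM_sub_le hK hgl.1 hp hF hdet (auxWinInv_mul_auxWin hh.1.ne') ?_
        (fun i => (d1 i).le) (by linarith) (d4 v hv) (d5 v hv)
      intro x hne
      have hx := abs_sub_le_of_auxWin hK hh.1 hne
      refine ⟨hg.2.2 x ⟨fun i => ?_, fun i => ?_⟩, hS₂ v hv x hx⟩ <;>
      · have h1 := abs_le.1 (hx i)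
        have h2 := hv.1 i
        have h3 := hv.2 i
        simp only at h2 h3 ⊢
        linarith [hh.2]

end GoodEvent

section Constants

variable {P : Pars}

/-- A logarithm of a quantity of polynomial growth is at most a multiple of `log n`. -/
theorem log_budget_le {α β γ A n : ℝ} (hα : 0 ≤ α) (hγ : 0 ≤ γ) (hA : 0 < A) (hn : 0 < n)
    (hL : 1 ≤ log n) {b q : ℝ} (hb : 0 < b) (hbL : log b ≤ q * log n) :
    α * log (A * n ^ 2 * b) + β * log n + γ
      ≤ (α * (|log A| + 2 + q) + β + γ) * log n := by
  rw [log_mul (by positivity) hb.ne', log_mul hA.ne' (by positivity), log_pow]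
  push_cast
  have h1 : log A ≤ |log A| * log n := (le_abs_self _).trans
    (le_mul_of_one_le_right (abs_nonneg _) hL)
  have h2 : γ ≤ γ * log n := le_mul_of_one_le_right hγ hL
  have h3 : α * (log A + 2 * log n + log b) ≤ α * (|log A| * log n + 2 * log n + q * log n) := by
    gcongr
  linarith

theorem exists_log_tauf_le (hΩ : P.Ωc ∈ Set.Ioc (0 : ℝ) 1) (hω : 0 < P.ω) (hr : 1 ≤ P.r) :
    ∃ q : ℝ, ∀ n : ℕ, 1 ≤ log n → log (tauf P n) ≤ q * log n := by
  have h1 : 0 < P.Ωc⁻¹ * (4 * P.r + 1) := mul_pos (inv_pos.2 hΩ.1) (by linarith)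
  refine ⟨1 / P.ω * (|log (P.Ωc⁻¹ * (4 * P.r + 1))| + 1), fun n hL => ?_⟩
  have hL0 : 0 < log n := by linarith
  rw [tauf, log_rpow (by positivity), log_mul h1.ne' hL0.ne', mul_assoc]
  gcongr
  have h2 := log_le_self hL0.le
  have h3 : log (P.Ωc⁻¹ * (4 * P.r + 1)) ≤ |log (P.Ωc⁻¹ * (4 * P.r + 1))| * log n :=
    (le_abs_self _).trans (le_mul_of_one_le_right (abs_nonneg _) hL)
  linarith

theorem exists_bandwise_constants_le (hΩ : P.Ωc ∈ Set.Ioc (0 : ℝ) 1) (hω : 0 < P.ω)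
    (hK : KernelHyp P.K P.Q) (hgl : P.gl ∈ Set.Ioo (0 : ℝ) 1) (hr : 1 ≤ P.r) :
    ∃ a : ℝ, 0 ≤ a ∧ ∀ n : ℕ, 1 ≤ log n →
      (0 ≤ c1f P n ∧ c1f P n ≤ a * log n) ∧ (0 ≤ c2f P n ∧ c2f P n ≤ a * log n) ∧
        (0 ≤ c4f P n ∧ c4f P n ≤ a * log n) := by
  obtain ⟨q, hq⟩ := exists_log_tauf_le hΩ hω hr
  have hQ := hK.half_le_Q
  have hg := one_le_gl_rpow hgl
  have hs2 : 1 ≤ √2 := one_le_sqrt.2 (by norm_num)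
  set A := 16 * P.gl ^ (-(1/2) : ℝ) * (12 * P.Q + √2) with hA
  set A' := 5 * P.Q * P.gl ^ (-(1/2) : ℝ) with hA'
  have hA0 : 1 ≤ A := by
    calc (1 : ℝ) ≤ 16 * 1 * (12 * (1 / 2) + 1) := by norm_num
      _ ≤ A := by rw [hA]; gcongr
  have hA0' : 1 ≤ A' := by
    calc (1 : ℝ) ≤ 5 * (1 / 2) * 1 := by norm_num
      _ ≤ A' := by rw [hA']; gcongr
  refine ⟨(730 * (|log A| + 2 + |q|) + 8 * P.r + 394) + (365 * (|log A'| + 2 + |q|) + 8 * P.r + 197),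
    by positivity, fun n hL => ?_⟩
  have hn0 : n ≠ 0 := by
    rintro rfl
    norm_num at hL
  have hn : (1 : ℝ) ≤ n := by exact_mod_cast Nat.one_le_iff_ne_zero.2 hn0
  have hL0 : 0 < log n := by linarith
  have hτ := one_le_tauf hΩ hω hr hL
  have hqn : log (tauf P n) ≤ |q| * log n :=
    (hq n hL).trans (mul_le_mul_of_nonneg_right (le_abs_self q) hL0.le)
  have h1n : log (1 : ℝ) ≤ |q| * log n := by
    rw [log_one]
    positivity
  have e1 : c1f P n = 730 * log (A * n ^ 2 * 1) + 8 * P.r * log n + 394 := by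
    rw [c1f, hA]; ring_nf
  have e2 : c2f P n = 730 * log (A * n ^ 2 * tauf P n) + 8 * P.r * log n + 394 := by
    rw [c2f, hA]; ring_nf
  have e4 : c4f P n = 365 * log (A' * n ^ 2 * tauf P n) + 8 * P.r * log n + 197 := by
    rw [c4f, hA']; ring_nf
  have l1 : 0 ≤ log (A * n ^ 2 * 1) := log_nonneg (by
    calc (1 : ℝ) = 1 * 1 ^ 2 * 1 := by norm_num
      _ ≤ _ := by gcongr)
  have l2 : 0 ≤ log (A * n ^ 2 * tauf P n) := log_nonneg (by
    calc (1 : ℝ) = 1 * 1 ^ 2 * 1 := by norm_num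
      _ ≤ _ := by gcongr)
  have l4 : 0 ≤ log (A' * n ^ 2 * tauf P n) := log_nonneg (by
    calc (1 : ℝ) = 1 * 1 ^ 2 * 1 := by norm_num
      _ ≤ _ := by gcongr)
  have hn1 : (0 : ℝ) < n := by linarith
  have p1 : 0 ≤ (730 * (|log A| + 2 + |q|) + 8 * P.r + 394) * log n := by positivity
  have p2 : 0 ≤ (365 * (|log A'| + 2 + |q|) + 8 * P.r + 197) * log n := by positivity
  rw [e1, e2, e4, add_mul]
  refine ⟨⟨by positivity, ?_⟩, ⟨by positivity, ?_⟩, by positivity, ?_⟩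
  · linarith [log_budget_le (α := 730) (β := 8 * P.r) (γ := 394) (by norm_num) (by norm_num)
      (by linarith : 0 < A) hn1 hL one_pos h1n]
  · linarith [log_budget_le (α := 730) (β := 8 * P.r) (γ := 394) (by norm_num) (by norm_num)
      (by linarith : 0 < A) hn1 hL (by linarith : 0 < tauf P n) hqn]
  · linarith [log_budget_le (α := 365) (β := 8 * P.r) (γ := 197) (by norm_num) (by norm_num)
      (by linarith : 0 < A') hn1 hL (by linarith : 0 < tauf P n) hqn]

theorem mul_rpow_neg_half_le {L s : ℝ} (hL : 1 ≤ L) (hs : s ≤ -(1/2)) : L * L ^ s ≤ √L := by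
  have hL0 : 0 < L := by linarith
  calc L * L ^ s ≤ L * L ^ (-(1/2) : ℝ) := by
        gcongr
    _ = L ^ (1 : ℝ) * L ^ (-(1/2) : ℝ) := by rw [rpow_one]
    _ = √L := by rw [← rpow_add hL0, sqrt_eq_rpow]; norm_num

/-- Orders of magnitude of the constants of the procedure. -/
theorem exists_constants_le (hΩ : P.Ωc ∈ Set.Ioc (0 : ℝ) 1) (hω : 0 < P.ω)
    (hK : KernelHyp P.K P.Q) (hgl : P.gl ∈ Set.Ioo (0 : ℝ) 1) (hr : 1 ≤ P.r) :
    ∃ C : ℝ, 0 ≤ C ∧ ∀ n : ℕ, 1 ≤ log n →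
      (0 ≤ C1f P n ∧ C1f P n ≤ C * √(log n)) ∧ (0 ≤ C2f P n ∧ C2f P n ≤ C * √(log n)) ∧
        (0 ≤ C4f P n ∧ (n * frakh P.ω n ^ 2) ^ (-(1/2) : ℝ) * C4f P n ≤ C) := by
  obtain ⟨a, ha, hc⟩ := exists_bandwise_constants_le hΩ hω hK hgl hr
  have hκ := hK.one_le_Ksup
  have hg := one_le_gl_rpow hgl
  have hgl0 := hgl.1
  set γ := P.gl ^ (-(1/2) : ℝ)
  set κ := Ksup P.K
  set T := (P.Ωc⁻¹ * (4 * P.r + 1)) ^ ((1 : ℝ) / P.ω)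
  have hT0 : 0 < P.Ωc⁻¹ * (4 * P.r + 1) := mul_pos (inv_pos.2 hΩ.1) (by linarith)
  have hT : 0 < T := by positivity
  set σ := max √(sigma2 P) 1
  have hσ : 1 ≤ σ := le_max_right _ _
  set D := 2 * √2 * σ * γ * κ ^ 2 * √a + 8 / 3 * a * P.gl⁻¹ * κ ^ 2 * (1 + T) with hD
  have hD0 : 0 ≤ D := by positivity
  refine ⟨D, hD0, fun n hL => ?_⟩
  obtain ⟨⟨h1, h1'⟩, ⟨h2, h2'⟩, h4, h4'⟩ := hc n hL
  have hL0 : 0 < log n := by linarith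
  have hn0 : n ≠ 0 := by
    rintro rfl
    norm_num at hL
  have hsq : ∀ c, c ≤ a * log n → √c ≤ √a * √(log n) := fun c hc => by
    rw [← sqrt_mul ha]
    exact sqrt_le_sqrt hc
  have hx1 : log n * log n ^ (-((2 + P.ω) / (2 * P.ω))) ≤ √(log n) := by
    apply mul_rpow_neg_half_le hL
    rw [neg_le_neg_iff, div_le_div_iff₀ (by norm_num) (by positivity)]
    linarith
  have hx2 : log n * log n ^ (-(1/2) : ℝ) ≤ √(log n) := mul_rpow_neg_half_le hL le_rfl
  have hLs : 0 ≤ √(log n) := sqrt_nonneg _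
  refine ⟨⟨?_, ?_⟩, ⟨?_, ?_⟩, ?_, ?_⟩
  · rw [C1f]
    positivity
  · have e1 : 2 * √2 * γ * κ ^ 2 * √(c1f P n) ≤ 2 * √2 * σ * γ * κ ^ 2 * √a * √(log n) := by
      calc _ ≤ 2 * √2 * γ * κ ^ 2 * (√a * √(log n)) := by gcongr; exact hsq _ h1'
        _ ≤ σ * (2 * √2 * γ * κ ^ 2 * (√a * √(log n))) := le_mul_of_one_le_left (by positivity) hσ
        _ = _ := by ring
    have e2 : 8 / 3 * c1f P n * log n ^ (-((2 + P.ω) / (2 * P.ω))) * P.gl⁻¹ * κ ^ 2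
        ≤ 8 / 3 * a * P.gl⁻¹ * κ ^ 2 * (1 + T) * √(log n) := by
      calc _ ≤ 8 / 3 * (a * log n) * log n ^ (-((2 + P.ω) / (2 * P.ω))) * P.gl⁻¹ * κ ^ 2 := by
            gcongr
        _ = 8 / 3 * a * P.gl⁻¹ * κ ^ 2 * (1 + 0)
            * (log n * log n ^ (-((2 + P.ω) / (2 * P.ω)))) := by ring
        _ ≤ _ := by gcongr
    rw [C1f, hD, add_mul]
    exact add_le_add e1 e2
  · rw [C2f]
    positivity
  · have e1 : 2 * √2 * σ * γ * κ ^ 2 * √(c2f P n) ≤ 2 * √2 * σ * γ * κ ^ 2 * √a * √(log n) := by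
      calc _ ≤ 2 * √2 * σ * γ * κ ^ 2 * (√a * √(log n)) := by gcongr; exact hsq _ h2'
        _ = _ := by ring
    have e2 : 8 / 3 * c2f P n * log n ^ (-(1/2) : ℝ) * P.gl⁻¹ * κ ^ 2 * T
        ≤ 8 / 3 * a * P.gl⁻¹ * κ ^ 2 * (1 + T) * √(log n) := by
      calc _ ≤ 8 / 3 * (a * log n) * log n ^ (-(1/2) : ℝ) * P.gl⁻¹ * κ ^ 2 * T := by
            gcongr
        _ = 8 / 3 * a * P.gl⁻¹ * κ ^ 2 * (0 + T) * (log n * log n ^ (-(1/2) : ℝ)) := by ring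
        _ ≤ _ := by gcongr; norm_num
    rw [C2f, hD, add_mul]
    exact add_le_add e1 e2
  · have hτ := one_le_tauf hΩ hω hr hL
    rw [C4f]
    positivity
  · rw [C4f, nat_mul_frakh_sq _ (Nat.one_le_iff_ne_zero.2 hn0)]
    set u := (log n ^ ((1 : ℝ) + 1 / P.ω)) ^ (-(1/2) : ℝ) with hu
    have hu0 : 0 < u := by positivity
    have hu1 : √(log n) * u ≤ 1 := by
      rw [hu, ← rpow_mul hL0.le, sqrt_eq_rpow, ← rpow_add hL0]
      apply rpow_le_one_of_one_le_of_nonpos hL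
      have : 0 < 1 / P.ω := by positivity
      linarith
    have hu2 : tauf P n * log n * u ^ 2 = T := by
      rw [hu, rpow_neg_half_sq (by positivity), tauf, mul_rpow hT0.le hL0.le, rpow_add hL0,
        rpow_one]
      have : log n ^ (1 / P.ω) ≠ 0 := (by positivity : (0:ℝ) < _).ne'
      change _ = (P.Ωc⁻¹ * (4 * P.r + 1)) ^ (1 / P.ω)
      generalize (P.Ωc⁻¹ * (4 * P.r + 1)) ^ (1 / P.ω) = T'
      field_simp
    have hτ := one_le_tauf hΩ hω hr hL
    have e1 : 2 * √2 * σ * γ * κ ^ 2 * √(c4f P n) * u ≤ 2 * √2 * σ * γ * κ ^ 2 * √a := by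
      calc _ ≤ 2 * √2 * σ * γ * κ ^ 2 * (√a * √(log n)) * u := by gcongr; exact hsq _ h4'
        _ = 2 * √2 * σ * γ * κ ^ 2 * √a * (√(log n) * u) := by ring
        _ ≤ 2 * √2 * σ * γ * κ ^ 2 * √a * 1 := by gcongr
        _ = _ := mul_one _
    have e2 : 8 / 3 * tauf P n * c4f P n * u * P.gl⁻¹ * κ ^ 2 * u
        ≤ 8 / 3 * a * P.gl⁻¹ * κ ^ 2 * (1 + T) := by
      calc _ ≤ 8 / 3 * tauf P n * (a * log n) * u * P.gl⁻¹ * κ ^ 2 * u := by gcongr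
        _ = 8 / 3 * a * P.gl⁻¹ * κ ^ 2 * (0 + tauf P n * log n * u ^ 2) := by ring
        _ ≤ _ := by rw [hu2]; gcongr; norm_num
    rw [hD]
    linarith

end Constants

section RidgeFunctions

variable {P : Pars} {K f : ℝ → ℝ} {Q β₀ M : ℝ} {n : ℕ} {θ : Fin 2 → ℝ}

theorem integral_K2 (hK : KernelHyp K Q) : ∫ w, K2 K w = 1 := by
  rw [integral_fin_two]
  have : ∫ z : ℝ × ℝ, K2 K ![z.1, z.2] = (∫ u, K u) * ∫ v, K v := by
    rw [← integral_prod_mul]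
    rfl
  rw [this, hK.norm_one, one_mul]

theorem integral_abs_K2 (K : ℝ → ℝ) : ∫ w, |K2 K w| = K1 K ^ 2 := by
  rw [integral_fin_two]
  have : ∫ z : ℝ × ℝ, |K2 K ![z.1, z.2]| = (∫ u, |K u|) * ∫ v, |K v| := by
    rw [← integral_prod_mul]
    simp only [← abs_mul]
    rfl
  rw [this, K1, sq]

theorem abs_integral_K2_mul_sub_le (hK : KernelHyp K Q) {G : (Fin 2 → ℝ) → ℝ} (hG : Continuous G)
    {c C : ℝ} (h : ∀ w : Fin 2 → ℝ, (∀ i, |w i| ≤ 1 / 2) → |G w - c| ≤ C) :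
    |(∫ w, K2 K w * G w) - c| ≤ K1 K ^ 2 * C := by
  have hi := hK.integrable_K2_mul hG
  have h1 : Integrable (K2 K) := by
    simpa using hK.integrable_K2_mul (continuous_const (y := (1 : ℝ)))
  have h2 : (∫ w, K2 K w * G w) - c = ∫ w, K2 K w * (G w - c) := by
    simp only [mul_sub]
    rw [integral_sub hi (h1.mul_const c), integral_mul_const, integral_K2 hK, one_mul]
  rw [h2, ← integral_abs_K2, ← integral_mul_const, ← Real.norm_eq_abs]
  refine norm_integral_le_of_norm_le (h1.abs.mul_const C) (Filter.Eventually.of_forall fun w => ?_)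
  rw [Real.norm_eq_abs, abs_mul]
  by_cases hw : K2 K w = 0
  · simp [hw]
  · obtain ⟨h0, h1⟩ := hK.abs_le_of_K2_ne_zero hw
    gcongr
    exact h w fun i => by fin_cases i <;> assumption

theorem continuous_dot2 (θ : Fin 2 → ℝ) : Continuous fun x : Fin 2 → ℝ => dot2 x θ := by
  unfold dot2
  fun_prop

theorem abs_ridge_sub_le (hβ : 0 < β₀) (hM : 0 < M) (hf : f ∈ HolderBall β₀ M) (hθ : θ ∈ S1)
    {x v : Fin 2 → ℝ} {δ : ℝ} (h : ∀ i, |x i - v i| ≤ δ / 2) :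
    |f (dot2 x θ) - f (dot2 v θ)| ≤ M * δ ^ β₀ := by
  have e0 := abs_apply_le_one_of_mem_S1 hθ 0
  have e1 := abs_apply_le_one_of_mem_S1 hθ 1
  have h1 : |dot2 x θ - dot2 v θ| ≤ δ := by
    rw [show dot2 x θ - dot2 v θ = (x 0 - v 0) * θ 0 + (x 1 - v 1) * θ 1 by
      rw [dot2, dot2]; ring]
    calc _ ≤ |x 0 - v 0| * |θ 0| + |x 1 - v 1| * |θ 1| := by
          rw [← abs_mul, ← abs_mul]; exact abs_add_le _ _
      _ ≤ δ / 2 * 1 + δ / 2 * 1 := by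
          have := (abs_nonneg _).trans (h 0)
          gcongr
          exacts [h 0, h 1]
      _ = δ := by ring
  refine (abs_sub_le_of_mem_HolderBall hf _ _).trans ?_
  gcongr

/-- On the event where the auxiliary estimator is close to its mean, `F̂_∞` dominates the
supremum of the regression function over the auxiliary box, and it stays bounded. -/
theorem le_FhatInf (H : Regime P β₀ M n) (hβ : 0 < β₀) (hM : 0 < M) (hK : KernelHyp P.K P.Q)
    (hf : f ∈ HolderBall β₀ M) (hθ : θ ∈ S1) {S : ℝ} {d : Fin n → (Fin 2 → ℝ) × ℝ}
    {v₀ : Fin 2 → ℝ} (hv₀ : v₀ ∈ Set.Icc (fun _ : Fin 2 => -(5/2 : ℝ)) (fun _ => (5/2 : ℝ)))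
    (hS₀ : |f (dot2 v₀ θ)| = S)
    (hS : ∀ v ∈ Set.Icc (fun _ : Fin 2 => -(5/2 : ℝ)) (fun _ => (5/2 : ℝ)), |f (dot2 v θ)| ≤ S)
    (hd : ∀ v ∈ Set.Icc (fun _ : Fin 2 => -(5/2 : ℝ)) (fun _ => (5/2 : ℝ)),
      |FhatAux P n d v
          - ∫ w, K2 P.K w * f (dot2 (v + (auxWinInv (frakh P.ω n)).mulVec w) θ)|
        ≤ (S + 1) * (C3f P n * (n * frakh P.ω n ^ 2) ^ (-(1/2) : ℝ))
          + C4f P n * (n * frakh P.ω n ^ 2) ^ (-(1/2) : ℝ)) :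
    S ≤ FhatInf P n d ∧ FhatInf P n d ≤ 3 * S + 4 * C5f P n := by
  have hS0 : 0 ≤ S := hS₀ ▸ abs_nonneg _
  have hH := H.C3_le
  set u := ((n : ℝ) * frakh P.ω n ^ 2) ^ (-(1/2) : ℝ)
  have hC5 : C5f P n = K1 P.K ^ 2 + u * C4f P n + 1 / 2 := rfl
  have hfc := continuous_of_mem_HolderBall hβ hf
  have key : ∀ v ∈ Set.Icc (fun _ : Fin 2 => -(5/2 : ℝ)) (fun _ => (5/2 : ℝ)),
      |FhatAux P n d v - f (dot2 v θ)| ≤ C5f P n + S / 2 := by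
    intro v hv
    have h2 : |(∫ w, K2 P.K w * f (dot2 (v + (auxWinInv (frakh P.ω n)).mulVec w) θ))
        - f (dot2 v θ)| ≤ K1 P.K ^ 2 * 1 := by
      refine abs_integral_K2_mul_sub_le hK ?_ fun w hw => ?_
      · exact hfc.comp ((continuous_dot2 θ).comp
          (continuous_const.add (Continuous.matrix_mulVec continuous_const continuous_id)))
      · refine (abs_ridge_sub_le hβ hM hf hθ fun i => ?_).trans H.holder_frakh
        rw [Pi.add_apply, add_sub_cancel_left, auxWinInv_mulVec, abs_mul, abs_of_pos H.frakh_pos]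
        have := H.frakh_pos
        calc _ ≤ frakh P.ω n * (1 / 2) := by gcongr; exact hw i
          _ = _ := by ring
    have h3 := abs_sub_le (FhatAux P n d v)
      (∫ w, K2 P.K w * f (dot2 (v + (auxWinInv (frakh P.ω n)).mulVec w) θ)) (f (dot2 v θ))
    have h4 : (S + 1) * (C3f P n * u) ≤ (S + 1) * (1 / 2) := by
      gcongr
      linarith
    linarith [hd v hv]
  have hub : ∀ v ∈ Set.Icc (fun _ : Fin 2 => -(5/2 : ℝ)) (fun _ => (5/2 : ℝ)),
      |FhatAux P n d v| ≤ C5f P n + 3 / 2 * S := by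
    intro v hv
    have := abs_sub_abs_le_abs_sub (FhatAux P n d v) (f (dot2 v θ))
    linarith [key v hv, hS v hv]
  constructor
  · have h1 : |FhatAux P n d v₀| ≤ sSup {w | ∃ v ∈ Set.Icc (fun _ : Fin 2 => -(5/2 : ℝ))
        (fun _ : Fin 2 => (5/2 : ℝ)), w = |FhatAux P n d v|} := by
      refine le_csSup ⟨C5f P n + 3 / 2 * S, ?_⟩ ⟨v₀, hv₀, rfl⟩
      rintro _ ⟨v, hv, rfl⟩
      exact hub v hv
    have h2 := abs_sub_abs_le_abs_sub (f (dot2 v₀ θ)) (FhatAux P n d v₀)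
    rw [abs_sub_comm] at h2
    rw [FhatInf]
    linarith [key v₀ hv₀]
  · have h1 : sSup {w | ∃ v ∈ Set.Icc (fun _ : Fin 2 => -(5/2 : ℝ))
        (fun _ : Fin 2 => (5/2 : ℝ)), w = |FhatAux P n d v|} ≤ C5f P n + 3 / 2 * S := by
      refine csSup_le ⟨_, v₀, hv₀, rfl⟩ ?_
      rintro _ ⟨v, hv, rfl⟩
      exact hub v hv
    rw [FhatInf]
    linarith

end RidgeFunctions

section Oracle

variable {P : Pars} {n : ℕ} {t : Fin 2 → ℝ} {d : Fin n → (Fin 2 → ℝ) × ℝ}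

theorem pos_of_mem_Hgrid {ω : ℝ} {n : ℕ} {h : ℝ} (hh : h ∈ Hgrid ω n) : 0 < h := by
  obtain ⟨⟨k, rfl⟩, -⟩ := hh
  positivity

theorem abs_estM_le {K : ℝ → ℝ} {Q D : ℝ} (hK : KernelHyp K Q) (g : (Fin 2 → ℝ) → ℝ) (n : ℕ)
    (t : Fin 2 → ℝ) (d : Fin n → (Fin 2 → ℝ) × ℝ) {E : Matrix (Fin 2) (Fin 2) ℝ}
    (h0 : 0 < E.det) (hD : E.det ≤ D) :
    |estM K g n E t d| ≤ D / n * ∑ i, Ksup K ^ 2 * |(d i).2 / g (d i).1| := by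
  rw [estM, abs_mul, abs_of_nonneg (by positivity)]
  have h1 : |∑ i, K2 K (E.mulVec ((d i).1 - t)) * (d i).2 / g (d i).1|
      ≤ ∑ i, Ksup K ^ 2 * |(d i).2 / g (d i).1| := by
    refine (Finset.abs_sum_le_sum_abs _ _).trans (Finset.sum_le_sum fun i _ => ?_)
    rw [mul_div_assoc, abs_mul]
    gcongr
    exact hK.abs_K2_le _
  have h2 : 0 ≤ D := h0.le.trans hD
  gcongr

theorem exists_abs_estM_le (hK : KernelHyp P.K P.Q) (hm : 0 < hmin P.ω n) (t : Fin 2 → ℝ)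
    (d : Fin n → (Fin 2 → ℝ) × ℝ) :
    ∃ B : ℝ, ∀ η ∈ Hgrid P.ω n, ∀ θ ∈ S1, |estM P.K P.g n (Emat θ η) t d| ≤ B ∧
      ∀ ν ∈ S1, |estM P.K P.g n (Epair θ ν η) t d| ≤ B := by
  refine ⟨(hmin P.ω n / 2)⁻¹ / n * ∑ i, Ksup P.K ^ 2 * |(d i).2 / P.g (d i).1|,
    fun η hη θ hθ => ?_⟩
  have hη0 := pos_of_mem_Hgrid hη
  have key : ∀ e ∈ S1, ∀ ρ ∈ Set.Icc (1 : ℝ) 2, |estM P.K P.g n (win e ρ η) t d|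
      ≤ (hmin P.ω n / 2)⁻¹ / n * ∑ i, Ksup P.K ^ 2 * |(d i).2 / P.g (d i).1| := by
    intro e he ρ hρ
    refine abs_estM_le hK P.g n t d (det_win_pos he hρ.1 hη0) ((det_win_le he hρ.1 hη0).trans ?_)
    gcongr
    exact hη.2.1
  constructor
  · rw [Emat_eq_win]
    exact key θ hθ 1 (by norm_num)
  · intro ν hν
    obtain ⟨e, he, ρ, hρ, hE, -⟩ := exists_Epair_eq_win hθ hν hη0.ne'
    rw [hE]
    exact key e he ρ hρ

/-- A nonnegative functional of the form `sup_η [sup_a φ η a - T η]_+`, the sup being over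
`η ∈ H`, `η ≤ h` and `a ∈ A`. -/
def excess {α : Type*} (H : Set ℝ) (A : Set α) (φ : ℝ → α → ℝ) (T : ℝ → ℝ) (h : ℝ) : ℝ :=
  sSup {v | ∃ η ∈ H, η ≤ h ∧ v = max (sSup {w | ∃ a ∈ A, w = φ η a} - T η) 0}

section Excess

variable {α : Type*} {H : Set ℝ} {A : Set α} {φ : ℝ → α → ℝ} {T : ℝ → ℝ} {h B : ℝ}

theorem excess_nonneg : 0 ≤ excess H A φ T h := by
  refine Real.sSup_nonneg ?_
  rintro _ ⟨η, -, -, rfl⟩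
  exact le_max_right _ _

theorem excess_eq_zero (hT : ∀ η ∈ H, η ≤ h → 0 ≤ T η)
    (hφ : ∀ η ∈ H, η ≤ h → ∀ a ∈ A, φ η a ≤ T η) : excess H A φ T h = 0 := by
  refine le_antisymm (Real.sSup_le ?_ le_rfl) excess_nonneg
  rintro _ ⟨η, hη, hηh, rfl⟩
  refine max_le (sub_nonpos.2 (Real.sSup_le ?_ (hT η hη hηh))) le_rfl
  rintro _ ⟨a, ha, rfl⟩
  exact hφ η hη hηh a ha

theorem le_excess_add (hT : ∀ η ∈ H, 0 ≤ T η) (hB : 0 ≤ B)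
    (hφ : ∀ η ∈ H, ∀ a ∈ A, φ η a ≤ B) {η : ℝ} (hη : η ∈ H) (hηh : η ≤ h) {a : α} (ha : a ∈ A) :
    φ η a ≤ excess H A φ T h + T η := by
  have h1 : φ η a ≤ sSup {w | ∃ a ∈ A, w = φ η a} := by
    refine le_csSup ⟨B, ?_⟩ ⟨a, ha, rfl⟩
    rintro _ ⟨b, hb, rfl⟩
    exact hφ η hη b hb
  have h2 : max (sSup {w | ∃ a ∈ A, w = φ η a} - T η) 0 ≤ excess H A φ T h := by
    refine le_csSup ⟨B, ?_⟩ ⟨η, hη, hηh, rfl⟩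
    rintro _ ⟨η', hη', -, rfl⟩
    refine max_le ?_ hB
    have : sSup {w | ∃ a ∈ A, w = φ η' a} ≤ B := by
      refine Real.sSup_le ?_ hB
      rintro _ ⟨b, hb, rfl⟩
      exact hφ η' hη' b hb
    linarith [hT η' hη']
  linarith [le_max_left (sSup {w | ∃ a ∈ A, w = φ η a} - T η) 0]

end Excess

/-- Deterministic part of the oracle inequality: if the estimators attached to the true index
and to the oracle bandwidth pass the tests of the selection rule, the selected estimator is
within five thresholds of the target. -/
theorem abs_selEst_sub_le (hK : KernelHyp P.K P.Q) (hm : 0 < hmin P.ω n)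
    {sel : (Fin n → (Fin 2 → ℝ) × ℝ) → (Fin 2 → ℝ) × ℝ} (hsel : IsSelector P n t sel)
    (hT : ∀ η ∈ Hgrid P.ω n, 0 ≤ TH P n d η) {θ : Fin 2 → ℝ} (hθ : θ ∈ S1) {h y : ℝ}
    (hh : h ∈ Hgrid P.ω n)
    (h₁ : ∀ η ∈ Hgrid P.ω n, η ≤ h → ∀ ν ∈ S1,
      |estM P.K P.g n (Epair θ ν η) t d - estM P.K P.g n (Emat ν η) t d| ≤ TH P n d η)
    (h₂ : ∀ η ∈ Hgrid P.ω n, η ≤ h → ∀ ν ∈ S1,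
      |estM P.K P.g n (Emat ν h) t d - estM P.K P.g n (Emat ν η) t d| ≤ TH P n d η)
    (h₃ : |estM P.K P.g n (Emat θ h) t d - y| ≤ TH P n d h) :
    |selEst P n t sel d - y| ≤ 5 * TH P n d h := by
  obtain ⟨hθ', hh', hmin⟩ := hsel d
  have hopt := hmin θ hθ h hh
  rw [selEst]
  set θ' := (sel d).1
  set h' := (sel d).2
  obtain ⟨B, hB⟩ := exists_abs_estM_le hK hm t d
  have hB0 : 0 ≤ B := (abs_nonneg _).trans (hB h hh θ hθ).1
  have e1 : R1 P n t θ h d = 0 := excess_eq_zero (fun η hη _ => hT η hη) h₁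
  have e2 : R2 P n t h d = 0 := excess_eq_zero (fun η hη _ => hT η hη) h₂
  have e1' : 0 ≤ R1 P n t θ' h' d := excess_nonneg
  have e2' : 0 ≤ R2 P n t h' d := excess_nonneg
  have e3 : ∀ η ∈ Hgrid P.ω n, η ≤ h' →
      |estM P.K P.g n (Epair θ' θ η) t d - estM P.K P.g n (Emat θ η) t d|
        ≤ R1 P n t θ' h' d + TH P n d η := by
    intro η hη hηh
    refine le_excess_add (φ := fun η ν => |estM P.K P.g n (Epair θ' ν η) t d -
      estM P.K P.g n (Emat ν η) t d|) (B := B + B) hT (by positivity) ?_ hη hηh hθ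
    intro η hη ν hν
    exact (abs_sub _ _).trans (add_le_add ((hB η hη θ' hθ').2 ν hν) (hB η hη ν hν).1)
  have e4 : h ≤ h' → |estM P.K P.g n (Emat θ' h') t d - estM P.K P.g n (Emat θ' h) t d|
        ≤ R2 P n t h' d + TH P n d h := by
    intro hle
    refine le_excess_add (φ := fun η ν => |estM P.K P.g n (Emat ν h') t d -
      estM P.K P.g n (Emat ν η) t d|) (B := B + B) hT (by positivity) ?_ hh hle hθ'
    intro η hη ν hν
    exact (abs_sub _ _).trans (add_le_add (hB h' hh' ν hν).1 (hB η hη ν hν).1)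
  have hTh := hT h hh
  have hTh' := hT h' hh'
  rw [e1, e2] at hopt
  rcases le_or_gt h h' with hle | hlt
  · have a1 := abs_le.1 (e4 hle)
    have a2 := abs_le.1 (h₁ h hh le_rfl θ' hθ')
    have a3 := abs_le.1 (e3 h hh hle)
    have a4 := abs_le.1 h₃
    rw [estM_Epair_comm hK] at a3
    rw [abs_le]
    constructor <;> linarith
  · have a1 := abs_le.1 (h₁ h' hh' hlt.le θ' hθ')
    have a2 := abs_le.1 (e3 h' hh' le_rfl)
    have a3 := abs_le.1 (h₂ h' hh' hlt.le θ hθ)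
    have a4 := abs_le.1 h₃
    rw [estM_Epair_comm hK] at a2
    rw [abs_le]
    constructor <;> linarith

end Oracle

section GoodEvent

variable {P : Pars} {f : ℝ → ℝ} {β₀ M : ℝ} {n : ℕ} {θ t : Fin 2 → ℝ}
  {d : Fin n → (Fin 2 → ℝ) × ℝ}

/-- On the event where all window estimators are close to their means, the selected estimator is
within five oracle thresholds of the target. -/
theorem abs_selEst_sub_le_of_dev (H : Regime P β₀ M n) (hβ : 0 < β₀) (hM : 0 < M)
    (hK : KernelHyp P.K P.Q) (hf : f ∈ HolderBall β₀ M) (hθ : θ ∈ S1)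
    {sel : (Fin n → (Fin 2 → ℝ) × ℝ) → (Fin 2 → ℝ) × ℝ} (hsel : IsSelector P n t sel)
    {S h : ℝ} (hS : 0 ≤ S) (hSF : S ≤ FhatInf P n d) (h1 : 0 ≤ C1f P n) (h2 : 0 ≤ C2f P n)
    (hh : h ∈ Hgrid P.ω n)
    (ho : √(n * h) * DeltaStar P.K f (2 * h) (dot2 t θ) ≤ Ksup P.K * √(log n))
    (hd : ∀ h ∈ Hgrid P.ω n, ∀ e ∈ S1, ∀ ρ ∈ Set.Icc (1 : ℝ) 2,
      |estM P.K P.g n (win e ρ h) t d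
          - ∫ w, K2 P.K w * f (dot2 (t + (winInv e ρ h).mulVec w) θ)|
        ≤ (S * C1f P n + C2f P n) * (h * n) ^ (-(1/2) : ℝ)) :
    |selEst P n t sel d - f (dot2 t θ)| ≤ 5 * TH P n d h := by
  have hn : (0 : ℝ) < n := by have := H.three_le; positivity
  have hm : 0 < hmin P.ω n := (inv_pos.2 hn).trans_le H.inv_le_hmin
  have hκ := hK.one_le_Ksup
  have hh0 := pos_of_mem_Hgrid hh
  set y := dot2 t θ with hy
  set m : ℝ → ℝ := fun b => ∫ v, P.K v * f (y + b * v) with hmdef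
  set u : ℝ → ℝ := fun η => (η * n) ^ (-(1/2) : ℝ) with hu
  set A := S * C1f P n + C2f P n + Ksup P.K ^ 2 * √(log n) with hA
  have hA0 : 0 ≤ A := by positivity
  have hu0 : ∀ η ∈ Hgrid P.ω n, 0 ≤ u η := fun η hη => by
    have := pos_of_mem_Hgrid hη
    positivity
  have hum : ∀ η ∈ Hgrid P.ω n, η ≤ h → u h ≤ u η := fun η hη hηh => by
    have := pos_of_mem_Hgrid hη
    exact rpow_le_rpow_of_nonpos (by positivity) (by gcongr) (by norm_num)
  have hTH : ∀ η ∈ Hgrid P.ω n, 2 * (A * u η) ≤ TH P n d η := fun η hη => by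
    have := hu0 η hη
    rw [TH, mul_assoc]
    have : S * C1f P n ≤ FhatInf P n d * C1f P n := by gcongr
    gcongr
    linarith
  have hbias : Ksup P.K * DeltaStar P.K f (2 * h) y ≤ Ksup P.K ^ 2 * √(log n) * u h := by
    have hs : 0 < √(n * h) := by positivity
    have e : u h = (√(n * h))⁻¹ := by
      simp only [hu]
      rw [rpow_neg (by positivity), sqrt_eq_rpow, mul_comm]
    have : DeltaStar P.K f (2 * h) y ≤ Ksup P.K * √(log n) * (√(n * h))⁻¹ := by
      rw [← div_eq_mul_inv, le_div_iff₀ hs, mul_comm]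
      exact ho
    calc _ ≤ Ksup P.K * (Ksup P.K * √(log n) * (√(n * h))⁻¹) := by gcongr
      _ = _ := by rw [e]; ring
  have key : ∀ η ∈ Hgrid P.ω n, η ≤ h → ∀ e ∈ S1, ∀ ρ ∈ Set.Icc (1 : ℝ) 2,
      |ρ * dot2 e θ| ≤ 2 →
      |estM P.K P.g n (win e ρ η) t d - m (ρ * cross2 e θ)| ≤ A * u η := by
    intro η hη hηh e he ρ hρ hc
    have a1 := hd η hη e he ρ hρ
    have e1 : ∫ w, K2 P.K w * f (dot2 (t + (winInv e ρ η).mulVec w) θ)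
        = smooth P.K f y (η * (ρ * dot2 e θ)) (ρ * cross2 e θ) := by
      simp only [dot2_winInv]
      rfl
    rw [e1] at a1
    have hη0 := pos_of_mem_Hgrid hη
    have a2 := abs_smooth_sub_le hK hM hβ hf (h := 2 * h) (a := η * (ρ * dot2 e θ)) (by
      rw [abs_mul, abs_of_pos hη0]
      calc _ ≤ h * 2 := by gcongr
        _ = _ := mul_comm _ _) y (ρ * cross2 e θ)
    have a3 : Ksup P.K ^ 2 * √(log n) * u h ≤ Ksup P.K ^ 2 * √(log n) * u η := by
      have := hum η hη hηh
      gcongr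
    have a4 := abs_sub_le (estM P.K P.g n (win e ρ η) t d)
      (smooth P.K f y (η * (ρ * dot2 e θ)) (ρ * cross2 e θ)) (m (ρ * cross2 e θ))
    rw [hA, add_mul _ _ (u η)]
    linarith
  have keyE : ∀ η ∈ Hgrid P.ω n, η ≤ h → ∀ ν ∈ S1,
      |estM P.K P.g n (Emat ν η) t d - m (cross2 ν θ)| ≤ A * u η := by
    intro η hη hηh ν hν
    have := key η hη hηh ν hν 1 (by norm_num)
      (by rw [one_mul]; linarith [abs_dot2_le_one hν hθ])
    rwa [one_mul, ← Emat_eq_win] at this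
  refine abs_selEst_sub_le hK hm hsel (fun η hη => ?_) hθ hh ?_ ?_ ?_
  · have := hu0 η hη
    exact le_trans (by positivity) (hTH η hη)
  · intro η hη hηh ν hν
    obtain ⟨e, he, ρ, hρ, hE, hc, hs⟩ := exists_Epair_eq_win hθ hν (pos_of_mem_Hgrid hη).ne'
    have a1 := key η hη hηh e he ρ hρ hc
    rw [hs, ← hE] at a1
    have a2 := keyE η hη hηh ν hν
    rw [abs_sub_comm] at a2
    linarith [abs_sub_le (estM P.K P.g n (Epair θ ν η) t d) (m (cross2 ν θ))
      (estM P.K P.g n (Emat ν η) t d), hTH η hη]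
  · intro η hη hηh ν hν
    have a1 := keyE h hh le_rfl ν hν
    have a2 := keyE η hη hηh ν hν
    rw [abs_sub_comm] at a2
    have a3 : A * u h ≤ A * u η := mul_le_mul_of_nonneg_left (hum η hη hηh) hA0
    linarith [abs_sub_le (estM P.K P.g n (Emat ν h) t d) (m (cross2 ν θ))
      (estM P.K P.g n (Emat ν η) t d), hTH η hη]
  · have a1 := keyE h hh le_rfl θ hθ
    have e1 : m (cross2 θ θ) = f y := by
      have : cross2 θ θ = 0 := by rw [cross2]; ring
      simp only [hmdef, this, zero_mul, add_zero]
      rw [integral_mul_const, hK.norm_one, one_mul]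
    rw [e1] at a1
    have := mul_nonneg hA0 (hu0 h hh)
    linarith [hTH h hh]

end GoodEvent

section HighProbability

variable {P : Pars}

/-- The oracle bound holds outside an event of polynomially small probability. -/
theorem exists_oracle_event {β₀ M : ℝ} (hβ : 0 < β₀) (hM : 0 < M) (hΥ : 0 < P.Υ)
    (hΩ : P.Ωc ∈ Set.Ioc (0 : ℝ) 1) (hω : 0 < P.ω) (hK : KernelHyp P.K P.Q)
    (hgl : P.gl ∈ Set.Ioo (0 : ℝ) 1) (hg : DesignOK P.g P.gl) (hr : 1 ≤ P.r) :
    ∃ C : ℝ, 0 < C ∧ ∀ n : ℕ, Regime P β₀ M n → ∀ f ∈ HolderBall β₀ M, ∀ θ ∈ S1,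
      ∀ p ∈ NoiseClass P.Υ P.Ωc P.ω, ∀ t : Fin 2 → ℝ, (∀ i, |t i| ≤ 1 / 2) →
      ∃ Bad : Set (Fin n → (Fin 2 → ℝ) × ℝ),
        dataLaw n P.g p (fun x => f (dot2 x θ)) Bad
          ≤ ENNReal.ofReal ((2 * P.Υ + 4) * (n : ℝ) ^ (-(4 * P.r))) ∧
        ∀ d ∉ Bad, ∀ sel : (Fin n → (Fin 2 → ℝ) × ℝ) → (Fin 2 → ℝ) × ℝ, IsSelector P n t sel →
          |selEst P n t sel d - f (dot2 t θ)|
            ≤ C * (log n / (n * hstar P.K f P.ω n (dot2 t θ))) ^ ((1 : ℝ) / 2) := by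
  obtain ⟨C, hC0, hC⟩ := exists_constants_le hΩ hω hK hgl hr
  have hκ := hK.one_le_Ksup
  set B := 3 * M + 4 * (K1 P.K ^ 2 + C + 1 / 2) with hB
  have hB0 : 0 < B := by positivity
  refine ⟨20 * (Ksup P.K ^ 2 + B * C + C), by positivity, ?_⟩
  intro n H f hf θ hθ p hp t ht
  obtain ⟨⟨hC1, hC1'⟩, ⟨hC2, hC2'⟩, -, hC4⟩ := hC n H.one_le_log
  have hfc : Continuous fun x : Fin 2 → ℝ => f (dot2 x θ) :=
    (continuous_of_mem_HolderBall hβ hf).comp (continuous_dot2 θ)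
  obtain ⟨v₀, hv₀, hmax⟩ := (isCompact_Icc (a := fun _ : Fin 2 => -(5/2 : ℝ))
    (b := fun _ : Fin 2 => (5/2 : ℝ))).exists_isMaxOn ⟨fun _ => 0, by
      constructor <;> intro i <;> norm_num⟩ hfc.abs.continuousOn
  have hmax' : ∀ v ∈ Set.Icc (fun _ : Fin 2 => -(5/2 : ℝ)) (fun _ => (5/2 : ℝ)),
      |f (dot2 v θ)| ≤ |f (dot2 v₀ θ)| := fun v hv => hmax hv
  set S := |f (dot2 v₀ θ)| with hS
  have hS0 : 0 ≤ S := abs_nonneg _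
  have hSM : S ≤ M := abs_le_of_mem_HolderBall hf _
  obtain ⟨Bad, hBad, hgood⟩ := exists_bad_event H hΥ hΩ hω hK hgl hg hr hp hfc ht hS0
    (fun x hx => hmax' x ⟨fun i => (abs_le.1 (hx i)).1, fun i => (abs_le.1 (hx i)).2⟩)
    (fun v hv x hx => by
      have h1 := (abs_ridge_sub_le hβ hM hf hθ hx).trans H.holder_frakh
      linarith [abs_sub_abs_le_abs_sub (f (dot2 x θ)) (f (dot2 v θ)), hmax' v hv])
  refine ⟨Bad, hBad, fun d hd sel hsel => ?_⟩
  obtain ⟨hdev, haux⟩ := hgood d hd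
  obtain ⟨hFI, hFI'⟩ := le_FhatInf H hβ hM hK hf hθ hv₀ rfl hmax' haux
  obtain ⟨hs0, h, hh, hsh, ho⟩ := exists_oracle_bandwidth hβ hM hK H hf (dot2 t θ)
  have hmain := abs_selEst_sub_le_of_dev H hβ hM hK hf hθ hsel hS0 hFI hC1 hC2 hh ho hdev
  set y := dot2 t θ
  set s := hstar P.K f P.ω n y
  have hn : (0 : ℝ) < n := by have := H.three_le; positivity
  have hh0 := pos_of_mem_Hgrid hh
  have hL := H.one_le_log
  have hFIB : FhatInf P n d ≤ B := by
    have : C5f P n ≤ K1 P.K ^ 2 + C + 1 / 2 := by rw [C5f]; linarith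
    linarith
  have hu : (h * n) ^ (-(1/2) : ℝ) ≤ 2 * (n * s) ^ (-(1/2) : ℝ) := by
    have e : (2 : ℝ) = (1 / 4) ^ (-(1/2) : ℝ) := by
      rw [show (1 / 4 : ℝ) = 2 ^ (-2 : ℝ) by rw [rpow_neg (by norm_num)]; norm_num,
        ← rpow_mul (by norm_num)]
      norm_num
    have e' : 2 * (n * s) ^ (-(1/2) : ℝ) = (1 / 4 * (n * s)) ^ (-(1/2) : ℝ) := by
      rw [mul_rpow (x := 1 / 4) (by norm_num) (by positivity), ← e]
    rw [e']
    refine rpow_le_rpow_of_nonpos (by positivity) ?_ (by norm_num)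
    nlinarith
  have hl : (log n / (n * s)) ^ ((1 : ℝ) / 2) = √(log n) * (n * s) ^ (-(1/2) : ℝ) := by
    rw [div_rpow (by positivity) (by positivity), rpow_neg (by positivity), sqrt_eq_rpow]
    rfl
  have hTH : TH P n d h
      ≤ 2 * ((Ksup P.K ^ 2 + B * C + C) * √(log n)) * (2 * (n * s) ^ (-(1/2) : ℝ)) := by
    rw [TH]
    have e1 : FhatInf P n d * C1f P n ≤ B * (C * √(log n)) := by
      gcongr
    have hFI0 : 0 ≤ FhatInf P n d := hS0.trans hFI
    have e2 : Ksup P.K ^ 2 * √(log n) + FhatInf P n d * C1f P n + C2f P n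
        ≤ (Ksup P.K ^ 2 + B * C + C) * √(log n) := by
      linarith
    gcongr
  rw [hl]
  calc _ ≤ 5 * TH P n d h := hmain
    _ ≤ 5 * (2 * ((Ksup P.K ^ 2 + B * C + C) * √(log n)) * (2 * (n * s) ^ (-(1/2) : ℝ))) := by
        gcongr
    _ = _ := by ring

end HighProbability

section Moments

variable {K : ℝ → ℝ} {g : (Fin 2 → ℝ) → ℝ} {Q gl Υ Ωc ω : ℝ} {p : ℝ → ℝ} {F : (Fin 2 → ℝ) → ℝ}

theorem isProbabilityMeasure_dataLaw (hg : DesignOK g gl) (hp : p ∈ NoiseClass Υ Ωc ω)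
    (hF : Measurable F) (n : ℕ) : IsProbabilityMeasure (dataLaw n g p F) := by
  have := isProbabilityMeasure_jointLaw hg hp hF
  rw [dataLaw]
  infer_instance

theorem exists_residual_moment_le (hΥ : 0 < Υ) (hΩ : 0 < Ωc) (hω : 0 < ω) {q c : ℝ} (hq : 0 < q)
    (hc : 0 ≤ c) (hg : DesignOK g gl) :
    ∃ C : ℝ, 0 ≤ C ∧ ∀ p ∈ NoiseClass Υ Ωc ω, ∀ F : (Fin 2 → ℝ) → ℝ, Measurable F →
      ∀ (n : ℕ) (i : Fin n),
        ∫⁻ d, ENNReal.ofReal ((|(d i).2 - F (d i).1| + c) ^ q) ∂(dataLaw n g p F)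
          ≤ ENNReal.ofReal C := by
  obtain ⟨C, hC0, hC⟩ := exists_noise_moment_le hΥ hΩ hω hq
  refine ⟨2 ^ q * C + (2 * c) ^ q, by positivity, fun p hp F hF n i => ?_⟩
  have hP := isProbabilityMeasure_jointLaw hg hp hF
  have hPn : IsProbabilityMeasure (noiseM p) :=
    isProbabilityMeasure_withDensity_ofReal hp.1 hp.2.1
  have hφ : Measurable fun e : ℝ => ENNReal.ofReal ((|e| + c) ^ q) := by fun_prop
  have h1 := (measurePreserving_eval (fun _ : Fin n => jointLaw g p F) i).lintegral_comp
    (f := fun z : (Fin 2 → ℝ) × ℝ => ENNReal.ofReal ((|z.2 - F z.1| + c) ^ q))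
    (hφ.comp (measurable_snd.sub (hF.comp measurable_fst)))
  rw [lintegral_jointLaw_snd hg hp hF hφ] at h1
  have h2 : ∀ e : ℝ, ENNReal.ofReal ((|e| + c) ^ q)
      ≤ ENNReal.ofReal (2 ^ q) * ENNReal.ofReal (|e| ^ q) + ENNReal.ofReal ((2 * c) ^ q) := by
    intro e
    rw [← ENNReal.ofReal_mul (by positivity), ← ENNReal.ofReal_add (by positivity) (by positivity),
      ← mul_rpow (by norm_num) (abs_nonneg e)]
    refine ENNReal.ofReal_le_ofReal ?_
    rcases le_total |e| c with hec | hec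
    · have : (|e| + c) ^ q ≤ (2 * c) ^ q := by gcongr; linarith
      have : 0 ≤ (2 * |e|) ^ q := by positivity
      linarith
    · have : (|e| + c) ^ q ≤ (2 * |e|) ^ q := by gcongr; linarith
      have : 0 ≤ (2 * c) ^ q := by positivity
      linarith
  calc _ = ∫⁻ e, ENNReal.ofReal ((|e| + c) ^ q) ∂(noiseM p) := h1
    _ ≤ ∫⁻ e, (ENNReal.ofReal (2 ^ q) * ENNReal.ofReal (|e| ^ q) + ENNReal.ofReal ((2 * c) ^ q))
          ∂(noiseM p) := lintegral_mono h2
    _ = ENNReal.ofReal (2 ^ q) * ∫⁻ e, ENNReal.ofReal (|e| ^ q) ∂(noiseM p)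
          + ENNReal.ofReal ((2 * c) ^ q) := by
        rw [lintegral_add_right _ measurable_const, lintegral_const, measure_univ, mul_one,
          lintegral_const_mul _ (by fun_prop)]
    _ ≤ ENNReal.ofReal (2 ^ q) * ENNReal.ofReal C + ENNReal.ofReal ((2 * c) ^ q) := by
        gcongr
        exact hC p hp
    _ = _ := by
        rw [← ENNReal.ofReal_mul (by positivity),
          ← ENNReal.ofReal_add (by positivity) (by positivity)]

theorem lintegral_mean_rpow_le (hF : Measurable F) {q c C B : ℝ} (hq : 1 ≤ q) (hc : 0 ≤ c) (hB : 0 ≤ B) {n : ℕ} (hn : n ≠ 0)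
    (hC : ∀ i : Fin n, ∫⁻ d, ENNReal.ofReal ((|(d i).2 - F (d i).1| + c) ^ q) ∂(dataLaw n g p F)
      ≤ ENNReal.ofReal C) :
    ∫⁻ d, ENNReal.ofReal ((B * ((n : ℝ)⁻¹ * ∑ i, (|(d i).2 - F (d i).1| + c))) ^ q)
        ∂(dataLaw n g p F) ≤ ENNReal.ofReal (B ^ q) * ENNReal.ofReal C := by
  have hn' : (0 : ℝ) < n := by positivity
  have h1 : ∀ d : Fin n → (Fin 2 → ℝ) × ℝ,
      ENNReal.ofReal ((B * ((n : ℝ)⁻¹ * ∑ i, (|(d i).2 - F (d i).1| + c))) ^ q)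
      ≤ ENNReal.ofReal (B ^ q) * (ENNReal.ofReal (n : ℝ)⁻¹ *
        ∑ i, ENNReal.ofReal ((|(d i).2 - F (d i).1| + c) ^ q)) := by
    intro d
    rw [← ENNReal.ofReal_sum_of_nonneg (fun i _ => by positivity),
      ← ENNReal.ofReal_mul (by positivity), ← ENNReal.ofReal_mul (by positivity),
      mul_rpow hB (by positivity)]
    refine ENNReal.ofReal_le_ofReal ?_
    have := Real.rpow_arith_mean_le_arith_mean_rpow Finset.univ (fun _ : Fin n => (n : ℝ)⁻¹)
      (fun i => |(d i).2 - F (d i).1| + c) (fun _ _ => by positivity)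
      (by simp [hn'.ne']) (fun _ _ => by positivity) hq
    rw [← Finset.mul_sum, ← Finset.mul_sum] at this
    gcongr
  calc _ ≤ ∫⁻ d, ENNReal.ofReal (B ^ q) * (ENNReal.ofReal (n : ℝ)⁻¹ *
        ∑ i, ENNReal.ofReal ((|(d i).2 - F (d i).1| + c) ^ q)) ∂(dataLaw n g p F) :=
        lintegral_mono h1
    _ = ENNReal.ofReal (B ^ q) * (ENNReal.ofReal (n : ℝ)⁻¹ *
        ∑ i, ∫⁻ d, ENNReal.ofReal ((|(d i).2 - F (d i).1| + c) ^ q) ∂(dataLaw n g p F)) := by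
        rw [lintegral_const_mul _ (by fun_prop), lintegral_const_mul _ (by fun_prop),
          lintegral_finsetSum _ (fun _ _ => by fun_prop)]
    _ ≤ ENNReal.ofReal (B ^ q) * (ENNReal.ofReal (n : ℝ)⁻¹ *
        ∑ _i : Fin n, ENNReal.ofReal C) := by
        gcongr with i
        exact hC i
    _ = _ := by
        rw [Finset.sum_const, Finset.card_univ, Fintype.card_fin, nsmul_eq_mul, ← mul_assoc
          (ENNReal.ofReal (n : ℝ)⁻¹), ← ENNReal.ofReal_natCast n,
          ← ENNReal.ofReal_mul (by positivity), inv_mul_cancel₀ hn'.ne', ENNReal.ofReal_one,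
          one_mul]

/-- Deterministic bound for a window estimator with bandwidth at least `1/(2n)`. -/
theorem abs_estM_win_le (hK : KernelHyp K Q) (hgl : 0 < gl) (hg : DesignOK g gl) {t : Fin 2 → ℝ}
    (ht : ∀ i, |t i| ≤ 1 / 2) {n : ℕ} (hn : n ≠ 0) {h : ℝ} (hh : (n : ℝ)⁻¹ / 2 ≤ h) (hh1 : h ≤ 1)
    {θ : Fin 2 → ℝ} (hθ : θ ∈ S1) (d : Fin n → (Fin 2 → ℝ) × ℝ) :
    |estM K g n (Emat θ h) t d|
      ≤ 2 * n * Ksup K ^ 2 / gl * ((n : ℝ)⁻¹ * ∑ i, |(d i).2|) := by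
  have hn' : (0 : ℝ) < n := by positivity
  have hh0 : 0 < h := lt_of_lt_of_le (by positivity) hh
  have hρ : (1 : ℝ) ∈ Set.Icc (1 : ℝ) 2 := by norm_num
  have hdet : (win θ 1 h).det ≤ 2 * n := by
    refine (det_win_le hθ le_rfl hh0).trans ?_
    rw [inv_le_comm₀ hh0 (by positivity)]
    calc _ = (n : ℝ)⁻¹ / 2 := by rw [mul_inv]; ring
      _ ≤ h := hh
  have hw : ∀ x, |wt K g (win θ 1 h) t x| ≤ 2 * n * Ksup K ^ 2 / gl := by
    intro x
    refine (hK.abs_wt_le hgl (det_win_pos hθ le_rfl hh0) fun hne => ?_).trans ?_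
    · obtain ⟨h0, h1⟩ := hK.abs_le_of_K2_ne_zero hne
      have hx : ∀ i, |x i| ≤ 3 := fun i => by
        have := abs_sub_le_of_win hθ hρ ⟨hh0, hh1⟩ h0 h1 i
        linarith [abs_sub_abs_le_abs_sub (x i) (t i), ht i]
      exact hg.2.2 x ⟨fun i => (abs_le.1 (hx i)).1, fun i => (abs_le.1 (hx i)).2⟩
    · gcongr
  rw [Emat_eq_win, estM_eq, abs_mul, abs_of_pos (inv_pos.2 hn'), mul_left_comm, Finset.mul_sum]
  gcongr
  refine (Finset.abs_sum_le_sum_abs _ _).trans (Finset.sum_le_sum fun i _ => ?_)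
  rw [abs_mul]
  gcongr
  exact hw _

theorem rpow_le_add_rpow_two_mul {W A r : ℝ} (hW : 0 ≤ W) (hA : 0 < A) (hr : 0 ≤ r) :
    W ^ r ≤ A ^ r + A ^ (-r) * W ^ (2 * r) := by
  rcases le_total W A with h | h
  · have : W ^ r ≤ A ^ r := by gcongr
    have : 0 ≤ A ^ (-r) * W ^ (2 * r) := by positivity
    linarith
  · have hW' : 0 < W := hA.trans_le h
    have h1 : 1 ≤ A ^ (-r) * W ^ r := by
      rw [rpow_neg hA.le, ← div_eq_inv_mul, le_div_iff₀ (by positivity), one_mul]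
      gcongr
    have h2 : W ^ (2 * r) = W ^ r * W ^ r := by rw [← rpow_add hW']; ring_nf
    have h3 : W ^ r * 1 ≤ W ^ r * (A ^ (-r) * W ^ r) := by gcongr
    have : 0 ≤ A ^ r := by positivity
    rw [h2]
    linarith

/-- Splitting of a risk into its values on a good event and a crude envelope on the
complement. -/
theorem lintegral_rpow_le_of_event {X : Type*} [MeasurableSpace X] {μ : Measure X}
    [IsProbabilityMeasure μ] {Z W : X → ℝ} {Bad : Set X} {a A r ε V : ℝ} (hr : 0 ≤ r)
    (ha : 0 ≤ a) (hA : 0 < A) (hε : 0 ≤ ε) (hV : 0 ≤ V) (hZ0 : ∀ d, 0 ≤ Z d)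
    (hZ : ∀ d ∉ Bad, Z d ≤ a) (hZW : ∀ d, Z d ≤ W d) (hBad : μ Bad ≤ ENNReal.ofReal ε)
    (hW : ∫⁻ d, ENNReal.ofReal (W d ^ (2 * r)) ∂μ ≤ ENNReal.ofReal V) :
    ∫ d, Z d ^ r ∂μ ≤ a ^ r + A ^ r * ε + A ^ (-r) * V := by
  set B := toMeasurable μ Bad with hB
  have hBm : MeasurableSet B := measurableSet_toMeasurable _ _
  have hpt : ∀ d, ENNReal.ofReal ‖Z d ^ r‖ ≤ (ENNReal.ofReal (a ^ r)
      + B.indicator (fun _ => ENNReal.ofReal (A ^ r)) d)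
      + ENNReal.ofReal (A ^ (-r)) * ENNReal.ofReal (W d ^ (2 * r)) := by
    intro d
    have h0 := hZ0 d
    rw [Real.norm_of_nonneg (by positivity)]
    by_cases hd : d ∈ Bad
    · rw [Set.indicator_of_mem (subset_toMeasurable μ Bad hd), ← ENNReal.ofReal_mul (by positivity),
        add_assoc, ← ENNReal.ofReal_add (by positivity)
          (mul_nonneg (by positivity) (rpow_nonneg (h0.trans (hZW d)) _))]
      refine le_add_left (ENNReal.ofReal_le_ofReal ?_)
      refine le_trans ?_ (rpow_le_add_rpow_two_mul (h0.trans (hZW d)) hA hr)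
      gcongr
      exact hZW d
    · rw [add_assoc]
      refine le_add_right (ENNReal.ofReal_le_ofReal ?_)
      gcongr
      exact hZ d hd
  have hlin : ∫⁻ d, ENNReal.ofReal ‖Z d ^ r‖ ∂μ
      ≤ ENNReal.ofReal (a ^ r + A ^ r * ε + A ^ (-r) * V) := by
    calc _ ≤ _ := lintegral_mono hpt
      _ = (ENNReal.ofReal (a ^ r) + ENNReal.ofReal (A ^ r) * μ Bad)
          + ENNReal.ofReal (A ^ (-r)) * ∫⁻ d, ENNReal.ofReal (W d ^ (2 * r)) ∂μ := by
          have hm : Measurable fun d => ENNReal.ofReal (a ^ r)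
              + B.indicator (fun _ => ENNReal.ofReal (A ^ r)) d :=
            Measurable.const_add (measurable_const.indicator hBm) _
          rw [lintegral_add_left hm,
            lintegral_add_left measurable_const, lintegral_const, measure_univ, mul_one,
            lintegral_indicator_const hBm, hB, measure_toMeasurable,
            lintegral_const_mul' _ _ ENNReal.ofReal_ne_top]
      _ ≤ (ENNReal.ofReal (a ^ r) + ENNReal.ofReal (A ^ r) * ENNReal.ofReal ε)
          + ENNReal.ofReal (A ^ (-r)) * ENNReal.ofReal V := by gcongr
      _ = _ := by
          rw [← ENNReal.ofReal_mul (by positivity), ← ENNReal.ofReal_mul (by positivity),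
            ← ENNReal.ofReal_add (by positivity) (by positivity),
            ← ENNReal.ofReal_add (by positivity) (by positivity)]
  calc _ ≤ ‖∫ d, Z d ^ r ∂μ‖ := le_abs_self _
    _ ≤ (∫⁻ d, ENNReal.ofReal ‖Z d ^ r‖ ∂μ).toReal := norm_integral_le_lintegral_norm _
    _ ≤ _ := ENNReal.toReal_le_of_le_ofReal (by positivity) hlin

end Moments

end SingleIndex

namespace SingleIndex

/-- Theorem 1, local oracle inequality: there are constants
`c₁, c₂ > 0`, independent of `n` and of `F`, such that for every `n ≥ n₀ ∨ n₁`,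
every `f ∈ F(β₀,M)`, every `θ* ∈ S¹`, every noise density `p ∈ 𝔓` and every
`t ∈ [-1/2,1/2]²`, any estimator `F̂_{(θ̂,ĥ)}` obtained from the selection rule
satisfies `(E_F|F̂_{(θ̂,ĥ)}(t) - F(t)|^r)^{1/r}
  ≤ c₁ (ln n / (n h*_{K,f}(tᵀθ*)))^{1/2} + c₂ n^{-1/2}`. -/
theorem local_oracle_inequality
    (P : Pars) (β₀ M : ℝ)
    (hβ₀ : β₀ ∈ Set.Ioo (0 : ℝ) 1) (hM : 0 < M)
    (hΥ : 0 < P.Υ) (hΩc : P.Ωc ∈ Set.Ioc (0 : ℝ) 1) (hω : 0 < P.ω)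
    (hK : KernelHyp P.K P.Q)
    (hgl : P.gl ∈ Set.Ioo (0 : ℝ) 1) (hg : DesignOK P.g P.gl)
    (hr : 1 ≤ P.r) :
    ∃ c₁ c₂ : ℝ, 0 < c₁ ∧ 0 < c₂ ∧
      ∀ n : ℕ, max (n0 β₀ M P.ω) (n1 P) ≤ n →
      ∀ f ∈ HolderBall β₀ M, ∀ θ ∈ S1, ∀ p ∈ NoiseClass P.Υ P.Ωc P.ω,
      ∀ t ∈ Set.Icc (fun _ : Fin 2 => -(1/2 : ℝ)) (fun _ : Fin 2 => (1/2 : ℝ)),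
      ∀ sel : (Fin n → (Fin 2 → ℝ) × ℝ) → (Fin 2 → ℝ) × ℝ, IsSelector P n t sel →
        (∫ d, |selEst P n t sel d - f (dot2 t θ)| ^ P.r
            ∂(dataLaw n P.g p fun x => f (dot2 x θ))) ^ (1 / P.r)
          ≤ c₁ * (Real.log n / ((n : ℝ) * hstar P.K f P.ω n (dot2 t θ))) ^ ((1:ℝ)/2)
            + c₂ * (n : ℝ) ^ (-(1/2) : ℝ) := by
  have hr0 : 0 < P.r := by linarith
  obtain ⟨c₁, hc₁, hC⟩ := exists_oracle_event hβ₀.1 hM hΥ hΩc hω hK hgl hg hr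
  obtain ⟨V, hV0, hV⟩ := exists_residual_moment_le (q := 2 * P.r) (c := 2 * M) hΥ hΩc.1 hω
    (by positivity) (by positivity) hg
  set b := 2 * Ksup P.K ^ 2 / P.gl with hb
  have hgl0 := hgl.1
  have hκ := hK.one_le_Ksup
  have hb2 : 1 ≤ b := by
    rw [hb, le_div_iff₀ hgl0]
    nlinarith [hgl.2]
  set D := (2 * P.Υ + 4) + b ^ (2 * P.r) * V with hD
  have hD0 : 0 < D := by positivity
  refine ⟨c₁, D ^ (1 / P.r), hc₁, by positivity, ?_⟩
  intro n hn f hf θ hθ p hp t ht sel hsel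
  have H := regime hβ₀.1 hM hK hgl hω hr hn
  have hn1 : 1 ≤ n := le_trans (by norm_num) H.three_le
  have hn0 : (0 : ℝ) < n := by positivity
  have ht' : ∀ i, |t i| ≤ 1 / 2 := fun i => abs_le.2 ⟨ht.1 i, ht.2 i⟩
  have hF : Measurable fun x : Fin 2 → ℝ => f (dot2 x θ) :=
    ((continuous_of_mem_HolderBall hβ₀.1 hf).comp (continuous_dot2 θ)).measurable
  have := isProbabilityMeasure_dataLaw hg hp hF n
  obtain ⟨Bad, hBad, hgood⟩ := hC n H f hf θ hθ p hp t ht'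
  have hs0 := (exists_oracle_bandwidth hβ₀.1 hM hK H hf (dot2 t θ)).1
  set a := c₁ * (log n / (n * hstar P.K f P.ω n (dot2 t θ))) ^ ((1 : ℝ) / 2) with ha
  have ha0 : 0 ≤ a := by
    have := H.one_le_log
    positivity
  have hfM := abs_le_of_mem_HolderBall hf
  have henv : ∀ d, |selEst P n t sel d - f (dot2 t θ)|
      ≤ b * n * ((n : ℝ)⁻¹ * ∑ i, (|(d i).2 - f (dot2 (d i).1 θ)| + 2 * M)) := by
    intro d
    obtain ⟨hθ', hh', -⟩ := hsel d
    have h1 := abs_estM_win_le hK hgl0 hg ht' (by positivity : n ≠ 0)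
      (h := (sel d).2) (by linarith [hh'.2.1, H.inv_le_hmin]) hh'.2.2 hθ' d
    have h2 : |selEst P n t sel d - f (dot2 t θ)|
        ≤ |estM P.K P.g n (Emat (sel d).1 (sel d).2) t d| + M :=
      (abs_sub _ _).trans (add_le_add le_rfl (hfM _))
    have h3 : ∑ i, |(d i).2| + n * M ≤ ∑ i, (|(d i).2 - f (dot2 (d i).1 θ)| + 2 * M) := by
      have : (n : ℝ) * M = ∑ _i : Fin n, M := by simp
      rw [this, ← Finset.sum_add_distrib]
      refine Finset.sum_le_sum fun i _ => ?_
      linarith [abs_sub_abs_le_abs_sub (d i).2 (f (dot2 (d i).1 θ)), hfM (dot2 (d i).1 θ)]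
    have h4 : M ≤ b * n * ((n : ℝ)⁻¹ * (n * M)) := by
      rw [inv_mul_cancel_left₀ hn0.ne']
      refine le_mul_of_one_le_left hM.le (one_le_mul_of_one_le_of_one_le hb2 ?_)
      exact_mod_cast hn1
    calc _ ≤ _ := h2
      _ ≤ 2 * n * Ksup P.K ^ 2 / P.gl * ((n : ℝ)⁻¹ * ∑ i, |(d i).2|)
          + b * n * ((n : ℝ)⁻¹ * (n * M)) := add_le_add h1 h4
      _ = b * n * ((n : ℝ)⁻¹ * (∑ i, |(d i).2| + n * M)) := by rw [hb]; ring
      _ ≤ _ := by gcongr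
  have hmom := lintegral_mean_rpow_le (c := 2 * M) (B := b * n) hF
    (by linarith : 1 ≤ 2 * P.r) (by positivity) (by positivity)
    (by positivity : n ≠ 0) (hV p hp _ hF n)
  rw [← ENNReal.ofReal_mul (by positivity)] at hmom
  have hrisk := lintegral_rpow_le_of_event (A := (n : ℝ) ^ (3 : ℝ)) hr0.le ha0 (by positivity)
    (by positivity) (by positivity) (fun d => abs_nonneg (selEst P n t sel d - f (dot2 t θ)))
    (fun d hd => hgood d hd sel hsel) henv hBad hmom
  have hsum : ((n : ℝ) ^ (3 : ℝ)) ^ P.r * ((2 * P.Υ + 4) * (n : ℝ) ^ (-(4 * P.r)))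
      + ((n : ℝ) ^ (3 : ℝ)) ^ (-P.r) * ((b * n) ^ (2 * P.r) * V)
      = (D ^ (1 / P.r) * (n : ℝ) ^ (-1 : ℝ)) ^ P.r := by
    have e1 : ((n : ℝ) ^ (3 : ℝ)) ^ P.r * (n : ℝ) ^ (-(4 * P.r)) = (n : ℝ) ^ (-P.r) := by
      rw [← rpow_mul hn0.le, ← rpow_add hn0]
      ring_nf
    have e2 : ((n : ℝ) ^ (3 : ℝ)) ^ (-P.r) * (n : ℝ) ^ (2 * P.r) = (n : ℝ) ^ (-P.r) := by
      rw [← rpow_mul hn0.le, ← rpow_add hn0]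
      ring_nf
    have e3 : (D ^ (1 / P.r) * (n : ℝ) ^ (-1 : ℝ)) ^ P.r = D * (n : ℝ) ^ (-P.r) := by
      rw [mul_rpow (by positivity) (by positivity), ← rpow_mul hD0.le,
        one_div_mul_cancel hr0.ne', rpow_one, ← rpow_mul hn0.le, neg_one_mul]
    rw [e3, mul_rpow (by positivity) hn0.le, hD]
    linear_combination (2 * P.Υ + 4) * e1 + b ^ (2 * P.r) * V * e2
  rw [add_assoc, hsum] at hrisk
  calc _ ≤ ((a + D ^ (1 / P.r) * (n : ℝ) ^ (-1 : ℝ)) ^ P.r) ^ (1 / P.r) := by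
        refine rpow_le_rpow (integral_nonneg fun d => by positivity) ?_ (by positivity)
        exact hrisk.trans (add_rpow_le_rpow_add ha0 (by positivity) hr)
    _ = a + D ^ (1 / P.r) * (n : ℝ) ^ (-1 : ℝ) := by
        rw [← rpow_mul (by positivity), mul_one_div_cancel hr0.ne', rpow_one]
    _ ≤ _ := by
        gcongr
        · exact_mod_cast hn1
        · norm_num

end SingleIndex
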